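/- (Theorem 2.5, Maldonado's Harnack inequality under the doubling condition.) Assume the Monge-Ampère measure μ of u is doubling with respect to the center of mass on the sections of u with constants α, β. Then there exist constants τ ∈ (0, 1) and C > 0 depending only on n, β, α such that for every section S_u(x, t) ⊂⊂ Ω and every nonnegative C² function v on S_u(x, t) satisfying ∑_{i,j} U^{ij} ∂_{ij} v = 0 in S_u(x, t), one has sup_{S_u(x, τt)} v ≤ C · inf_{S_u(x, τt)} v. -/

import Mathlib

open MeasureTheory

noncomputable section

/-- Euclidean space `ℝⁿ`. -/
abbrev E (n : ℕ) := EuclideanSpace ℝ (Fin n)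

/-- First partial derivative `∂_i f (x)`. -/
noncomputable def pd {n : ℕ} (f : E n → ℝ) (x : E n) (i : Fin n) : ℝ :=
  fderiv ℝ f x (EuclideanSpace.single i 1)

/-- Second partial derivative `∂_{ij} f (x)`. -/
noncomputable def pd2 {n : ℕ} (f : E n → ℝ) (x : E n) (i j : Fin n) : ℝ :=
  fderiv ℝ (fun y => fderiv ℝ f y (EuclideanSpace.single j 1)) x (EuclideanSpace.single i 1)

/-- Hessian matrix `D²f(x)`. -/
noncomputable def Hess {n : ℕ} (f : E n → ℝ) (x : E n) : Matrix (Fin n) (Fin n) ℝ :=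
  Matrix.of fun i j => pd2 f x i j

/-- The cofactor matrix `U = (det D²u)(D²u)⁻¹` of the Hessian of `u`,
realized as the adjugate. -/
noncomputable def cofU {n : ℕ} (u : E n → ℝ) (x : E n) : Matrix (Fin n) (Fin n) ℝ :=
  (Hess u x).adjugate

/-- Section of the convex function `u`:
`S_u(x₀,t) = {x ∈ cl Ω : u x < u x₀ + ∇u(x₀)·(x - x₀) + t}`. -/
def MASection {n : ℕ} (Ω : Set (E n)) (u : E n → ℝ) (x₀ : E n) (t : ℝ) : Set (E n) :=
  {x ∈ closure Ω | u x < u x₀ + fderiv ℝ u x₀ (x - x₀) + t}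

/-- `A ⊂⊂ B`: the closure of `A` is a compact subset of `B`. -/
def CptIn {n : ℕ} (A B : Set (E n)) : Prop :=
  IsCompact (closure A) ∧ closure A ⊆ B

/-- Uniform convexity of a domain: balls of radius proportional to `‖x - y‖²`
centered at midpoints of points of the closure stay in the closure. -/
def UnifConvex {n : ℕ} (Ω : Set (E n)) : Prop :=
  ∃ δ > 0, ∀ x ∈ closure Ω, ∀ y ∈ closure Ω,
    Metric.closedBall (midpoint ℝ x y) (δ * ‖x - y‖ ^ 2) ⊆ closure Ω

/-- Standing assumptions: `Ω` is a bounded, open, nonempty, uniformly convex domain and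
`u` is a smooth convex function on `cl Ω` vanishing on `∂Ω`. -/
def MASetup {n : ℕ} (Ω : Set (E n)) (u : E n → ℝ) : Prop :=
  IsOpen Ω ∧ Bornology.IsBounded Ω ∧ Ω.Nonempty ∧ UnifConvex Ω ∧
  ContDiffOn ℝ (⊤ : ℕ∞) u (closure Ω) ∧ ConvexOn ℝ (closure Ω) u ∧
  ∀ x ∈ frontier Ω, u x = 0

/-- `λ ≤ det D²u ≤ Λ` in `Ω`. -/
def DetBounds {n : ℕ} (Ω : Set (E n)) (u : E n → ℝ) (lam Lam : ℝ) : Prop :=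
  ∀ x ∈ Ω, lam ≤ (Hess u x).det ∧ (Hess u x).det ≤ Lam

/-- The Monge-Ampère measure of `u`: `μ(A) = ∫_A det D²u`. -/
noncomputable def maMeasure {n : ℕ} (u : E n → ℝ) (A : Set (E n)) : ℝ :=
  ∫ x in A, (Hess u x).det

/-- Center of mass of a set. -/
noncomputable def centerOfMass {n : ℕ} (S : Set (E n)) : E n :=
  (volume S).toReal⁻¹ • ∫ x in S, x

/-- The `α`-dilation of `S` with respect to its center of mass. -/
def dilateCM {n : ℕ} (α : ℝ) (S : Set (E n)) : Set (E n) :=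
  (fun x => centerOfMass S + α • (x - centerOfMass S)) '' S

/-- The Monge-Ampère measure of `u` is doubling with respect to the center of mass
on the sections of `u`, with constants `0 < α < 1 < β`. -/
def DoublingCM {n : ℕ} (Ω : Set (E n)) (u : E n → ℝ) (α β : ℝ) : Prop :=
  0 < α ∧ α < 1 ∧ 1 < β ∧
  ∀ x₀ ∈ Ω, ∀ t : ℝ, 0 < t → CptIn (MASection Ω u x₀ t) Ω →
    maMeasure u (MASection Ω u x₀ t) ≤ β * maMeasure u (dilateCM α (MASection Ω u x₀ (t / 2)))

/-- `g` is a Green's function of the linearized Monge-Ampère operator `L_u` in `V`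
with pole `y`: positive and smooth on `V \ {y}`, `L_u`-harmonic there, vanishing
continuously on `∂V`, and `∫_V g · (L_u φ) = φ(y)` (i.e. `∫_V g · U^{ij}∂_{ij}φ = -φ(y)`)
for all test functions `φ`. -/
def IsGreen {n : ℕ} (u : E n → ℝ) (V : Set (E n)) (y : E n) (g : E n → ℝ) : Prop :=
  (∀ x ∈ V \ {y}, 0 < g x) ∧
  ContDiffOn ℝ (⊤ : ℕ∞) g (V \ {y}) ∧
  (∀ x ∈ V \ {y}, ∑ i, ∑ j, cofU u x i j * pd2 g x i j = 0) ∧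
  ContinuousOn g (closure V \ {y}) ∧
  (∀ x ∈ frontier V, g x = 0) ∧
  ∀ φ : E n → ℝ, ContDiff ℝ (⊤ : ℕ∞) φ → HasCompactSupport φ → tsupport φ ⊆ V →
    (∫ x in V, g x * ∑ i, ∑ j, cofU u x i j * pd2 φ x i j) = -φ y

/-- Capacity of a compact set `K` relative to `V` for the operator `L_u`:
the infimum of `∫_V U^{ij} ∂_iΦ ∂_jΦ` over Lipschitz `Φ` compactly supported in `V`
with `Φ ≥ 1` on `K`. -/
noncomputable def capacity {n : ℕ} (u : E n → ℝ) (K V : Set (E n)) : ℝ :=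
  sInf { e : ℝ | ∃ Φ : E n → ℝ, (∃ L : NNReal, LipschitzWith L Φ) ∧
    HasCompactSupport Φ ∧ tsupport Φ ⊆ V ∧ (∀ x ∈ K, 1 ≤ Φ x) ∧
    e = ∫ x in V, ∑ i, ∑ j, cofU u x i j * pd Φ x i * pd Φ x j }

section

open scoped Topology Matrix

/-- The Hessian matrix as a continuous linear endomorphism. -/
def hessCLM {n : ℕ} (f : E n → ℝ) (x : E n) : E n →L[ℝ] E n :=
  LinearMap.toContinuousLinearMap (Matrix.toEuclideanLin (Hess f x))

lemma pd2_eq_fderiv_fderiv {n : ℕ} {f : E n → ℝ} {x : E n} (hf : ContDiffAt ℝ 2 f x)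
    (i j : Fin n) :
    pd2 f x i j = fderiv ℝ (fderiv ℝ f) x (EuclideanSpace.single i 1)
      (EuclideanSpace.single j 1) := by
  have h1 : DifferentiableAt ℝ (fderiv ℝ f) x :=
    (hf.fderiv_right (m := 1) (by norm_num)).differentiableAt (by norm_num)
  unfold pd2
  rw [fderiv_clm_apply h1 (differentiableAt_const _)]
  simp

lemma hess_isSymm {n : ℕ} {f : E n → ℝ} {x : E n} (hf : ContDiffAt ℝ 2 f x) :
    (Hess f x).IsSymm := by
  ext i j
  have := hf.isSymmSndFDerivAt (by simp)
  simp only [Matrix.transpose_apply, Hess, Matrix.of_apply, pd2_eq_fderiv_fderiv hf]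
  exact this.eq _ _

lemma euclidean_eq_sum_single {n : ℕ} (e : E n) :
    e = ∑ i, e i • (EuclideanSpace.single i (1 : ℝ) : E n) := by
  have := (EuclideanSpace.basisFun (Fin n) ℝ).sum_repr e
  simpa using this.symm

lemma fderiv_fderiv_apply_eq_sum {n : ℕ} {f : E n → ℝ} {x : E n} (hf : ContDiffAt ℝ 2 f x)
    (a b : E n) :
    fderiv ℝ (fderiv ℝ f) x a b = ∑ i, ∑ j, a i * Hess f x i j * b j := by
  conv_lhs => rw [euclidean_eq_sum_single a, euclidean_eq_sum_single b]
  simp only [map_sum, map_smul, _root_.sum_apply, _root_.smul_apply,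
    smul_eq_mul, Hess, Matrix.of_apply, pd2_eq_fderiv_fderiv hf, Finset.mul_sum]
  rw [Finset.sum_comm]
  exact Finset.sum_congr rfl fun i _ => Finset.sum_congr rfl fun j _ => by ring

lemma gradient_apply {n : ℕ} (f : E n → ℝ) (x : E n) (i : Fin n) :
    gradient f x i = pd f x i := by
  have := inner_gradient_left (𝕜 := ℝ) (f := f) (x := x) (y := EuclideanSpace.single i 1)
  rw [EuclideanSpace.inner_single_right] at this
  simpa [pd] using this

lemma inner_gradient {n : ℕ} (f : E n → ℝ) (x y : E n) :
    inner ℝ (gradient f x) y = fderiv ℝ f x y := inner_gradient_left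

lemma hessCLM_apply {n : ℕ} (f : E n → ℝ) (x e : E n) (i : Fin n) :
    hessCLM f x e i = ∑ j, Hess f x i j * e j := by
  simp [hessCLM, Matrix.toLpLin_apply, Matrix.mulVec, dotProduct]

lemma inner_hessCLM {n : ℕ} (f : E n → ℝ) (x a b : E n) :
    inner ℝ (hessCLM f x a) b = ∑ i, ∑ j, b i * Hess f x i j * a j := by
  rw [PiLp.inner_apply]
  refine Finset.sum_congr rfl fun i _ => ?_
  rw [hessCLM_apply]
  simp only [RCLike.inner_apply, conj_trivial, Finset.mul_sum]
  exact Finset.sum_congr rfl fun j _ => by ring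

lemma hasFDerivAt_gradient {n : ℕ} {f : E n → ℝ} {x : E n} (hf : ContDiffAt ℝ 2 f x) :
    HasFDerivAt (gradient f) (hessCLM f x) x := by
  have h1 : DifferentiableAt ℝ (fderiv ℝ f) x :=
    (hf.fderiv_right (m := 1) (by norm_num)).differentiableAt (by norm_num)
  have h2 := ((InnerProductSpace.toDual ℝ (E n)).symm.toContinuousLinearEquiv.toContinuousLinearMap
    |>.restrictScalars ℝ).hasFDerivAt.comp x h1.hasFDerivAt
  refine h2.congr_fderiv ?_
  ext a i
  have key : inner ℝ ((InnerProductSpace.toDual ℝ (E n)).symm (fderiv ℝ (fderiv ℝ f) x a))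
      (EuclideanSpace.single i (1 : ℝ)) = inner ℝ (hessCLM f x a) (EuclideanSpace.single i 1) := by
    rw [InnerProductSpace.toDual_symm_apply, fderiv_fderiv_apply_eq_sum hf, inner_hessCLM,
      Finset.sum_comm]
    refine Finset.sum_congr rfl fun j _ => Finset.sum_congr rfl fun k _ => ?_
    rw [← (hess_isSymm hf).apply k j]
    ring
  rw [EuclideanSpace.inner_single_right, EuclideanSpace.inner_single_right] at key
  simpa using key

lemma det_hessCLM {n : ℕ} (f : E n → ℝ) (x : E n) : (hessCLM f x).det = (Hess f x).det := by
  unfold hessCLM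
  rw [ContinuousLinearMap.det, LinearMap.coe_toContinuousLinearMap]
  rw [← LinearMap.det_toMatrix (EuclideanSpace.basisFun (Fin n) ℝ).toBasis]
  congr 1
  rw [Matrix.toEuclideanLin_eq_toLin_orthonormal, LinearMap.toMatrix_toLin]

/-- Restriction of a `C²` function to a line: first and second derivative. -/
lemma hasDerivAt_line {n : ℕ} {f : E n → ℝ} {x a : E n} {r : ℝ}
    (hf : DifferentiableAt ℝ f (x + r • a)) :
    HasDerivAt (fun r : ℝ => f (x + r • a)) (fderiv ℝ f (x + r • a) a) r := by
  have h : HasDerivAt (fun r : ℝ => x + r • a) a r := by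
    simpa using ((hasDerivAt_id r).smul_const a).const_add x
  exact hf.hasFDerivAt.comp_hasDerivAt r h

lemma hess_posSemidef_of_isLocalMin {n : ℕ} {f : E n → ℝ} {x : E n} (hf : ContDiffAt ℝ 2 f x)
    (hmin : IsLocalMin f x) : (Hess f x).PosSemidef := by
  have key : ∀ a : E n, 0 ≤ fderiv ℝ (fderiv ℝ f) x a a := by
    intro a
    by_contra! hneg
    have hline : Filter.Tendsto (fun r : ℝ => x + r • a) (𝓝 0) (𝓝 x) := by
      have : Continuous (fun r : ℝ => x + r • a) := by fun_prop
      simpa using this.tendsto 0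
    have hev : ∀ᶠ y in 𝓝 x, DifferentiableAt ℝ f y := by
      have := hf.eventually (by simp)
      exact this.mono fun y hy => hy.differentiableAt (by norm_num)
    have hd : deriv (fun r : ℝ => f (x + r • a)) =ᶠ[𝓝 0] fun r => fderiv ℝ f (x + r • a) a := by
      filter_upwards [hline.eventually hev] with r hr
      exact (hasDerivAt_line hr).deriv
    have h1 : DifferentiableAt ℝ (fderiv ℝ f) x :=
      (hf.fderiv_right (m := 1) (by norm_num)).differentiableAt (by norm_num)
    have hl : HasDerivAt (fun r : ℝ => x + r • a) a 0 := by
      simpa using ((hasDerivAt_id (0 : ℝ)).smul_const a).const_add x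
    have hdd : deriv (deriv (fun r : ℝ => f (x + r • a))) 0 = fderiv ℝ (fderiv ℝ f) x a a := by
      rw [hd.deriv_eq]
      have h1' : HasFDerivAt (fderiv ℝ f) (fderiv ℝ (fderiv ℝ f) x) (x + (0 : ℝ) • a) := by
        simpa using h1.hasFDerivAt
      have h2 := h1'.comp_hasDerivAt (0 : ℝ) hl
      have h3 := h2.clm_apply (hasDerivAt_const (0 : ℝ) a)
      simpa using h3.deriv
    have hm0 : IsLocalMin (fun r : ℝ => f (x + r • a)) 0 := by
      have := hline.eventually hmin
      simpa [IsLocalMin, IsMinFilter] using this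
    have hd0 : deriv (fun r : ℝ => f (x + r • a)) 0 = 0 := hm0.deriv_eq_zero
    have hc : ContinuousAt (fun r : ℝ => f (x + r • a)) 0 := by
      apply ContinuousAt.comp (x := (0 : ℝ)) (g := f)
      · simpa using hf.continuousAt
      · fun_prop
    have hM := isLocalMax_of_deriv_deriv_neg (by rw [hdd]; exact hneg) hd0 hc
    have hconst : (fun r : ℝ => f (x + r • a)) =ᶠ[𝓝 0] fun _ => f (x + (0 : ℝ) • a) := by
      filter_upwards [hm0, hM] with r h1 h2
      exact le_antisymm h2 h1
    have : deriv (deriv (fun r : ℝ => f (x + r • a))) 0 = 0 := by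
      have h4 := hconst.deriv
      rw [h4.deriv_eq]
      simp
    rw [hdd] at this
    linarith
  refine Matrix.PosSemidef.of_dotProduct_mulVec_nonneg ?_ ?_
  · rw [Matrix.IsHermitian, Matrix.conjTranspose_eq_transpose_of_trivial]
    exact hess_isSymm hf
  · intro a
    have := key (WithLp.toLp 2 a)
    rw [fderiv_fderiv_apply_eq_sum hf] at this
    simp only [dotProduct, Matrix.mulVec, star_trivial, Finset.mul_sum]
    simpa [mul_assoc] using this

lemma hess_add_smul {n : ℕ} {f g : E n → ℝ} {x : E n} (hf : ContDiffAt ℝ 2 f x)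
    (hg : ContDiffAt ℝ 2 g x) (a b : ℝ) :
    Hess (fun y => a * f y + b * g y) x = a • Hess f x + b • Hess g x := by
  have hfg : ContDiffAt ℝ 2 (fun y => a * f y + b * g y) x :=
    (contDiffAt_const.mul hf).add (contDiffAt_const.mul hg)
  have h1 : fderiv ℝ (fun y => a * f y + b * g y) =ᶠ[𝓝 x]
      fun y => a • fderiv ℝ f y + b • fderiv ℝ g y := by
    filter_upwards [hf.eventually (by simp), hg.eventually (by simp)] with y h1 h2
    have h1' := h1.differentiableAt (by norm_num)
    have h2' := h2.differentiableAt (by norm_num)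
    rw [fderiv_fun_add (h1'.const_mul a) (h2'.const_mul b), fderiv_const_mul h1',
      fderiv_const_mul h2']
  have hdf : DifferentiableAt ℝ (fderiv ℝ f) x :=
    (hf.fderiv_right (m := 1) (by norm_num)).differentiableAt (by norm_num)
  have hdg : DifferentiableAt ℝ (fderiv ℝ g) x :=
    (hg.fderiv_right (m := 1) (by norm_num)).differentiableAt (by norm_num)
  have h2 : HasFDerivAt (fun y => a • fderiv ℝ f y + b • fderiv ℝ g y)
      (a • fderiv ℝ (fderiv ℝ f) x + b • fderiv ℝ (fderiv ℝ g) x) x :=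
    (hdf.hasFDerivAt.const_smul a).add (hdg.hasFDerivAt.const_smul b)
  ext i j
  simp only [Hess, Matrix.of_apply, Matrix.add_apply, Matrix.smul_apply]
  rw [pd2_eq_fderiv_fderiv hfg, pd2_eq_fderiv_fderiv hf, pd2_eq_fderiv_fderiv hg, h1.fderiv_eq,
    h2.fderiv]
  simp

lemma hess_affine {n : ℕ} (p : E n →L[ℝ] ℝ) (c : ℝ) (x : E n) :
    Hess (fun y => p y + c) x = 0 := by
  ext i j
  simp [Hess, pd2]

lemma continuousOn_hess {n : ℕ} {f : E n → ℝ} {s : Set (E n)} (hs : IsOpen s)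
    (hf : ContDiffOn ℝ 2 f s) (i j : Fin n) : ContinuousOn (fun x => Hess f x i j) s := by
  have h1 : ContDiffOn ℝ 1 (fderiv ℝ f) s := hf.fderiv_of_isOpen hs (by norm_num)
  have h2 : ContDiffOn ℝ 0 (fderiv ℝ (fderiv ℝ f)) s := h1.fderiv_of_isOpen hs (by norm_num)
  have h3 := (h2.continuousOn.clm_apply (continuousOn_const (c := EuclideanSpace.single i
    (1 : ℝ)))).clm_apply (continuousOn_const (c := (EuclideanSpace.single j (1 : ℝ) : E n)))
  refine h3.congr fun x hx => ?_
  simp only [Hess, Matrix.of_apply]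
  exact pd2_eq_fderiv_fderiv (hf.contDiffAt (hs.mem_nhds hx)) i j

lemma posSemidef_eq_transpose_mul_self {n : ℕ} {A : Matrix (Fin n) (Fin n) ℝ}
    (hA : A.PosSemidef) : ∃ B : Matrix (Fin n) (Fin n) ℝ, A = Bᵀ * B := by
  open scoped MatrixOrder in
  obtain ⟨B, hB⟩ := CStarAlgebra.nonneg_iff_eq_star_mul_self.mp hA.nonneg
  exact ⟨B, by simpa [Matrix.star_eq_conjTranspose] using hB⟩

/-- AM-GM for the eigenvalues of a positive semidefinite matrix. -/
lemma det_le_trace_div_pow {n : ℕ} (hn : 0 < n) {P : Matrix (Fin n) (Fin n) ℝ}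
    (hP : P.PosSemidef) : P.det ≤ (P.trace / n) ^ n := by
  have hd : P.det = ∏ i, hP.1.eigenvalues i := by
    simpa using hP.1.det_eq_prod_eigenvalues
  have ht : P.trace = ∑ i, hP.1.eigenvalues i := by
    simpa using hP.1.trace_eq_sum_eigenvalues
  have hnn := hP.eigenvalues_nonneg
  have h := Real.geom_mean_le_arith_mean Finset.univ (fun _ => (1 : ℝ)) hP.1.eigenvalues
    (fun _ _ => zero_le_one) (by simpa using hn) (fun i _ => hnn i)
  simp only [Real.rpow_one, Finset.sum_const, Finset.card_univ, Fintype.card_fin, nsmul_eq_mul,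
    mul_one, one_mul] at h
  rw [← hd, ← ht] at h
  have h0 : 0 ≤ P.det := hP.det_nonneg
  calc P.det = (P.det ^ ((n : ℝ)⁻¹)) ^ n := by
        rw [← Real.rpow_natCast, ← Real.rpow_mul h0, inv_mul_cancel₀ (by positivity),
          Real.rpow_one]
    _ ≤ _ := pow_le_pow_left₀ (by positivity) h n

/-- If `A > 0`, `B ≥ 0` and `tr (adj A * B) ≤ n det A`, then `det B ≤ det A`. -/
lemma det_le_det_of_trace_adjugate_mul_le {n : ℕ} (hn : 0 < n)
    {A B : Matrix (Fin n) (Fin n) ℝ} (hA : A.PosDef) (hB : B.PosSemidef)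
    (h : (A.adjugate * B).trace ≤ n * A.det) : B.det ≤ A.det := by
  have hdet := hA.det_pos
  obtain ⟨C, hC⟩ := posSemidef_eq_transpose_mul_self hA.inv.posSemidef
  have hP : (C * B * Cᵀ).PosSemidef := by
    simpa using hB.mul_mul_conjTranspose_same C
  have htr : (C * B * Cᵀ).trace ≤ n := by
    rw [Matrix.trace_mul_comm, ← Matrix.mul_assoc, ← hC, Matrix.inv_def, Matrix.smul_mul,
      Matrix.trace_smul, Ring.inverse_eq_inv', smul_eq_mul, inv_mul_le_iff₀ hdet]
    linarith
  have h1 := det_le_trace_div_pow hn hP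
  have h2 : ((C * B * Cᵀ).trace / n) ^ n ≤ 1 := by
    apply pow_le_one₀
    · exact div_nonneg hP.trace_nonneg (by positivity)
    · rw [div_le_one (by positivity)]; exact htr
  have h3 : (C * B * Cᵀ).det = B.det * A.det⁻¹ := by
    have : A⁻¹.det = A.det⁻¹ := by simp [Matrix.det_nonsing_inv]
    rw [Matrix.det_mul, Matrix.det_mul, ← this, hC, Matrix.det_mul]
    ring
  rw [h3] at h1
  have := h1.trans h2
  rwa [mul_inv_le_iff₀ hdet, one_mul] at this

lemma posDef_add_smul_one {n : ℕ} {A : Matrix (Fin n) (Fin n) ℝ} (hA : A.PosSemidef) {l : ℝ}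
    (hl : 0 < l) : (A + l • (1 : Matrix (Fin n) (Fin n) ℝ)).PosDef :=
  Matrix.PosDef.posSemidef_add hA (Matrix.PosDef.one.smul hl)

lemma adjugate_posDef {n : ℕ} {A : Matrix (Fin n) (Fin n) ℝ} (hA : A.PosDef) :
    A.adjugate.PosDef := by
  have h : A.adjugate = A.det • A⁻¹ := by
    rw [Matrix.inv_def, smul_smul, Ring.inverse_eq_inv', mul_inv_cancel₀ hA.det_pos.ne', one_smul]
  rw [h]
  exact hA.inv.smul hA.det_pos

lemma adjugate_posSemidef {n : ℕ} {A : Matrix (Fin n) (Fin n) ℝ} (hA : A.PosSemidef) :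
    A.adjugate.PosSemidef := by
  refine Matrix.PosSemidef.of_dotProduct_mulVec_nonneg ?_ fun x => ?_
  · rw [Matrix.IsHermitian, Matrix.adjugate_conjTranspose, hA.1.eq]
  · have hc : Continuous fun l : ℝ =>
        star x ⬝ᵥ ((A + l • (1 : Matrix (Fin n) (Fin n) ℝ)).adjugate *ᵥ x) := by
      refine Continuous.dotProduct continuous_const (Continuous.matrix_mulVec ?_ continuous_const)
      exact Continuous.matrix_adjugate (by fun_prop)
    have h0 := hc.continuousWithinAt (s := Set.Ioi 0) (x := 0)
    have h1 : star x ⬝ᵥ (A.adjugate *ᵥ x) =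
        star x ⬝ᵥ ((A + (0 : ℝ) • (1 : Matrix (Fin n) (Fin n) ℝ)).adjugate *ᵥ x) := by simp
    rw [h1]
    refine ge_of_tendsto h0 ?_
    filter_upwards [self_mem_nhdsWithin] with l hl
    exact (adjugate_posDef (posDef_add_smul_one hA hl)).posSemidef.dotProduct_mulVec_nonneg x

/-- Quadratic form of a matrix on Euclidean space. -/
def qf {n : ℕ} (A : Matrix (Fin n) (Fin n) ℝ) (a b : E n) : ℝ := ∑ i, ∑ j, A i j * a i * b j

lemma qf_eq_dotProduct {n : ℕ} (A : Matrix (Fin n) (Fin n) ℝ) (a b : E n) :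
    qf A a b = (WithLp.ofLp a) ⬝ᵥ (A *ᵥ (WithLp.ofLp b)) := by
  simp only [qf, dotProduct, Matrix.mulVec, Finset.mul_sum]
  exact Finset.sum_congr rfl fun i _ => Finset.sum_congr rfl fun j _ => by ring

lemma qf_nonneg {n : ℕ} {A : Matrix (Fin n) (Fin n) ℝ} (hA : A.PosSemidef) (a : E n) :
    0 ≤ qf A a a := by
  rw [qf_eq_dotProduct]
  simpa using hA.dotProduct_mulVec_nonneg (WithLp.ofLp a)

lemma qf_add_left {n : ℕ} (A : Matrix (Fin n) (Fin n) ℝ) (a b c : E n) :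
    qf A (a + b) c = qf A a c + qf A b c := by
  simp [qf_eq_dotProduct, add_dotProduct]

lemma qf_add_right {n : ℕ} (A : Matrix (Fin n) (Fin n) ℝ) (a b c : E n) :
    qf A a (b + c) = qf A a b + qf A a c := by
  simp [qf_eq_dotProduct, Matrix.mulVec_add]

lemma qf_smul_left {n : ℕ} (A : Matrix (Fin n) (Fin n) ℝ) (r : ℝ) (a c : E n) :
    qf A (r • a) c = r * qf A a c := by
  simp [qf_eq_dotProduct]

lemma qf_smul_right {n : ℕ} (A : Matrix (Fin n) (Fin n) ℝ) (r : ℝ) (a c : E n) :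
    qf A a (r • c) = r * qf A a c := by
  simp [qf_eq_dotProduct, Matrix.mulVec_smul]

lemma qf_comm {n : ℕ} {A : Matrix (Fin n) (Fin n) ℝ} (hA : A.IsSymm) (a b : E n) :
    qf A a b = qf A b a := by
  unfold qf
  rw [Finset.sum_comm]
  refine Finset.sum_congr rfl fun i _ => Finset.sum_congr rfl fun j _ => ?_
  rw [hA.apply i j]; ring

lemma isSymm_of_posSemidef {n : ℕ} {A : Matrix (Fin n) (Fin n) ℝ} (hA : A.PosSemidef) :
    A.IsSymm := by
  have := hA.1
  rwa [Matrix.IsHermitian, Matrix.conjTranspose_eq_transpose_of_trivial] at this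

/-- Cauchy-Schwarz for a positive semidefinite form, in weighted AM-GM form. -/
lemma two_mul_qf_le {n : ℕ} {A : Matrix (Fin n) (Fin n) ℝ} (hA : A.PosSemidef) (a b : E n) :
    2 * qf A a b ≤ qf A a a + qf A b b := by
  have h := qf_nonneg hA (a + (-1 : ℝ) • b)
  simp only [qf_add_left, qf_add_right, qf_smul_left, qf_smul_right] at h
  rw [qf_comm (isSymm_of_posSemidef hA) b a] at h
  linarith

lemma qf_adjugate_mulVec {n : ℕ} (A : Matrix (Fin n) (Fin n) ℝ) (a b : E n) :
    qf A.adjugate a (WithLp.toLp 2 (A *ᵥ WithLp.ofLp b)) = A.det * inner ℝ a b := by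
  rw [qf_eq_dotProduct]
  simp only [Matrix.mulVec_mulVec, Matrix.adjugate_mul, Matrix.smul_mulVec, Matrix.one_mulVec,
    PiLp.inner_apply, RCLike.inner_apply, conj_trivial, dotProduct, Pi.smul_apply, smul_eq_mul,
    Finset.mul_sum]
  exact Finset.sum_congr rfl fun i _ => by ring

lemma PosDef.eventually_posSemidef {n : ℕ} {X : Type*} [TopologicalSpace X] {x : X}
    {M : X → Matrix (Fin n) (Fin n) ℝ} (hM : (M x).PosDef) (hc : ∀ i j, ContinuousAt (fun y => M y i j) x)
    (hs : ∀ᶠ y in 𝓝 x, (M y).IsSymm) : ∀ᶠ y in 𝓝 x, (M y).PosSemidef := by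
  have hcpt : IsCompact (Metric.sphere (0 : E n) 1) := isCompact_sphere _ _
  have h1 : ∀ᶠ y in 𝓝 x, ∀ e ∈ Metric.sphere (0 : E n) 1, 0 < qf (M y) e e := by
    refine hcpt.eventually_forall_of_forall_eventually fun e he => ?_
    have hcont : ContinuousAt (fun p : X × E n => qf (M p.1) p.2 p.2) (x, e) := by
      unfold qf
      refine tendsto_finsetSum _ fun i _ => tendsto_finsetSum _ fun j _ => ?_
      refine Filter.Tendsto.mul (Filter.Tendsto.mul ?_ ?_) ?_
      · exact (hc i j).comp (f := fun p : X × E n => p.1) (x := (x, e)) continuousAt_fst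
      · exact Continuous.tendsto (f := fun p : X × E n => p.2 i) (by fun_prop) (x, e)
      · exact Continuous.tendsto (f := fun p : X × E n => p.2 j) (by fun_prop) (x, e)
    have hpos : 0 < qf (M x) e e := by
      rw [qf_eq_dotProduct]
      have hne : WithLp.ofLp e ≠ 0 := by
        intro h
        have : e = 0 := by simpa using h
        simp [this] at he
      simpa using hM.dotProduct_mulVec_pos hne
    exact hcont.eventually (lt_mem_nhds hpos)
  filter_upwards [h1, hs] with y hy hsy
  refine Matrix.PosSemidef.of_dotProduct_mulVec_nonneg ?_ fun a => ?_
  · rw [Matrix.IsHermitian, Matrix.conjTranspose_eq_transpose_of_trivial]; exact hsy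
  · rcases eq_or_ne a 0 with rfl | ha
    · simp
    · set b : E n := WithLp.toLp 2 a with hb
      have hb0 : b ≠ 0 := by simpa [hb] using ha
      have hn0 : 0 < ‖b‖ := norm_pos_iff.mpr hb0
      have h2 := hy (‖b‖⁻¹ • b) (by simp [norm_smul, hn0.ne'])
      rw [qf_smul_left, qf_smul_right] at h2
      have h3 : 0 < qf (M y) b b := by
        have := inv_pos.mpr hn0
        exact (pos_iff_pos_of_mul_pos ((pos_iff_pos_of_mul_pos h2).mp this)).mp this
      rw [qf_eq_dotProduct] at h3
      simpa [hb] using h3.le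

/-- Derivative of the gradient along a line. -/
lemma hasDerivAt_fderiv_line {n : ℕ} {f : E n → ℝ} {x a b : E n} {r : ℝ}
    (hf : DifferentiableAt ℝ (fderiv ℝ f) (x + r • a)) :
    HasDerivAt (fun r : ℝ => fderiv ℝ f (x + r • a) b)
      (fderiv ℝ (fderiv ℝ f) (x + r • a) a b) r := by
  have h : HasDerivAt (fun r : ℝ => x + r • a) a r := by
    simpa using ((hasDerivAt_id r).smul_const a).const_add x
  have h2 := hf.hasFDerivAt.comp_hasDerivAt r h
  simpa using h2.clm_apply (hasDerivAt_const r b)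

/-- The parts of the standing assumptions that are used. -/
structure ConvexSetup {n : ℕ} (Ω : Set (E n)) (u : E n → ℝ) : Prop where
  isOpen : IsOpen Ω
  smooth : ContDiffOn ℝ 3 u Ω
  conv : ConvexOn ℝ (closure Ω) u

lemma MASetup.convexSetup {n : ℕ} {Ω : Set (E n)} {u : E n → ℝ} (h : MASetup Ω u) :
    ConvexSetup Ω u :=
  ⟨h.1, (h.2.2.2.2.1.mono subset_closure).of_le (WithTop.coe_le_coe.mpr (le_top : (3 : ℕ∞) ≤ ⊤)), h.2.2.2.2.2.1⟩

/-- Bregman divergence of `u`: height of the graph over the tangent plane at `y`. -/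
def breg {n : ℕ} (u : E n → ℝ) (y z : E n) : ℝ := u z - u y - fderiv ℝ u y (z - y)

lemma breg_self {n : ℕ} (u : E n → ℝ) (y : E n) : breg u y y = 0 := by simp [breg]

/-- The part of `closure Ω` where the graph of `u` lies below an affine function. -/
def cut {n : ℕ} (Ω : Set (E n)) (u : E n → ℝ) (l : E n →L[ℝ] ℝ) (c : ℝ) : Set (E n) :=
  {z ∈ closure Ω | u z < l z + c}

lemma mem_section_iff {n : ℕ} {Ω : Set (E n)} {u : E n → ℝ} {y z : E n} {s : ℝ} :
    z ∈ MASection Ω u y s ↔ z ∈ closure Ω ∧ breg u y z < s := by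
  unfold MASection breg
  simp only [Set.mem_ofPred_eq]
  constructor <;> rintro ⟨h1, h2⟩ <;> exact ⟨h1, by linarith⟩

lemma section_eq_cut {n : ℕ} (Ω : Set (E n)) (u : E n → ℝ) (y : E n) (s : ℝ) :
    MASection Ω u y s = cut Ω u (fderiv ℝ u y) (u y - fderiv ℝ u y y + s) := by
  ext z
  unfold MASection cut
  simp only [Set.mem_ofPred_eq, map_sub]
  constructor <;> rintro ⟨h1, h2⟩ <;> exact ⟨h1, by linarith⟩

lemma section_mono {n : ℕ} {Ω : Set (E n)} {u : E n → ℝ} {y : E n} {s t : ℝ} (h : s ≤ t) :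
    MASection Ω u y s ⊆ MASection Ω u y t := by
  intro z hz
  rw [mem_section_iff] at *
  exact ⟨hz.1, hz.2.trans_le h⟩

lemma CptIn.mono {n : ℕ} {A B C : Set (E n)} (h : CptIn B C) (hAB : A ⊆ B) : CptIn A C :=
  ⟨h.1.of_isClosed_subset isClosed_closure (closure_mono hAB), (closure_mono hAB).trans h.2⟩

lemma CptIn.subset {n : ℕ} {A B : Set (E n)} (h : CptIn A B) : A ⊆ B :=
  subset_closure.trans h.2

namespace ConvexSetup

variable {n : ℕ} {Ω : Set (E n)} {u : E n → ℝ}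

lemma contDiffAt (S : ConvexSetup Ω u) {x : E n} (hx : x ∈ Ω) : ContDiffAt ℝ 3 u x :=
  S.smooth.contDiffAt (S.isOpen.mem_nhds hx)

lemma contDiffAt_two (S : ConvexSetup Ω u) {x : E n} (hx : x ∈ Ω) : ContDiffAt ℝ 2 u x :=
  (S.contDiffAt hx).of_le (by norm_num)

lemma differentiableAt (S : ConvexSetup Ω u) {x : E n} (hx : x ∈ Ω) : DifferentiableAt ℝ u x :=
  (S.contDiffAt hx).differentiableAt (by norm_num)

lemma continuousOn (S : ConvexSetup Ω u) : ContinuousOn u Ω := S.smooth.continuousOn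

lemma breg_nonneg (S : ConvexSetup Ω u) {y z : E n} (hy : y ∈ Ω) (hz : z ∈ closure Ω) :
    0 ≤ breg u y z := by
  have hline : Filter.Tendsto (fun r : ℝ => r⁻¹ * (u (y + r • (z - y)) - u y)) (𝓝[>] 0)
      (𝓝 (fderiv ℝ u y (z - y))) := by
    have h := hasDerivAt_line (f := u) (x := y) (a := z - y) (r := 0)
      (by simpa using S.differentiableAt hy)
    have := h.tendsto_slope_zero_right
    simpa using this
  have hle : fderiv ℝ u y (z - y) ≤ u z - u y := by
    refine le_of_tendsto hline ?_
    filter_upwards [Ioo_mem_nhdsGT (show (0 : ℝ) < 1 by norm_num)] with r hr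
    have h1 := S.conv.2 (subset_closure hy) hz (sub_nonneg.mpr hr.2.le) hr.1.le (by ring)
    have h2 : (1 - r) • y + r • z = y + r • (z - y) := by
      rw [smul_sub, sub_smul, one_smul]; abel
    rw [h2] at h1
    simp only [smul_eq_mul] at h1
    rw [inv_mul_le_iff₀ hr.1]
    linarith
  unfold breg; linarith

lemma convexOn_breg (S : ConvexSetup Ω u) (y : E n) : ConvexOn ℝ (closure Ω) (breg u y) := by
  have h2 : ConvexOn ℝ (closure Ω) (fun z => - fderiv ℝ u y z + (fderiv ℝ u y y - u y)) := by
    refine ⟨S.conv.1, fun a _ b _ r t _ _ h => le_of_eq ?_⟩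
    simp only [map_add, map_smul, smul_eq_mul]
    have : fderiv ℝ u y y - u y = (r + t) * (fderiv ℝ u y y - u y) := by rw [h, one_mul]
    linarith
  refine (S.conv.add h2).congr fun z _ => ?_
  simp only [breg, Pi.add_apply, map_sub]; ring

/-- Convexity of the divergence along segments. -/
lemma breg_segment (S : ConvexSetup Ω u) {y a b : E n} (ha : a ∈ closure Ω) (hb : b ∈ closure Ω)
    {r : ℝ} (h0 : 0 ≤ r) (h1 : r ≤ 1) :
    breg u y (a + r • (b - a)) ≤ (1 - r) * breg u y a + r * breg u y b := by
  have h := (S.convexOn_breg y).2 ha hb (sub_nonneg.mpr h1) h0 (by ring)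
  have h2 : (1 - r) • a + r • b = a + r • (b - a) := by
    rw [smul_sub, sub_smul, one_smul]; abel
  rw [h2] at h
  simpa using h

lemma closure_segment (S : ConvexSetup Ω u) {a b : E n} (ha : a ∈ closure Ω) (hb : b ∈ closure Ω)
    {r : ℝ} (h0 : 0 ≤ r) (h1 : r ≤ 1) : a + r • (b - a) ∈ closure Ω :=
  S.conv.1.add_smul_sub_mem ha hb ⟨h0, h1⟩

lemma continuousOn_breg (S : ConvexSetup Ω u) (y : E n) : ContinuousOn (breg u y) Ω := by
  unfold breg
  exact (S.continuousOn.sub continuousOn_const).sub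
    ((fderiv ℝ u y).continuous.comp (continuous_id.sub continuous_const)).continuousOn

lemma contDiffAt_breg (S : ConvexSetup Ω u) (y : E n) {z : E n} (hz : z ∈ Ω) :
    ContDiffAt ℝ 3 (breg u y) z := by
  unfold breg
  refine ((S.contDiffAt hz).sub contDiffAt_const).sub ?_
  exact ((fderiv ℝ u y).contDiff.comp (contDiff_id.sub contDiff_const)).contDiffAt

lemma fderiv_breg (S : ConvexSetup Ω u) (y : E n) {z : E n} (hz : z ∈ Ω) :
    HasFDerivAt (breg u y) (fderiv ℝ u z - fderiv ℝ u y) z := by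
  unfold breg
  have h1 := ((S.differentiableAt hz).hasFDerivAt.sub_const (u y))
  have h2 : HasFDerivAt (fun z => fderiv ℝ u y (z - y)) (fderiv ℝ u y) z :=
    ((fderiv ℝ u y).hasFDerivAt.comp z ((hasFDerivAt_id z).sub_const y)).congr_fderiv (by ext; simp)
  exact h1.sub h2

lemma hess_breg (S : ConvexSetup Ω u) (y : E n) {z : E n} (hz : z ∈ Ω) :
    Hess (breg u y) z = Hess u z := by
  have h := hess_add_smul (S.contDiffAt_two hz)
    (g := fun z => fderiv ℝ u y z + (u y - fderiv ℝ u y y)) 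
    ((fderiv ℝ u y).contDiff.add contDiff_const).contDiffAt 1 (-1)
  rw [hess_affine] at h
  simp only [one_smul, smul_zero, add_zero] at h
  rw [← h]
  congr 1
  funext w
  simp only [breg, map_sub]; ring

lemma hess_posSemidef (S : ConvexSetup Ω u) {z : E n} (hz : z ∈ Ω) : (Hess u z).PosSemidef := by
  rw [← S.hess_breg z hz]
  refine hess_posSemidef_of_isLocalMin ((S.contDiffAt_breg z hz).of_le (by norm_num)) ?_
  filter_upwards [S.isOpen.mem_nhds hz] with w hw
  rw [breg_self]
  exact S.breg_nonneg hz (subset_closure hw)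

lemma det_nonneg (S : ConvexSetup Ω u) {z : E n} (hz : z ∈ Ω) : 0 ≤ (Hess u z).det :=
  (S.hess_posSemidef hz).det_nonneg

lemma continuousOn_hess (S : ConvexSetup Ω u) (i j : Fin n) :
    ContinuousOn (fun x => Hess u x i j) Ω :=
  _root_.continuousOn_hess S.isOpen (S.smooth.of_le (by norm_num)) i j

lemma continuousOn_hess' (S : ConvexSetup Ω u) : ContinuousOn (fun x => Hess u x) Ω :=
  continuousOn_pi.mpr fun i => continuousOn_pi.mpr fun j => S.continuousOn_hess i j

lemma continuousOn_det (S : ConvexSetup Ω u) : ContinuousOn (fun x => (Hess u x).det) Ω :=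
  (Continuous.matrix_det continuous_id).comp_continuousOn S.continuousOn_hess'

lemma convex_cut (S : ConvexSetup Ω u) (l : E n →L[ℝ] ℝ) (c : ℝ) : Convex ℝ (cut Ω u l c) := by
  intro a ha b hb r t hr ht h
  refine ⟨S.conv.1 ha.1 hb.1 hr ht h, ?_⟩
  have h1 := S.conv.2 ha.1 hb.1 hr ht h
  simp only [map_add, map_smul, smul_eq_mul] at *
  have e : c = (r + t) * c := by rw [h, one_mul]
  have ha2 := ha.2
  have hb2 := hb.2
  rcases hr.eq_or_lt with h0 | h0
  · have : t = 1 := by linarith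
    subst this; subst h0
    linarith
  · nlinarith [mul_le_mul_of_nonneg_left hb2.le ht, mul_lt_mul_of_pos_left ha2 h0]

lemma convex_section (S : ConvexSetup Ω u) (y : E n) (s : ℝ) : Convex ℝ (MASection Ω u y s) := by
  rw [section_eq_cut]; exact S.convex_cut _ _

lemma isOpen_cut (S : ConvexSetup Ω u) {l : E n →L[ℝ] ℝ} {c : ℝ} (h : CptIn (cut Ω u l c) Ω) :
    IsOpen (cut Ω u l c) := by
  have e : cut Ω u l c = Ω ∩ {z | u z < l z + c} := by
    ext z
    exact ⟨fun hz => ⟨h.subset hz, hz.2⟩, fun hz => ⟨subset_closure hz.1, hz.2⟩⟩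
  rw [e]
  have h1 : ContinuousOn (fun z => u z - (l z + c)) Ω := S.continuousOn.sub (by fun_prop)
  have := h1.isOpen_inter_preimage S.isOpen (isOpen_Iio (a := (0 : ℝ)))
  convert this using 2
  ext z; simp

lemma isOpen_section (S : ConvexSetup Ω u) {y : E n} {s : ℝ} (h : CptIn (MASection Ω u y s) Ω) :
    IsOpen (MASection Ω u y s) := by
  rw [section_eq_cut] at *; exact S.isOpen_cut h

lemma eq_of_mem_closure_cut (S : ConvexSetup Ω u) {l : E n →L[ℝ] ℝ} {c : ℝ}
    (h : CptIn (cut Ω u l c) Ω) {w : E n} (hw : w ∈ closure (cut Ω u l c))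
    (hw' : w ∉ cut Ω u l c) : u w = l w + c := by
  have hwΩ := h.2 hw
  refine le_antisymm ?_ ?_
  · have h1 : ContinuousWithinAt (fun z => u z - (l z + c)) (cut Ω u l c) w :=
      ((S.continuousOn.sub (by fun_prop)).continuousAt (S.isOpen.mem_nhds hwΩ)).continuousWithinAt
    have h2 : (𝓝[cut Ω u l c] w).NeBot := mem_closure_iff_nhdsWithin_neBot.mp hw
    have h3 : u w - (l w + c) ≤ 0 := by
      refine le_of_tendsto h1 ?_
      filter_upwards [self_mem_nhdsWithin] with z hz
      linarith [hz.2]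
    linarith
  · by_contra! hlt
    exact hw' ⟨subset_closure hwΩ, hlt⟩

lemma breg_eq_of_mem_closure (S : ConvexSetup Ω u) {y : E n} {s : ℝ}
    (h : CptIn (MASection Ω u y s) Ω) {w : E n} (hw : w ∈ closure (MASection Ω u y s))
    (hw' : w ∉ MASection Ω u y s) : breg u y w = s := by
  rw [section_eq_cut] at *
  have := S.eq_of_mem_closure_cut h hw hw'
  simp only [breg, map_sub]; linarith

lemma breg_le_of_mem_closure (S : ConvexSetup Ω u) {y : E n} {s : ℝ}
    (h : CptIn (MASection Ω u y s) Ω) {w : E n} (hw : w ∈ closure (MASection Ω u y s)) :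
    breg u y w ≤ s := by
  by_cases hw' : w ∈ MASection Ω u y s
  · exact (mem_section_iff.mp hw').2.le
  · exact (S.breg_eq_of_mem_closure h hw hw').le

end ConvexSetup

lemma exists_interior_min {X : Type*} [TopologicalSpace X] {V : Set X} (hc : IsCompact (closure V))
    {h : X → ℝ} (hh : ContinuousOn h (closure V)) {z : X} (hz : z ∈ V)
    (hb : ∀ w ∈ closure V, w ∉ V → h z ≤ h w) : ∃ y ∈ V, ∀ w ∈ closure V, h y ≤ h w := by
  obtain ⟨y, hy, hmin⟩ := hc.exists_isMinOn ⟨z, subset_closure hz⟩ hh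
  by_cases hyV : y ∈ V
  · exact ⟨y, hyV, fun w hw => hmin hw⟩
  · exact ⟨z, hz, fun w hw => (hb y hy hyV).trans (hmin hw)⟩

lemma isLocalMin_of_open {X : Type*} [TopologicalSpace X] {V : Set X} (ho : IsOpen V)
    {h : X → ℝ} {y : X} (hy : y ∈ V) (hmin : ∀ w ∈ closure V, h y ≤ h w) : IsLocalMin h y := by
  filter_upwards [ho.mem_nhds hy] with w hw using hmin w (subset_closure hw)

namespace ConvexSetup

variable {n : ℕ} {Ω : Set (E n)} {u : E n → ℝ}

/-- A nonempty compactly contained cut is a section around an interior point. -/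
lemma cut_eq_section (S : ConvexSetup Ω u) {l : E n →L[ℝ] ℝ} {c : ℝ}
    (h : CptIn (cut Ω u l c) Ω) (hne : (cut Ω u l c).Nonempty) :
    ∃ y ∈ cut Ω u l c, fderiv ℝ u y = l ∧ cut Ω u l c = MASection Ω u y (l y + c - u y) := by
  obtain ⟨z, hz⟩ := hne
  obtain ⟨y, hy, hmin⟩ := exists_interior_min h.1 (h := fun w => u w - l w)
    ((S.continuousOn.mono h.2).sub (by fun_prop)) hz (fun w hw hw' => by
      have := S.eq_of_mem_closure_cut h hw hw'
      have := hz.2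
      linarith)
  have hl : fderiv ℝ u y = l := by
    have hloc := isLocalMin_of_open (h := fun w => u w - l w) (S.isOpen_cut h) hy hmin
    have h1 : HasFDerivAt (fun w => u w - l w) (fderiv ℝ u y - l) y :=
      (S.differentiableAt (h.subset hy)).hasFDerivAt.sub l.hasFDerivAt
    exact sub_eq_zero.mp (hloc.hasFDerivAt_eq_zero h1)
  refine ⟨y, hy, hl, ?_⟩
  rw [section_eq_cut, hl]
  congr 1; ring

/-- Real measure versus lower integral. -/
lemma integrableOn_det (S : ConvexSetup Ω u) {A : Set (E n)} (hA : CptIn A Ω) :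
    IntegrableOn (fun x => (Hess u x).det) A :=
  ((S.continuousOn_det.mono hA.2).integrableOn_compact hA.1).mono_set subset_closure

lemma ofReal_maMeasure (S : ConvexSetup Ω u) {A : Set (E n)} (hA : CptIn A Ω)
    (hm : MeasurableSet A) :
    ENNReal.ofReal (maMeasure u A) = ∫⁻ x in A, ENNReal.ofReal (Hess u x).det := by
  unfold maMeasure
  rw [ofReal_integral_eq_lintegral_ofReal (S.integrableOn_det hA)]
  filter_upwards [ae_restrict_mem hm] with x hx using S.det_nonneg (hA.subset hx)

lemma maMeasure_nonneg (S : ConvexSetup Ω u) {A : Set (E n)} (hA : A ⊆ Ω)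
    (hm : MeasurableSet A) : 0 ≤ maMeasure u A :=
  setIntegral_nonneg hm fun _ hx => S.det_nonneg (hA hx)

lemma maMeasure_mono (S : ConvexSetup Ω u) {A B : Set (E n)} (hB : CptIn B Ω)
    (hBm : MeasurableSet B) (hAB : A ⊆ B) : maMeasure u A ≤ maMeasure u B :=
  setIntegral_mono_set (S.integrableOn_det hB)
    (by filter_upwards [ae_restrict_mem hBm] with x hx using S.det_nonneg (hB.subset hx))
    (Filter.Eventually.of_forall hAB)

/-- The image of a set under the gradient has volume at most its Monge-Ampère measure. -/
lemma volume_gradient_image_le (S : ConvexSetup Ω u) {A : Set (E n)} (hA : CptIn A Ω)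
    (hm : MeasurableSet A) :
    volume (gradient u '' A) ≤ ENNReal.ofReal (maMeasure u A) := by
  rw [S.ofReal_maMeasure hA hm]
  refine (addHaar_image_le_lintegral_abs_det_fderiv volume hm (f' := hessCLM u)
    fun x hx => (hasFDerivAt_gradient
      (S.contDiffAt_two (hA.subset hx))).hasFDerivWithinAt).trans (le_of_eq ?_)
  refine setLIntegral_congr_fun hm fun x hx => ?_
  rw [det_hessCLM, abs_of_nonneg (S.det_nonneg (hA.subset hx))]

/-- The gradient is injective where the Hessian determinant is positive. -/
lemma eq_of_gradient_eq (S : ConvexSetup Ω u) {y z : E n} (hy : y ∈ Ω) (hz : z ∈ Ω)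
    (hdet : 0 < (Hess u y).det) (h : gradient u y = gradient u z) : y = z := by
  by_contra hne
  have hfd : fderiv ℝ u y = fderiv ℝ u z := by
    ext w; rw [← inner_gradient, ← inner_gradient, h]
  have h1 := S.breg_nonneg hy (subset_closure hz)
  have h2 := S.breg_nonneg hz (subset_closure hy)
  have h0 : breg u y z = 0 := by
    have : breg u y z + breg u z y = 0 := by
      simp only [breg, hfd, map_sub]; ring
    linarith
  have hpd : (Hess u y).PosDef :=
    (S.hess_posSemidef hy).posDef_iff_det_ne_zero.mpr hdet.ne'
  set a := z - y with ha
  have ha0 : a ≠ 0 := sub_ne_zero.mpr (Ne.symm hne)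
  have hpos : 0 < fderiv ℝ (fderiv ℝ u) y a a := by
    rw [fderiv_fderiv_apply_eq_sum (S.contDiffAt_two hy)]
    have h3 : WithLp.ofLp a ≠ 0 := by simpa using ha0
    have := hpd.dotProduct_mulVec_pos h3
    simpa [dotProduct, Matrix.mulVec, Finset.mul_sum, mul_assoc] using this
  have hd1 : DifferentiableAt ℝ (fderiv ℝ u) y :=
    ((S.contDiffAt_two hy).fderiv_right (m := 1) (by norm_num)).differentiableAt (by norm_num)
  have hg : HasDerivAt (fun r : ℝ => fderiv ℝ u (y + r • a) a) (fderiv ℝ (fderiv ℝ u) y a a) 0 := by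
    simpa using hasDerivAt_fderiv_line (r := 0) (a := a) (b := a) (by simpa using hd1)
  have hsl := hg.tendsto_slope_zero_right
  have hev1 := hsl.eventually (lt_mem_nhds hpos)
  have hevΩ : ∀ᶠ r : ℝ in 𝓝[>] 0, y + r • a ∈ Ω := by
    have hcont : Continuous (fun r : ℝ => y + r • a) := by fun_prop
    have := (hcont.tendsto 0).eventually (S.isOpen.mem_nhds (by simpa using hy))
    exact this.filter_mono nhdsWithin_le_nhds
  obtain ⟨r, hr1, hrΩ, hr⟩ :=
    (hev1.and (hevΩ.and (Ioo_mem_nhdsGT (show (0 : ℝ) < 1 by norm_num)))).exists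
  simp only [zero_add, zero_smul, add_zero, smul_eq_mul] at hr1
  have hr2 : fderiv ℝ u y a < fderiv ℝ u (y + r • a) a := by
    have := (mul_pos_iff_of_pos_left (inv_pos.mpr hr.1)).mp hr1
    linarith
  have h4 := S.breg_nonneg hrΩ (subset_closure hz)
  have h5 := S.breg_nonneg hy (subset_closure hrΩ)
  have e1 : z - (y + r • a) = (1 - r) • a := by rw [sub_smul, one_smul, ha]; abel
  have e2 : y + r • a - y = r • a := by abel
  have h6 : breg u y z = u z - u y - fderiv ℝ u y a := rfl
  rw [breg, e1, map_smul, smul_eq_mul] at h4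
  rw [breg, e2, map_smul, smul_eq_mul] at h5
  nlinarith [mul_pos (sub_pos.mpr hr.2) (sub_pos.mpr hr2)]

end ConvexSetup

end

section

open scoped Topology Matrix Pointwise

/-- The polar of `K` with respect to the base point `z`. -/
def polarAt {n : ℕ} (K : Set (E n)) (z : E n) : Set (E n) :=
  {q | ∀ w ∈ K, inner ℝ q (w - z) ≤ 1}

lemma isClosed_polarAt {n : ℕ} (K : Set (E n)) (z : E n) : IsClosed (polarAt K z) := by
  have : polarAt K z = ⋂ w ∈ K, {q | inner ℝ q (w - z) ≤ 1} := by
    ext q; simp [polarAt]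
  rw [this]
  exact isClosed_biInter fun w _ => isClosed_le (by fun_prop) (by fun_prop)

lemma volume_image_add_smul {n : ℕ} (g : E n) {h : ℝ} (hh : 0 ≤ h) (P : Set (E n)) :
    volume ((fun q => g + h • q) '' P) = ENNReal.ofReal (h ^ n) * volume P := by
  have : (fun q => g + h • q) '' P = (fun q => g + q) '' (h • P) := by
    rw [← Set.image_smul, Set.image_image]
  rw [this, Set.image_add_left, measure_preimage_add, Measure.addHaar_smul_of_nonneg _ hh]
  simp

lemma volume_polarAt_lt_top {n : ℕ} {K : Set (E n)} {z : E n} (ho : IsOpen K) (hz : z ∈ K) :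
    volume (polarAt K z) < ⊤ := by
  obtain ⟨r, hr, hball⟩ := Metric.isOpen_iff.mp ho z hz
  refine (measure_mono (t := Metric.closedBall 0 (2 / r)) fun q hq => ?_).trans_lt
    measure_closedBall_lt_top
  rw [mem_closedBall_zero_iff]
  rcases eq_or_ne q 0 with rfl | hq0
  · simp only [norm_zero]; positivity
  have hn : 0 < ‖q‖ := norm_pos_iff.mpr hq0
  have hmem : z + (r / 2 / ‖q‖) • q ∈ K := by
    apply hball
    rw [mem_ball_iff_norm, add_sub_cancel_left, norm_smul, Real.norm_of_nonneg (by positivity),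
      div_mul_cancel₀ _ hn.ne']
    linarith
  have := hq _ hmem
  rw [add_sub_cancel_left, inner_smul_right, real_inner_self_eq_norm_sq] at this
  rw [le_div_iff₀ hr]
  have e : r / 2 / ‖q‖ * ‖q‖ ^ 2 = r / 2 * ‖q‖ := by field_simp
  rw [e] at this
  linarith

lemma volume_polarAt_pos {n : ℕ} {K : Set (E n)} (z : E n) (hb : Bornology.IsBounded K) :
    0 < volume (polarAt K z) := by
  obtain ⟨R, hR, hK⟩ := hb.subset_closedBall_lt 0 z
  refine (Metric.measure_ball_pos volume (0 : E n) (inv_pos.mpr hR)).trans_le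
    (measure_mono fun q hq w hw => ?_)
  rw [mem_ball_zero_iff] at hq
  have h1 := hK hw
  rw [mem_closedBall_iff_norm] at h1
  calc inner ℝ q (w - z) ≤ ‖q‖ * ‖w - z‖ := real_inner_le_norm _ _
    _ ≤ R⁻¹ * R := by gcongr
    _ = 1 := inv_mul_cancel₀ hR.ne'

/-- A half-space bound at the center of mass of a convex body. -/
lemma centerOfMass_bound {n : ℕ} {Q : Set (E n)} (ho : IsOpen Q) (hc : Convex ℝ Q)
    (hb : Bornology.IsBounded Q) (l : E n →L[ℝ] ℝ) {M : ℝ} (hM : ∀ x ∈ Q, l x ≤ M) {w : E n}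
    (hw : w ∈ Q) : (M - l w) ≤ 2 ^ (n + 1) * (M - l (centerOfMass Q)) := by
  have hvt : volume Q ≠ ⊤ := hb.measure_lt_top.ne
  have hv0 : 0 < (volume Q).toReal :=
    ENNReal.toReal_pos (ho.measure_pos volume ⟨w, hw⟩).ne' hvt
  have hQc : IsCompact (closure Q) := hb.isCompact_closure
  have hid : IntegrableOn (fun x : E n => x) Q :=
    (continuousOn_id.integrableOn_compact hQc).mono_set subset_closure
  have h_int : IntegrableOn (fun x : E n => M - l x) Q :=
    ((by fun_prop : ContinuousOn (fun x : E n => M - l x)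
      (closure Q)).integrableOn_compact hQc).mono_set subset_closure
  have h1 : ∫ x in Q, (M - l x) = (volume Q).toReal * (M - l (centerOfMass Q)) := by
    have hcst : Integrable (fun _ : E n => M) (volume.restrict Q) := integrableOn_const hvt
    rw [integral_sub hcst (l.integrable_comp hid), l.integral_comp_comm hid]
    simp only [setIntegral_const, centerOfMass, map_smul, smul_eq_mul, Measure.real]
    field_simp
  set Q' : Set (E n) := (fun x => (1 / 2 : ℝ) • w + (1 / 2 : ℝ) • x) '' Q with hQ'
  have hsub : Q' ⊆ Q := by
    rintro _ ⟨x, hx, rfl⟩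
    exact hc hw hx (by norm_num) (by norm_num) (by norm_num)
  have hQ'm : MeasurableSet Q' := by
    have : Q' = (fun x => (1 / 2 : ℝ) • w + x) '' ((1 / 2 : ℝ) • Q) := by
      rw [← Set.image_smul, Set.image_image]
    rw [this, Set.image_add_left]
    exact (measurable_const_add _) (ho.measurableSet.const_smul₀ _)
  have hvol : (volume Q').toReal = (1 / 2) ^ n * (volume Q).toReal := by
    rw [hQ', volume_image_add_smul _ (by norm_num), ENNReal.toReal_mul,
      ENNReal.toReal_ofReal (by positivity)]
  have h2 : (volume Q').toReal * ((M - l w) / 2) ≤ ∫ x in Q', (M - l x) := by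
    have : ∫ _ in Q', ((M - l w) / 2) = (volume Q').toReal * ((M - l w) / 2) := by
      simp [Measure.real]
    rw [← this]
    refine setIntegral_mono_on ?_ (h_int.mono_set hsub) hQ'm ?_
    · exact integrableOn_const ((measure_mono hsub).trans_lt hb.measure_lt_top).ne
    · rintro _ ⟨x, hx, rfl⟩
      have := hM x hx
      simp only [map_add, map_smul, smul_eq_mul]
      linarith
  have h3 : ∫ x in Q', (M - l x) ≤ ∫ x in Q, (M - l x) := by
    refine setIntegral_mono_set h_int ?_ (Filter.Eventually.of_forall hsub)
    filter_upwards [ae_restrict_mem ho.measurableSet] with x hx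
    simpa using hM x hx
  rw [h1] at h3
  rw [hvol] at h2
  have h4 : (1 / 2) ^ n * ((M - l w) / 2) ≤ M - l (centerOfMass Q) := by
    refine le_of_mul_le_mul_left ?_ hv0
    linarith
  have h5 : (2 : ℝ) ^ (n + 1) * ((1 / 2) ^ n * ((M - l w) / 2)) = M - l w := by
    rw [pow_succ, one_div, inv_pow]; field_simp
  rw [← h5]
  gcongr

lemma centerOfMass_mem {n : ℕ} {Q : Set (E n)} (ho : IsOpen Q) (hc : Convex ℝ Q)
    (hb : Bornology.IsBounded Q) (hne : Q.Nonempty) : centerOfMass Q ∈ Q := by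
  by_contra hn
  obtain ⟨f, hf⟩ := geometric_hahn_banach_open_point hc ho hn
  obtain ⟨w, hw⟩ := hne
  have := centerOfMass_bound ho hc hb f (fun x hx => (hf x hx).le) hw
  have := hf w hw
  simp only [sub_self, mul_zero] at *
  linarith

/-- Elements of the polar at the center of mass have bounded oscillation. -/
lemma polar_osc {n : ℕ} {Q : Set (E n)} (ho : IsOpen Q) (hc : Convex ℝ Q)
    (hb : Bornology.IsBounded Q) {q : E n} (hq : q ∈ polarAt Q (centerOfMass Q)) {a b : E n}
    (ha : a ∈ Q) (hb' : b ∈ Q) : inner ℝ q (a - b) ≤ 2 ^ (n + 1) := by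
  have h1 := centerOfMass_bound ho hc hb (innerSL ℝ q)
    (M := inner ℝ q (centerOfMass Q) + 1) (fun x hx => by
      have := hq x hx
      rw [inner_sub_right] at this
      simp only [innerSL_apply_apply]
      linarith) hb'
  have h2 := hq a ha
  simp only [innerSL_apply_apply] at h1
  rw [inner_sub_right] at h2 ⊢
  linarith

namespace ConvexSetup

variable {n : ℕ} {Ω : Set (E n)} {u : E n → ℝ}

lemma gradient_eq_add (f : E n → ℝ) (y y' q : E n)
    (h : ∀ e, fderiv ℝ f y' e = fderiv ℝ f y e + inner ℝ q e) :
    gradient f y' = gradient f y + q := by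
  refine ext_inner_right ℝ fun e => ?_
  rw [inner_gradient, inner_add_left, inner_gradient, h]

/-- Aleksandrov-type lower bound for the Monge-Ampère measure of a section. -/
lemma volume_polar_le (S : ConvexSetup Ω u) {y z : E n} {s : ℝ}
    (h : CptIn (MASection Ω u y s) Ω) (hz : z ∈ MASection Ω u y s) :
    ENNReal.ofReal ((s - breg u y z) ^ n) * volume (polarAt (MASection Ω u y s) z) ≤
      ENNReal.ofReal (maMeasure u (MASection Ω u y s)) := by
  have hd : 0 < s - breg u y z := sub_pos.mpr (mem_section_iff.mp hz).2
  set d := s - breg u y z with hdd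
  rw [← volume_image_add_smul (gradient u y) hd.le]
  refine (measure_mono ?_).trans (S.volume_gradient_image_le h (S.isOpen_section h).measurableSet)
  rintro _ ⟨q, hq, rfl⟩
  have hq' : ∀ w ∈ closure (MASection Ω u y s), inner ℝ q (w - z) ≤ 1 := by
    intro w hw
    have hcl : IsClosed {w : E n | inner ℝ q (w - z) ≤ 1} :=
      isClosed_le (by fun_prop) (by fun_prop)
    exact closure_minimal hq hcl hw
  obtain ⟨y', hy', hmin⟩ := exists_interior_min h.1
    (h := fun w => breg u y w - d * inner ℝ q (w - z))
    (((S.continuousOn_breg y).mono h.2).sub (by fun_prop)) hz (fun w hw hw' => by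
      have h1 := S.breg_eq_of_mem_closure h hw hw'
      have h2 := hq' w hw
      simp only [sub_self, inner_zero_right, mul_zero, sub_zero, h1]
      nlinarith)
  have hloc := isLocalMin_of_open (h := fun w => breg u y w - d * inner ℝ q (w - z))
    (S.isOpen_section h) hy' hmin
  have hf : HasFDerivAt (fun w => breg u y w - d * inner ℝ q (w - z))
      ((fderiv ℝ u y' - fderiv ℝ u y) - d • innerSL ℝ q) y' := by
    refine (S.fderiv_breg y (h.subset hy')).sub ?_
    have h3 : HasFDerivAt (fun w : E n => inner ℝ q (w - z)) (innerSL ℝ q) y' :=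
      ((innerSL ℝ q).hasFDerivAt.comp y' ((hasFDerivAt_id y').sub_const z)).congr_fderiv
        (by ext; simp)
    exact h3.const_mul d
  have h0 := hloc.hasFDerivAt_eq_zero hf
  refine ⟨y', hy', gradient_eq_add _ _ _ _ fun e => ?_⟩
  have := congrArg (fun L : E n →L[ℝ] ℝ => L e) h0
  simp only [_root_.sub_apply, _root_.smul_apply, innerSL_apply_apply, smul_eq_mul,
    _root_.zero_apply] at this
  rw [inner_smul_left]
  simp only [conj_trivial]
  linarith

lemma maMeasure_section_pos (S : ConvexSetup Ω u) {y : E n} (hy : y ∈ Ω) {s : ℝ} (hs : 0 < s)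
    (h : CptIn (MASection Ω u y s) Ω) : 0 < maMeasure u (MASection Ω u y s) := by
  have hyS : y ∈ MASection Ω u y s :=
    mem_section_iff.mpr ⟨subset_closure hy, by rwa [breg_self]⟩
  have h1 := S.volume_polar_le h hyS
  have h2 := volume_polarAt_pos y (h.1.isBounded.subset subset_closure)
  rw [breg_self, sub_zero] at h1
  have h3 : 0 < ENNReal.ofReal (s ^ n) := ENNReal.ofReal_pos.mpr (by positivity)
  exact ENNReal.ofReal_pos.mp ((ENNReal.mul_pos h3.ne' h2.ne').trans_le h1)

lemma maMeasure_eq_volume (S : ConvexSetup Ω u) {A : Set (E n)} (hA : CptIn A Ω)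
    (hm : MeasurableSet A) :
    ENNReal.ofReal (maMeasure u A) = volume (gradient u '' (A ∩ {x | 0 < (Hess u x).det})) := by
  have hopen : IsOpen (Ω ∩ {x | 0 < (Hess u x).det}) :=
    S.continuousOn_det.isOpen_inter_preimage S.isOpen isOpen_Ioi
  have hAe : A ∩ {x | 0 < (Hess u x).det} = A ∩ (Ω ∩ {x | 0 < (Hess u x).det}) := by
    ext x; exact ⟨fun hx => ⟨hx.1, hA.subset hx.1, hx.2⟩, fun hx => ⟨hx.1, hx.2.2⟩⟩
  have hm' : MeasurableSet (A ∩ {x | 0 < (Hess u x).det}) := by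
    rw [hAe]; exact hm.inter hopen.measurableSet
  rw [← lintegral_abs_det_fderiv_eq_addHaar_image volume hm' (f' := hessCLM u)
    (fun x hx => (hasFDerivAt_gradient
      (S.contDiffAt_two (hA.subset hx.1))).hasFDerivWithinAt)
    (fun x hx x' hx' he => S.eq_of_gradient_eq (hA.subset hx.1) (hA.subset hx'.1) hx.2 he),
    S.ofReal_maMeasure hA hm]
  have e : ∀ x ∈ A, ENNReal.ofReal (Hess u x).det =
      (A ∩ {x | 0 < (Hess u x).det}).indicator
        (fun x => ENNReal.ofReal |(hessCLM u x).det|) x := by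
    intro x hx
    by_cases h0 : 0 < (Hess u x).det
    · rw [Set.indicator_of_mem (Set.mem_inter hx h0), det_hessCLM, abs_of_pos h0]
    · rw [Set.indicator_of_notMem (fun h => h0 h.2), ENNReal.ofReal_eq_zero]
      exact not_lt.mp h0
  rw [setLIntegral_congr_fun hm e, lintegral_indicator hm', Measure.restrict_restrict hm',
    Set.inter_eq_left.mpr Set.inter_subset_left]

/-- Upper bound for the measure of a dilated section by the polar volume. -/
lemma maMeasure_dilate_le (S : ConvexSetup Ω u) {y : E n} (hy : y ∈ Ω) {s : ℝ} (hs : 0 < s)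
    (h : CptIn (MASection Ω u y s) Ω) {α : ℝ} (h0 : 0 < α) (h1 : α < 1) :
    ENNReal.ofReal (maMeasure u (dilateCM α (MASection Ω u y s))) ≤
      ENNReal.ofReal ((s / (1 - α)) ^ n) *
        volume (polarAt (MASection Ω u y s) (centerOfMass (MASection Ω u y s))) := by
  set Q := MASection Ω u y s with hQ
  have ho := S.isOpen_section h
  have hc := S.convex_section y s
  have hyQ : y ∈ Q := mem_section_iff.mpr ⟨subset_closure hy, by rwa [breg_self]⟩
  have hcm := centerOfMass_mem ho hc (h.1.isBounded.subset subset_closure) ⟨y, hyQ⟩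
  set c := centerOfMass Q with hcc
  have hsub : dilateCM α Q ⊆ Q := by
    rintro _ ⟨b, hb, rfl⟩
    exact hc.add_smul_sub_mem hcm hb ⟨h0.le, h1.le⟩
  have hm : MeasurableSet (dilateCM α Q) := by
    have e : dilateCM α Q = AffineMap.homothety c α '' Q := by
      unfold dilateCM
      refine Set.image_congr fun x _ => ?_
      simp [AffineMap.homothety_apply, add_comm, hcc]
    rw [e]
    exact (AffineMap.homothety_isOpenMap c α h0.ne' Q ho).measurableSet
  rw [S.maMeasure_eq_volume (h.mono hsub) hm,
    ← volume_image_add_smul (gradient u y) (div_nonneg hs.le (sub_pos.mpr h1).le)]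
  refine measure_mono ?_
  rintro _ ⟨x, ⟨⟨b, hb, rfl⟩, -⟩, rfl⟩
  set x := c + α • (b - c) with hx
  have hxQ : x ∈ Q := hsub (Set.mem_image_of_mem _ hb)
  have hα : 0 < 1 - α := sub_pos.mpr h1
  refine ⟨(s / (1 - α))⁻¹ • (gradient u x - gradient u y), fun w hw => ?_, ?_⟩
  · have hwQ : x + (1 - α) • (w - c) ∈ Q := by
      have : x + (1 - α) • (w - c) = α • b + (1 - α) • w := by
        rw [hx, smul_sub, smul_sub, sub_smul, sub_smul, one_smul, one_smul]; abel
      rw [this]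
      exact hc hb hw h0.le hα.le (by ring)
    have h2 := S.breg_nonneg (h.subset hxQ) (mem_section_iff.mp hwQ).1
    have h3 := (mem_section_iff.mp hwQ).2
    have h4 := S.breg_nonneg hy (mem_section_iff.mp hxQ).1
    have h5 : fderiv ℝ u x ((1 - α) • (w - c)) - fderiv ℝ u y ((1 - α) • (w - c)) ≤ s := by
      simp only [breg, add_sub_cancel_left] at h2 h3 h4
      have e : x + (1 - α) • (w - c) - y = (x - y) + (1 - α) • (w - c) := by abel
      rw [e, map_add] at h3
      linarith
    rw [inner_smul_left, inner_sub_left, inner_gradient, inner_gradient]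
    simp only [map_smul, smul_eq_mul, conj_trivial] at h5 ⊢
    rw [inv_mul_le_iff₀ (by positivity), mul_one, le_div_iff₀ hα]
    linarith
  · simp only
    rw [smul_smul, mul_inv_cancel₀ (by positivity), one_smul]; abel

end ConvexSetup

/-- Packing: `J` disjoint translates of a scaled copy of `A` inside `P`. -/
lemma packing_volume {n : ℕ} {A P : Set (E n)} (hA : IsClosed A) {f v : E n} {r m : ℝ}
    (hr : 0 < r) (J : ℕ) (hv : ∀ a ∈ A, |inner ℝ (r • a) v| ≤ 1 / 2)
    (hf : 1 < m * |inner ℝ f v|) (hm : 0 ≤ m)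
    (hP : ∀ a ∈ A, ∀ j < J, (j * m) • f + r • a ∈ P) :
    (J : ENNReal) * (ENNReal.ofReal (r ^ n) * volume A) ≤ volume P := by
  set T : ℕ → Set (E n) := fun j => (fun q => ((j : ℝ) * m) • f + r • q) '' A with hT
  have hcl : ∀ j, MeasurableSet (T j) := fun j => by
    have : T j = (fun q => ((j : ℝ) * m) • f + q) '' (r • A) := by
      rw [hT, ← Set.image_smul, Set.image_image]
    rw [this, Set.image_add_left]
    exact (measurable_const_add _) (hA.measurableSet.const_smul₀ _)
  have hdis : Set.PairwiseDisjoint (↑(Finset.range J)) T := by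
    intro i _ j _ hij
    rw [Function.onFun, Set.disjoint_left]
    rintro _ ⟨a, ha, rfl⟩ ⟨b, hb, he⟩
    have h1 := hv a ha
    have h2 := hv b hb
    have h3 : inner ℝ (((j : ℝ) * m) • f + r • b) v = inner ℝ (((i : ℝ) * m) • f + r • a) v := by
      simpa using congrArg (fun x => inner ℝ x v) he
    simp only [inner_add_left, inner_smul_left, conj_trivial] at h1 h2 h3
    have h4 : |((i : ℝ) - j) * (m * inner ℝ f v)| ≤ 1 := by
      have : ((i : ℝ) - j) * (m * inner ℝ f v) = r * inner ℝ b v - r * inner ℝ a v := by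
        linarith
      rw [this]
      rw [abs_le] at *
      constructor <;> linarith
    have h5 : (1 : ℝ) ≤ |(i : ℝ) - j| := by
      have : (1 : ℤ) ≤ |(i : ℤ) - j| := Int.one_le_abs (sub_ne_zero.mpr (by exact_mod_cast hij))
      exact_mod_cast this
    rw [abs_mul, abs_mul, abs_of_nonneg hm] at h4
    nlinarith
  have hvol : ∀ j, volume (T j) = ENNReal.ofReal (r ^ n) * volume A :=
    fun j => volume_image_add_smul _ hr.le _
  calc (J : ENNReal) * (ENNReal.ofReal (r ^ n) * volume A)
      = ∑ j ∈ Finset.range J, volume (T j) := by simp [hvol]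
    _ = volume (⋃ j ∈ Finset.range J, T j) :=
        (measure_biUnion_finset hdis fun j _ => hcl j).symm
    _ ≤ volume P := by
        refine measure_mono ?_
        simp only [Set.iUnion_subset_iff, Finset.mem_range]
        rintro j hj _ ⟨a, ha, rfl⟩
        exact hP a ha j hj

/-- The quantitative balancing property of sections. -/
def SectionBalanced {n : ℕ} (Ω : Set (E n)) (u : E n → ℝ) (ε : ℝ) : Prop :=
  ∀ y ∈ Ω, ∀ s : ℝ, CptIn (MASection Ω u y s) Ω → ∀ z ∈ MASection Ω u y s, breg u y z ≤ s / 2 →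
    ∀ w ∈ MASection Ω u y s, z - ε • (w - z) ∈ MASection Ω u y s

theorem exists_balanced (n : ℕ) {α β : ℝ} (h0 : 0 < α) (h1 : α < 1) (hβ : 1 < β) :
    ∃ ε : ℝ, 0 < ε ∧ ε < 1 ∧ ∀ (Ω : Set (E n)) (u : E n → ℝ), ConvexSetup Ω u →
      DoublingCM Ω u α β → SectionBalanced Ω u ε := by
  have hα : 0 < 1 - α := sub_pos.mpr h1
  set C : ℝ := 2 ^ (n + 2) with hC
  have hC0 : 0 < C := by positivity
  set J : ℕ := ⌊β * (2 * C / (1 - α)) ^ n⌋₊ + 1 with hJ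
  have hJ1 : β * (2 * C / (1 - α)) ^ n < J := by
    rw [hJ]; exact_mod_cast Nat.lt_floor_add_one _
  have hJ0 : (1 : ℝ) ≤ J := by rw [hJ]; push_cast; linarith [Nat.cast_nonneg (α := ℝ) ⌊β * (2 * C / (1 - α)) ^ n⌋₊]
  refine ⟨1 / (4 * J), by positivity, by rw [div_lt_one (by positivity)]; linarith, ?_⟩
  intro Ω u S hD y hy s hcpt z hz hzs w hw
  by_contra hout
  set K := MASection Ω u y s with hK
  have hs : 0 < s := (S.breg_nonneg hy (mem_section_iff.mp hz).1).trans_lt (mem_section_iff.mp hz).2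
  set Q := MASection Ω u y (s / 2) with hQ
  have hQK : Q ⊆ K := section_mono (by linarith)
  have hQcpt : CptIn Q Ω := hcpt.mono hQK
  have hQo := S.isOpen_section hQcpt
  have hQc := S.convex_section y (s / 2)
  have hQb : Bornology.IsBounded Q := hQcpt.1.isBounded.subset subset_closure
  have hyQ : y ∈ Q := mem_section_iff.mpr ⟨subset_closure hy, by rw [breg_self]; linarith⟩
  have hcm := centerOfMass_mem hQo hQc hQb ⟨y, hyQ⟩
  set A := polarAt Q (centerOfMass Q) with hA
  have hhalf : ∀ x ∈ K, y + (1 / 2 : ℝ) • (x - y) ∈ Q := fun x hx => by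
    have hx' := mem_section_iff.mp hx
    refine mem_section_iff.mpr ⟨S.closure_segment (subset_closure hy) hx'.1 (by norm_num)
      (by norm_num), ?_⟩
    have := S.breg_segment (y := y) (subset_closure hy) hx'.1 (r := 1 / 2) (by norm_num)
      (by norm_num)
    rw [breg_self] at this
    linarith [hx'.2]
  have hosc : ∀ q ∈ A, ∀ a ∈ K, ∀ b ∈ K, inner ℝ q (a - b) ≤ C := by
    intro q hq a ha b hb
    have := polar_osc hQo hQc hQb hq (hhalf a ha) (hhalf b hb)
    have e : y + (1 / 2 : ℝ) • (a - y) - (y + (1 / 2 : ℝ) • (b - y)) = (1 / 2 : ℝ) • (a - b) := by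
      rw [add_sub_add_left_eq_sub, ← smul_sub]; congr 1; abel
    rw [e, inner_smul_right] at this
    rw [hC, pow_succ]; linarith
  obtain ⟨g, hg⟩ := geometric_hahn_banach_open_point (S.convex_section y s)
    (S.isOpen_section hcpt) hout
  set ε : ℝ := 1 / (4 * J) with hε
  have hε0 : 0 < ε := by positivity
  have hm0 : 0 < -(ε * g (w - z)) := by
    have := hg z hz
    rw [map_sub, map_smul, smul_eq_mul] at this
    linarith
  set m := -(ε * g (w - z)) with hm
  set f : E n := m⁻¹ • (InnerProductSpace.toDual ℝ (E n)).symm g with hf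
  have hfe : ∀ x, inner ℝ f x = m⁻¹ * g x := fun x => by
    rw [hf, inner_smul_left, InnerProductSpace.toDual_symm_apply]; simp
  have hfP : ∀ a ∈ K, inner ℝ f (a - z) ≤ 1 := fun a ha => by
    rw [hfe, inv_mul_le_iff₀ hm0, mul_one]
    have := hg a ha
    rw [map_sub, map_smul, smul_eq_mul] at this
    rw [map_sub, hm]; linarith
  have hfw : inner ℝ f (w - z) = -(4 * J) := by
    rw [hfe, inv_mul_eq_iff_eq_mul₀ hm0.ne', hm, hε]
    field_simp
  have hJne : (J : ℝ) ≠ 0 := by positivity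
  have hpack := packing_volume (isClosed_polarAt Q (centerOfMass Q)) (P := polarAt K z) (f := f)
    (v := w - z) (r := 1 / (2 * C)) (m := 1 / (2 * J)) (by positivity) J
    (fun a ha => by
      have h1 := hosc a ha w hw z hz
      have h2 := hosc a ha z hz w hw
      rw [← neg_sub, inner_neg_right] at h2
      rw [inner_smul_left, conj_trivial, abs_mul, abs_of_pos (by positivity)]
      have h3 : |inner ℝ a (w - z)| ≤ C := abs_le.mpr ⟨by linarith, h1⟩
      calc 1 / (2 * C) * |inner ℝ a (w - z)| ≤ 1 / (2 * C) * C := by gcongr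
        _ = 1 / 2 := by field_simp)
    (by
      rw [hfw, abs_neg, abs_of_pos (by positivity)]
      have : 1 / (2 * (J : ℝ)) * (4 * J) = 2 := by field_simp; norm_num
      linarith)
    (by positivity)
    (fun a ha j hj b hb => by
      rw [inner_add_left, real_inner_smul_left f (b - z) ((j : ℝ) * (1 / (2 * J))),
        real_inner_smul_left a (b - z) (1 / (2 * C))]
      have h1 := hosc a ha b hb z hz
      have h2 := hfP b hb
      have h3 : 1 / (2 * C) * inner ℝ a (b - z) ≤ 1 / 2 := by
        calc 1 / (2 * C) * inner ℝ a (b - z) ≤ 1 / (2 * C) * C := by gcongr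
          _ = 1 / 2 := by field_simp
      have h4 : (j : ℝ) * (1 / (2 * J)) * inner ℝ f (b - z) ≤ 1 / 2 := by
        have hj' : (j : ℝ) ≤ J := by exact_mod_cast hj.le
        calc (j : ℝ) * (1 / (2 * J)) * inner ℝ f (b - z) ≤ (j : ℝ) * (1 / (2 * J)) * 1 := by
              gcongr
          _ ≤ J * (1 / (2 * J)) * 1 := by gcongr
          _ = 1 / 2 := by field_simp
      linarith)
  have hlow := S.volume_polar_le hcpt hz
  have hup := S.maMeasure_dilate_le hy (by linarith : 0 < s / 2) hQcpt h0 h1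
  have hdb := hD.2.2.2 y hy s hs hcpt
  have hAt : volume A ≠ ⊤ := (volume_polarAt_lt_top hQo hcm).ne
  have hApos : 0 < (volume A).toReal :=
    ENNReal.toReal_pos (volume_polarAt_pos _ hQb).ne' hAt
  have key : ENNReal.ofReal ((s - breg u y z) ^ n) *
      ((J : ENNReal) * (ENNReal.ofReal ((1 / (2 * C)) ^ n) * volume A)) ≤
      ENNReal.ofReal β * (ENNReal.ofReal ((s / 2 / (1 - α)) ^ n) * volume A) := by
    calc _ ≤ ENNReal.ofReal ((s - breg u y z) ^ n) * volume (polarAt K z) := by gcongr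
      _ ≤ ENNReal.ofReal (maMeasure u K) := hlow
      _ ≤ ENNReal.ofReal (β * maMeasure u (dilateCM α Q)) := ENNReal.ofReal_le_ofReal hdb
      _ = ENNReal.ofReal β * ENNReal.ofReal (maMeasure u (dilateCM α Q)) :=
          ENNReal.ofReal_mul (by linarith)
      _ ≤ _ := by gcongr
  have hd0 : 0 ≤ s - breg u y z := by linarith
  have key2 := ENNReal.toReal_mono (by finiteness) key
  simp only [ENNReal.toReal_mul, ENNReal.toReal_natCast] at key2
  rw [ENNReal.toReal_ofReal (by positivity), ENNReal.toReal_ofReal (by positivity),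
    ENNReal.toReal_ofReal (by linarith), ENNReal.toReal_ofReal (by positivity)] at key2
  have key3 : (s / 2) ^ n * (J * (1 / (2 * C)) ^ n) ≤ β * (s / 2 / (1 - α)) ^ n := by
    refine le_of_mul_le_mul_right ?_ hApos
    refine le_trans ?_ (key2.trans (le_of_eq (by ring)))
    have : (s / 2) ^ n ≤ (s - breg u y z) ^ n := by gcongr; linarith
    calc (s / 2) ^ n * (J * (1 / (2 * C)) ^ n) * (volume A).toReal
        = (s / 2) ^ n * (J * ((1 / (2 * C)) ^ n * (volume A).toReal)) := by ring
      _ ≤ _ := by gcongr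
  have key4 : (J : ℝ) ≤ β * (2 * C / (1 - α)) ^ n := by
    have hp : 0 < (s / 2) ^ n * (1 / (2 * C)) ^ n := by positivity
    refine le_of_mul_le_mul_left ?_ hp
    calc (s / 2) ^ n * (1 / (2 * C)) ^ n * J ≤ β * (s / 2 / (1 - α)) ^ n := by linarith
      _ = β * ((s / 2) * (1 / (2 * C)) * (2 * C / (1 - α))) ^ n := by
          congr 2; field_simp
      _ = _ := by rw [mul_pow, mul_pow]; ring
  linarith

lemma breg_three {n : ℕ} (u : E n → ℝ) (x z w : E n) :
    breg u x w = breg u x z + breg u z w + (fderiv ℝ u z (w - z) - fderiv ℝ u x (w - z)) := by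
  simp only [breg, map_sub]; ring

/-- A convex function on a bounded domain whose sections are balanced and whose Monge-Ampère
measure is doubling on them. -/
structure DoublingSetup {n : ℕ} (Ω : Set (E n)) (u : E n → ℝ) (β ε : ℝ) : Prop where
  convex : ConvexSetup Ω u
  bounded : Bornology.IsBounded Ω
  one_lt : 1 < β
  eps_pos : 0 < ε
  eps_lt : ε < 1
  balanced : SectionBalanced Ω u ε
  doubling : ∀ y ∈ Ω, ∀ s : ℝ, 0 < s → CptIn (MASection Ω u y s) Ω →
    maMeasure u (MASection Ω u y s) ≤ β * maMeasure u (MASection Ω u y (s / 2))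

theorem exists_doublingSetup (n : ℕ) {α β : ℝ} (h0 : 0 < α) (h1 : α < 1) (hβ : 1 < β) :
    ∃ ε : ℝ, 0 < ε ∧ ε < 1 ∧ ∀ (Ω : Set (E n)) (u : E n → ℝ), MASetup Ω u →
      DoublingCM Ω u α β → DoublingSetup Ω u β ε := by
  obtain ⟨ε, he0, he1, hε⟩ := exists_balanced n h0 h1 hβ
  refine ⟨ε, he0, he1, fun Ω u hM hD => ?_⟩
  have S := hM.convexSetup
  refine ⟨S, hM.2.1, hβ, he0, he1, hε Ω u S hD, fun y hy s hs hcpt => ?_⟩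
  refine (hD.2.2.2 y hy s hs hcpt).trans ?_
  have hQcpt : CptIn (MASection Ω u y (s / 2)) Ω := hcpt.mono (section_mono (by linarith))
  have hQo := S.isOpen_section hQcpt
  have hQc := S.convex_section y (s / 2)
  have hyQ : y ∈ MASection Ω u y (s / 2) :=
    mem_section_iff.mpr ⟨subset_closure hy, by rw [breg_self]; linarith⟩
  have hcm := centerOfMass_mem hQo hQc (hQcpt.1.isBounded.subset subset_closure) ⟨y, hyQ⟩
  refine mul_le_mul_of_nonneg_left (S.maMeasure_mono hQcpt hQo.measurableSet ?_) (by linarith)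
  rintro _ ⟨a, ha, rfl⟩
  exact hQc.add_smul_sub_mem hcm ha ⟨h0.le, h1.le⟩

lemma exists_mem_closure_diff_of_segment {n : ℕ} {s : Set (E n)} (hs : IsOpen s) {a b : E n}
    (ha : a ∈ s) (hb : b ∉ s) : ∃ w ∈ segment ℝ a b, w ∈ closure s ∧ w ∉ s := by
  by_contra! hcon
  have h2 : b ∉ closure s := fun h => hb (hcon b (right_mem_segment ℝ a b) h)
  obtain ⟨x, -, hx1, hx2⟩ := (convex_segment (𝕜 := ℝ) a b).isPreconnected s (closure s)ᶜ hs
    isClosed_closure.isOpen_compl (fun w hw => by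
      by_cases h : w ∈ closure s
      · exact Or.inl (hcon w hw h)
      · exact Or.inr h) ⟨a, left_mem_segment ℝ a b, ha⟩ ⟨b, right_mem_segment ℝ a b, h2⟩
  exact hx2 (subset_closure hx1)

namespace DoublingSetup

variable {n : ℕ} {Ω : Set (E n)} {u : E n → ℝ} {β ε : ℝ}

lemma cut_balanced (S : DoublingSetup Ω u β ε) {l : E n →L[ℝ] ℝ} {c H : ℝ}
    (h : CptIn (cut Ω u l c) Ω) (hH : ∀ ξ ∈ cut Ω u l c, l ξ + c - u ξ ≤ H) {z w : E n}
    (hz : z ∈ cut Ω u l c) (hz' : H / 2 ≤ l z + c - u z) (hw : w ∈ cut Ω u l c) :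
    z - ε • (w - z) ∈ cut Ω u l c := by
  obtain ⟨y, hy, hl, he⟩ := S.convex.cut_eq_section h ⟨z, hz⟩
  have hyH := hH y hy
  rw [he] at h hz hw ⊢
  refine S.balanced y ?_ _ h z hz ?_ w hw
  · rw [← he] at h; exact h.subset hy
  · simp only [breg, hl, map_sub]; linarith

/-- Small sections centred in a small section are engulfed. -/
lemma engulfing (S : DoublingSetup Ω u β ε) {x z : E n} {t : ℝ} (hx : x ∈ Ω) (ht : 0 < t)
    (hcpt : CptIn (MASection Ω u x t) Ω) (hz : z ∈ MASection Ω u x (ε / 20 * t)) :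
    MASection Ω u z (ε / 20 * t) ⊆ MASection Ω u x t := by
  have he0 := S.eps_pos
  have he1 := S.eps_lt
  set κ := ε / 20 with hκ
  have hκ0 : 0 < κ := by positivity
  have hκ1 : κ < 1 / 20 := by rw [hκ]; linarith
  have hzt : z ∈ MASection Ω u x t := section_mono (by nlinarith) hz
  have hzΩ := hcpt.subset hzt
  intro ζ hζ
  by_contra hout
  have ho := S.convex.isOpen_section hcpt
  obtain ⟨w, hwseg, hwfr⟩ := exists_mem_closure_diff_of_segment ho hzt hout
  have hwx := S.convex.breg_eq_of_mem_closure hcpt hwfr.1 hwfr.2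
  have hwΩ := hcpt.2 hwfr.1
  rw [mem_section_iff] at hz hζ
  have hwz : breg u z w < κ * t := by
    rw [segment_eq_image'] at hwseg
    obtain ⟨r, hr, rfl⟩ := hwseg
    have h1 := S.convex.breg_segment (y := z) hz.1 hζ.1 hr.1 hr.2
    rw [breg_self] at h1
    have h2 := S.convex.breg_nonneg hzΩ hζ.1
    nlinarith [hr.2, hζ.2]
  set η := 2 * κ with hη
  set l : E n →L[ℝ] ℝ := (1 - η) • fderiv ℝ u z + η • fderiv ℝ u x with hl
  set c : ℝ := (1 - η) * (u z - fderiv ℝ u z z) + η * (u x - fderiv ℝ u x x + t) with hc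
  have hdep : ∀ ξ, l ξ + c - u ξ = η * (t - breg u x ξ) - (1 - η) * breg u z ξ := fun ξ => by
    simp only [hl, hc, breg, map_sub, _root_.add_apply, _root_.smul_apply, smul_eq_mul]; ring
  have hη1 : 0 < 1 - η := by linarith
  have hη0 : 0 < η := by linarith
  have hmem : ∀ ξ ∈ closure Ω, (ξ ∈ cut Ω u l c ↔
      0 < η * (t - breg u x ξ) - (1 - η) * breg u z ξ) := fun ξ hξ => by
    rw [← hdep]
    exact ⟨fun h => by linarith [h.2], fun h => ⟨hξ, by linarith⟩⟩
  have hsub : cut Ω u l c ⊆ MASection Ω u x t := fun ξ hξ => by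
    have h1 := (hmem ξ hξ.1).mp hξ
    have h2 := S.convex.breg_nonneg hzΩ hξ.1
    refine mem_section_iff.mpr ⟨hξ.1, ?_⟩
    have : 0 < η * (t - breg u x ξ) := by nlinarith
    linarith [pos_of_mul_pos_right this hη0.le]
  have hzx0 := S.convex.breg_nonneg hx hz.1
  have hzc : z ∈ cut Ω u l c := by
    rw [hmem z hz.1, breg_self]; nlinarith [hz.2]
  have hwc : z + (1 / 2 : ℝ) • (w - z) ∈ cut Ω u l c := by
    have h1 := S.convex.breg_segment (y := x) hz.1 (subset_closure hwΩ) (r := 1 / 2)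
      (by norm_num) (by norm_num)
    have h2 := S.convex.breg_segment (y := z) hz.1 (subset_closure hwΩ) (r := 1 / 2)
      (by norm_num) (by norm_num)
    rw [breg_self] at h2
    rw [hmem _ (S.convex.closure_segment hz.1 (subset_closure hwΩ) (by norm_num) (by norm_num))]
    have h3 : t - breg u x (z + (1 / 2 : ℝ) • (w - z)) ≥ (1 - κ) / 2 * t := by
      linarith [hz.2]
    have h4 : breg u z (z + (1 / 2 : ℝ) • (w - z)) ≤ κ * t / 2 := by linarith
    nlinarith [mul_pos hκ0 ht, mul_pos (mul_pos hκ0 ht) hη1]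
  have hξ := S.cut_balanced (hcpt.mono hsub) (H := η * t) (fun ξ hξ => by
    rw [hdep]
    have h1 := S.convex.breg_nonneg hx hξ.1
    have h2 := S.convex.breg_nonneg hzΩ hξ.1
    nlinarith [mul_nonneg hη0.le h1, mul_nonneg hη1.le h2]) hzc (by
    rw [hdep, breg_self]
    nlinarith [hz.2, mul_pos hη0 ht]) hwc
  set ξ := z - ε • (z + (1 / 2 : ℝ) • (w - z) - z) with hξd
  have hξz : ξ - z = -(10 * κ) • (w - z) := by
    rw [hξd, add_sub_cancel_left, sub_sub_cancel_left, smul_smul, ← neg_smul]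
    congr 1; rw [hκ]; ring
  have h1 := (hmem ξ hξ.1).mp hξ
  have h2 := breg_three u x z ξ
  have h3 := breg_three u x z w
  rw [hξz, map_smul, map_smul, smul_eq_mul, smul_eq_mul] at h2
  have h4 := S.convex.breg_nonneg hx hξ.1
  have hA : fderiv ℝ u z (w - z) - fderiv ℝ u x (w - z) ≥ (1 - 2 * κ) * t := by
    linarith [hz.2]
  have h5 : breg u z ξ ≥ - (κ * t) + 10 * κ * ((1 - 2 * κ) * t) := by
    nlinarith [hz.2, mul_le_mul_of_nonneg_left hA (by positivity : 0 ≤ 10 * κ)]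
  have hκt : 0 < κ * t := by positivity
  have h6 : breg u z ξ ≥ 8 * (κ * t) := by nlinarith
  have h7 : (1 - η) * breg u z ξ ≥ 9 / 10 * (8 * (κ * t)) := by
    apply mul_le_mul <;> linarith
  have h8 : η * (t - breg u x ξ) ≤ 2 * (κ * t) := by nlinarith [mul_nonneg hη0.le h4]
  linarith

lemma breg_lt_of_mem (S : DoublingSetup Ω u β ε) {y z w : E n} {s : ℝ} (hy : y ∈ Ω)
    (hcpt : CptIn (MASection Ω u y (2 * s)) Ω) (hz : z ∈ MASection Ω u y s)
    (hw : w ∈ MASection Ω u y s) : breg u z w < (1 + 2 / ε) * s := by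
  have he0 := S.eps_pos
  have hs : 0 < s := (S.convex.breg_nonneg hy (mem_section_iff.mp hz).1).trans_lt
    (mem_section_iff.mp hz).2
  have hsub : MASection Ω u y s ⊆ MASection Ω u y (2 * s) := section_mono (by linarith)
  rw [mem_section_iff] at hz hw
  have hξ := S.balanced y hy _ hcpt z (hsub (mem_section_iff.mpr hz)) (by linarith [hz.2]) w
    (hsub (mem_section_iff.mpr hw))
  have hzΩ : z ∈ Ω := hcpt.subset (hsub (mem_section_iff.mpr hz))
  have h1 := breg_three u y z (z - ε • (w - z))
  have h2 := breg_three u y z w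
  rw [sub_sub_cancel_left, map_neg, map_neg, map_smul, map_smul, smul_eq_mul, smul_eq_mul] at h1
  rw [mem_section_iff] at hξ
  have h3 := S.convex.breg_nonneg hzΩ hξ.1
  have h4 := S.convex.breg_nonneg hy hz.1
  set A := fderiv ℝ u z (w - z) - fderiv ℝ u y (w - z) with hA
  have h5 : ε * A > - (2 * s) := by rw [hA]; linarith [hξ.2]
  have h6 : A > - (2 / ε * s) := by
    rw [gt_iff_lt, ← mul_lt_mul_iff_right₀ he0]
    have : ε * -(2 / ε * s) = - (2 * s) := by field_simp
    linarith
  linarith [hw.2]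

lemma add_smul_mem (S : DoublingSetup Ω u β ε) {y z : E n} {s : ℝ} (hy : y ∈ Ω) (hs : 0 < s)
    (hcpt : CptIn (MASection Ω u y s) Ω) (hz : z ∈ MASection Ω u y s) (hzs : breg u y z ≤ s / 2) :
    z + ε • (z - y) ∈ MASection Ω u y s := by
  have := S.balanced y hy s hcpt z hz hzs y
    (mem_section_iff.mpr ⟨subset_closure hy, by rwa [breg_self]⟩)
  rwa [← neg_sub z y, smul_neg, sub_neg_eq_add] at this

lemma self_mem {y : E n} {s : ℝ} (hy : y ∈ Ω) (hs : 0 < s) :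
    y ∈ MASection Ω u y s :=
  mem_section_iff.mpr ⟨subset_closure hy, by rwa [breg_self]⟩

lemma eq_of_breg_eq_zero (S : DoublingSetup Ω u β ε) {z w : E n} {r : ℝ} (hz : z ∈ Ω)
    (hr : 0 < r) (hcpt : CptIn (MASection Ω u z r) Ω) (hw : w ∈ closure Ω)
    (h0 : breg u z w = 0) : w = z := by
  by_contra hne
  have he0 := S.eps_pos
  have he1 := S.eps_lt
  set K := closure (MASection Ω u z r) with hK
  have hcont : ContinuousOn (breg u z) K := (S.convex.continuousOn_breg z).mono hcpt.2
  have hFc : IsCompact (K ∩ breg u z ⁻¹' {0}) :=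
    hcpt.1.of_isClosed_subset (hcont.preimage_isClosed_of_isClosed isClosed_closure
      isClosed_singleton) Set.inter_subset_left
  have hmemF : ∀ ξ ∈ closure Ω, breg u z ξ = 0 → ξ ∈ K ∩ breg u z ⁻¹' {0} := fun ξ hξ h =>
    ⟨subset_closure (mem_section_iff.mpr ⟨hξ, by rwa [h]⟩), h⟩
  set e : E n →L[ℝ] ℝ := innerSL ℝ (w - z) with he
  obtain ⟨p, hp, hpmax⟩ := hFc.exists_isMaxOn ⟨w, hmemF w hw h0⟩
    (e.continuous.continuousOn)
  have hew : 0 < e (w - z) := by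
    rw [he, innerSL_apply_apply, real_inner_self_eq_norm_sq]
    exact pow_pos (norm_pos_iff.mpr (sub_ne_zero.mpr hne)) 2
  set M := e (p - z) with hM
  have hMax : ∀ ξ ∈ closure Ω, breg u z ξ = 0 → e (ξ - z) ≤ M := fun ξ hξ h => by
    have := hpmax (hmemF ξ hξ h)
    simp only [Set.mem_ofPred_eq] at this
    rw [hM, map_sub, map_sub]; linarith
  have hM0 : 0 < M := hew.trans_le (hMax w hw h0)
  have hpΩ : p ∈ closure Ω := subset_closure (hcpt.2 hp.1)
  set V := K ∩ {ξ | (1 + ε / 4) * M ≤ e (ξ - z)} with hV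
  have hVc : IsCompact V := hcpt.1.inter_right
    (isClosed_le continuous_const (by fun_prop))
  obtain ⟨c, hc0, hc⟩ : ∃ c, 0 < c ∧ ∀ ξ ∈ V, c ≤ breg u z ξ := by
    refine hVc.exists_forall_le' (hcont.mono Set.inter_subset_left) fun ξ hξ => ?_
    have hξΩ := subset_closure (hcpt.2 hξ.1)
    refine lt_of_le_of_ne (S.convex.breg_nonneg hz hξΩ) fun h => ?_
    have h1 := hMax ξ hξΩ h.symm
    have h2 : (1 + ε / 4) * M ≤ e (ξ - z) := hξ.2
    nlinarith
  obtain ⟨R, hR⟩ : ∃ R, ∀ ξ ∈ closure Ω, e (ξ - z) ≤ R := by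
    obtain ⟨B, hB⟩ := S.bounded.closure.exists_norm_le
    refine ⟨‖e‖ * (B + ‖z‖), fun ξ hξ => ?_⟩
    calc e (ξ - z) ≤ ‖e (ξ - z)‖ := Real.le_norm_self _
      _ ≤ ‖e‖ * ‖ξ - z‖ := e.le_opNorm _
      _ ≤ _ := by
        gcongr
        exact (norm_sub_le _ _).trans (by linarith [hB ξ hξ])
  have hR0 : 0 < R := hM0.trans_le (hR p hpΩ)
  set δ := min c r / R with hδ
  have hδ0 : 0 < δ := div_pos (lt_min hc0 hr) hR0
  have hδR : δ * R = min c r := by rw [hδ]; field_simp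
  set l : E n →L[ℝ] ℝ := fderiv ℝ u z + δ • e with hl
  set b : ℝ := u z - fderiv ℝ u z z - δ * e z with hb
  have hdep : ∀ ξ, l ξ + b - u ξ = δ * e (ξ - z) - breg u z ξ := fun ξ => by
    simp only [hl, hb, breg, map_sub, _root_.add_apply, _root_.smul_apply, smul_eq_mul]; ring
  have hlt : ∀ ξ ∈ cut Ω u l b, breg u z ξ < min c r := fun ξ hξ => by
    have h1 := hdep ξ
    have h2 := mul_le_mul_of_nonneg_left (hR ξ hξ.1) hδ0.le
    linarith [hξ.2]
  have hsub : cut Ω u l b ⊆ MASection Ω u z r := fun ξ hξ =>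
    mem_section_iff.mpr ⟨hξ.1, (hlt ξ hξ).trans_le (min_le_right _ _)⟩
  have hbd : ∀ ξ ∈ cut Ω u l b, e (ξ - z) < (1 + ε / 4) * M := fun ξ hξ => by
    by_contra! hcon
    exact absurd (hc ξ ⟨subset_closure (hsub hξ), hcon⟩)
      (not_le.mpr ((hlt ξ hξ).trans_le (min_le_left _ _)))
  have hpc : p ∈ cut Ω u l b := ⟨hpΩ, by
    have := hdep p
    rw [show breg u z p = 0 from hp.2] at this
    nlinarith [mul_pos hδ0 hM0]⟩
  have hqc : z + (1 / 2 : ℝ) • (p - z) ∈ cut Ω u l b := by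
    refine ⟨S.convex.closure_segment (subset_closure hz) hpΩ (by norm_num) (by norm_num), ?_⟩
    have h1 := S.convex.breg_segment (y := z) (subset_closure hz) hpΩ (r := 1 / 2) (by norm_num)
      (by norm_num)
    rw [breg_self, show breg u z p = 0 from hp.2] at h1
    have h2 := hdep (z + (1 / 2 : ℝ) • (p - z))
    rw [add_sub_cancel_left, map_smul, smul_eq_mul, ← hM] at h2
    nlinarith [mul_pos hδ0 hM0]
  have hfin := hbd _ (S.cut_balanced (hcpt.mono hsub) (H := δ * ((1 + ε / 4) * M))
    (fun ξ hξ => by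
      rw [hdep]
      have h1 := S.convex.breg_nonneg hz hξ.1
      nlinarith [mul_le_mul_of_nonneg_left (hbd ξ hξ).le hδ0.le]) hpc (by
      rw [hdep, show breg u z p = 0 from hp.2, ← hM]
      nlinarith [mul_pos hδ0 hM0]) hqc)
  have h3 : p - ε • (z + (1 / 2 : ℝ) • (p - z) - p) - z = (1 + ε / 2) • (p - z) := by
    module
  rw [h3, map_smul, smul_eq_mul, ← hM] at hfin
  nlinarith

lemma exists_section_subset (S : DoublingSetup Ω u β ε) {z : E n} {r : ℝ} (hz : z ∈ Ω)
    (hr : 0 < r) (hcpt : CptIn (MASection Ω u z r) Ω) {W : Set (E n)} (hW : W ∈ 𝓝 z) :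
    ∃ s, 0 < s ∧ s ≤ r ∧ MASection Ω u z s ⊆ W := by
  obtain ⟨c, hc0, hc⟩ : ∃ c, 0 < c ∧ ∀ ξ ∈ closure (MASection Ω u z r) \ interior W,
      c ≤ breg u z ξ := by
    refine (hcpt.1.diff isOpen_interior).exists_forall_le'
      (((S.convex.continuousOn_breg z).mono hcpt.2).mono Set.sdiff_subset) fun ξ hξ => ?_
    have hξΩ := subset_closure (hcpt.2 hξ.1)
    refine lt_of_le_of_ne (S.convex.breg_nonneg hz hξΩ) fun h => hξ.2 ?_
    rw [S.eq_of_breg_eq_zero hz hr hcpt hξΩ h.symm]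
    exact mem_interior_iff_mem_nhds.mpr hW
  refine ⟨min c r, lt_min hc0 hr, min_le_right _ _, fun ξ hξ => ?_⟩
  by_contra hcon
  have h1 := hc ξ ⟨subset_closure (section_mono (min_le_right _ _) hξ),
    fun h => hcon (interior_subset h)⟩
  exact absurd h1 (not_le.mpr ((mem_section_iff.mp hξ).2.trans_le (min_le_left _ _)))

lemma frequently_det_pos (S : DoublingSetup Ω u β ε) {z : E n} {r : ℝ} (hz : z ∈ Ω)
    (hr : 0 < r) (hcpt : CptIn (MASection Ω u z r) Ω) :
    ∃ᶠ w in 𝓝 z, 0 < (Hess u w).det := by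
  rw [Filter.frequently_iff]
  intro W hW
  obtain ⟨s, hs, hsr, hsW⟩ := S.exists_section_subset hz hr hcpt hW
  have hcs := hcpt.mono (section_mono hsr)
  have hpos := S.convex.maMeasure_section_pos hz hs hcs
  by_contra! hcon
  refine hpos.not_ge (setIntegral_nonpos (S.convex.isOpen_section hcs).measurableSet
    fun w hw => hcon w (hsW hw))

end DoublingSetup

/-- `v` is a `C²` solution of the linearized Monge-Ampère equation on `V`. -/
structure IsSol {n : ℕ} (u v : E n → ℝ) (V : Set (E n)) : Prop where
  smooth : ContDiffOn ℝ 2 v V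
  eqn : ∀ y ∈ V, ∑ i, ∑ j, cofU u y i j * pd2 v y i j = 0

lemma IsSol.mono {n : ℕ} {u v : E n → ℝ} {V W : Set (E n)} (h : IsSol u v V) (hW : W ⊆ V) :
    IsSol u v W := ⟨h.smooth.mono hW, fun y hy => h.eqn y (hW hy)⟩

lemma IsSol.affine {n : ℕ} {u v : E n → ℝ} {V : Set (E n)} (h : IsSol u v V) (hV : IsOpen V)
    (a b : ℝ) : IsSol u (fun y => a * v y + b) V := by
  refine ⟨(contDiffOn_const.mul h.smooth).add contDiffOn_const, fun y hy => ?_⟩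
  have h1 := hess_add_smul (h.smooth.contDiffAt (hV.mem_nhds hy)) (g := fun _ => b)
    contDiffAt_const a 1
  have h2 : Hess (fun _ : E n => b) y = 0 := by simpa using hess_affine 0 b y
  rw [h2, smul_zero, add_zero] at h1
  have h3 : ∀ i j, pd2 (fun y => a * v y + b) y i j = a * pd2 v y i j := fun i j => by
    have := congrFun (congrFun h1 i) j
    simpa [Hess] using this
  simp only [h3]
  calc ∑ i, ∑ j, cofU u y i j * (a * pd2 v y i j)
      = a * ∑ i, ∑ j, cofU u y i j * pd2 v y i j := by
        simp only [Finset.mul_sum]; exact Finset.sum_congr rfl fun i _ =>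
          Finset.sum_congr rfl fun j _ => by ring
    _ = 0 := by rw [h.eqn y hy, mul_zero]

lemma measurableSet_inter_le {n : ℕ} {V : Set (E n)} (hV : IsOpen V) {f g : E n → ℝ}
    (hf : ContinuousOn f V) (hg : ContinuousOn g V) : MeasurableSet (V ∩ {z | f z ≤ g z}) := by
  have h : IsOpen (V ∩ (fun z => g z - f z) ⁻¹' Set.Iio 0) :=
    (hg.sub hf).isOpen_inter_preimage hV isOpen_Iio
  have e : V ∩ {z | f z ≤ g z} = V \ (V ∩ (fun z => g z - f z) ⁻¹' Set.Iio 0) := by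
    ext z
    simp only [Set.mem_inter_iff, Set.mem_ofPred_eq, Set.mem_sdiff, Set.mem_preimage, Set.mem_Iio,
      sub_neg, not_and, not_lt]
    tauto
  rw [e]
  exact hV.measurableSet.diff h.measurableSet

/-- Aleksandrov-type comparison of determinants at a contact point. -/
lemma ConvexSetup.det_contact_le {n : ℕ} (hn : 0 < n) {Ω : Set (E n)} {u v : E n → ℝ}
    (S : ConvexSetup Ω u) {V : Set (E n)} (hV : IsOpen V) (hVΩ : V ⊆ Ω) (hv : IsSol u v V)
    {z : E n} (hz : z ∈ V) (hden : ∃ᶠ w in 𝓝 z, 0 < (Hess u w).det) (a : ℝ)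
    (hM : (Hess u z + a • Hess v z).PosSemidef) :
    (Hess u z + a • Hess v z).det ≤ (Hess u z).det := by
  by_cases h0 : (Hess u z + a • Hess v z).det = 0
  · rw [h0]; exact S.det_nonneg (hVΩ hz)
  have hpd : (Hess u z + a • Hess v z).PosDef := hM.posDef_iff_det_ne_zero.mpr h0
  have hcu : ∀ i j, ContinuousAt (fun y => Hess u y i j) z := fun i j =>
    (S.continuousOn_hess i j).continuousAt (S.isOpen.mem_nhds (hVΩ hz))
  have hcv : ∀ i j, ContinuousAt (fun y => Hess v y i j) z := fun i j =>
    (_root_.continuousOn_hess hV hv.smooth i j).continuousAt (hV.mem_nhds hz)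
  have hcM : ∀ i j, ContinuousAt (fun y => (Hess u y + a • Hess v y) i j) z := fun i j => by
    simp only [Matrix.add_apply, Matrix.smul_apply, smul_eq_mul]
    exact (hcu i j).add (continuousAt_const.mul (hcv i j))
  have hsymm : ∀ y ∈ V, (Hess v y).IsSymm := fun y hy =>
    hess_isSymm (hv.smooth.contDiffAt (hV.mem_nhds hy))
  have hev := PosDef.eventually_posSemidef (M := fun y => Hess u y + a • Hess v y) hpd hcM (by
    filter_upwards [hV.mem_nhds hz] with y hy
    exact (isSymm_of_posSemidef (S.hess_posSemidef (hVΩ hy))).add ((hsymm y hy).smul a))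
  have hfreq : ∃ᶠ y in 𝓝 z, (Hess u y + a • Hess v y).det ≤ (Hess u y).det := by
    refine (hden.and_eventually (hev.and (hV.mem_nhds hz))).mono ?_
    rintro y ⟨h1, h2, hy⟩
    refine det_le_det_of_trace_adjugate_mul_le hn
      ((S.hess_posSemidef (hVΩ hy)).posDef_iff_det_ne_zero.mpr h1.ne') h2 (le_of_eq ?_)
    have h3 : ((Hess u y).adjugate * Hess v y).trace = 0 := by
      rw [← hv.eqn y hy, Matrix.trace]
      refine Finset.sum_congr rfl fun i _ => ?_
      rw [Matrix.diag_apply, Matrix.mul_apply]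
      refine Finset.sum_congr rfl fun j _ => ?_
      rw [(hsymm y hy).apply i j]; rfl
    rw [mul_add, Matrix.trace_add, Matrix.mul_smul, Matrix.trace_smul, h3, Matrix.adjugate_mul,
      Matrix.trace_smul, Matrix.trace_one]
    simp [mul_comm]
  by_contra! hcon
  have hc1 : ContinuousAt (fun y => (Hess u y + a • Hess v y).det) z :=
    ContinuousAt.comp (g := Matrix.det) (Continuous.matrix_det continuous_id).continuousAt
      (continuousAt_pi.mpr fun i => continuousAt_pi.mpr fun j => hcM i j)
  have hc2 : ContinuousAt (fun y => (Hess u y).det) z :=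
    S.continuousOn_det.continuousAt (S.isOpen.mem_nhds (hVΩ hz))
  exact hfreq ((hc2.eventually_lt hc1 hcon).mono fun y hy => not_le.mpr hy)

namespace DoublingSetup

variable {n : ℕ} {Ω : Set (E n)} {u : E n → ℝ} {β ε : ℝ}

lemma maMeasure_pow_le (S : DoublingSetup Ω u β ε) {y : E n} (hy : y ∈ Ω) {s : ℝ} (hs : 0 < s)
    (hcpt : CptIn (MASection Ω u y s) Ω) (k : ℕ) :
    maMeasure u (MASection Ω u y s) ≤ β ^ k * maMeasure u (MASection Ω u y (s / 2 ^ k)) := by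
  have hβ := S.one_lt
  induction k with
  | zero => simp
  | succ k ih =>
    have h1 := S.doubling y hy (s / 2 ^ k) (by positivity)
      (hcpt.mono (section_mono (div_le_self hs.le (one_le_pow₀ (by norm_num)))))
    calc _ ≤ _ := ih
      _ ≤ β ^ k * (β * maMeasure u (MASection Ω u y (s / 2 ^ k / 2))) := by gcongr
      _ = _ := by rw [div_div, ← pow_succ, pow_succ β]; ring

/-- Comparison of the measures of concentric sections. -/
lemma exists_measure_ratio (β : ℝ) (hβ : 1 < β) {κ : ℝ} (hκ : 0 < κ) :
    ∃ c : ℝ, 0 < c ∧ ∀ {n : ℕ} {Ω : Set (E n)} {u : E n → ℝ} {ε : ℝ}, DoublingSetup Ω u β ε →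
      ∀ y ∈ Ω, ∀ s : ℝ, 0 < s → CptIn (MASection Ω u y s) Ω →
      ∀ A : Set (E n), MASection Ω u y (κ * s) ⊆ A → CptIn A Ω → MeasurableSet A →
        c * maMeasure u (MASection Ω u y s) ≤ maMeasure u A := by
  obtain ⟨k, hk⟩ := exists_pow_lt_of_lt_one hκ (by norm_num : (1 / 2 : ℝ) < 1)
  refine ⟨(β ^ k)⁻¹, by positivity, fun {n Ω u ε} S y hy s hs hcpt A hA hAc hAm => ?_⟩
  rw [inv_mul_le_iff₀ (by positivity)]
  refine (S.maMeasure_pow_le hy hs hcpt k).trans ?_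
  have hsub : MASection Ω u y (s / 2 ^ k) ⊆ A := (section_mono (by
    rw [one_div, inv_pow] at hk
    rw [div_eq_inv_mul]; gcongr)).trans hA
  exact mul_le_mul_of_nonneg_left (S.convex.maMeasure_mono hAc hAm hsub) (by positivity)

/-- Critical density estimate. -/
theorem exists_critical_density {n : ℕ} (hn : 0 < n) {β ε : ℝ} (hβ : 1 < β) (hε : 0 < ε) :
    ∃ c : ℝ, 0 < c ∧ ∀ {Ω : Set (E n)} {u : E n → ℝ}, DoublingSetup Ω u β ε →
      ∀ y ∈ Ω, ∀ s : ℝ, 0 < s → CptIn (MASection Ω u y (20 / ε * s)) Ω →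
      ∀ v : E n → ℝ, IsSol u v (MASection Ω u y s) → (∀ z ∈ MASection Ω u y s, 0 ≤ v z) →
      v y ≤ 1 → c * maMeasure u (MASection Ω u y s) ≤
        maMeasure u (MASection Ω u y (s / 2) ∩ {z | v z ≤ 3}) := by
  set κ := ε / 20 with hκ
  have hκ0 : 0 < κ := by positivity
  set θ := 1 + 2 / ε with hθ
  have hθ1 : 1 ≤ θ := by rw [hθ]; linarith [div_pos two_pos hε]
  set κ' := κ / (4 * θ) with hκ'
  have hκ'0 : 0 < κ' := by positivity
  have hκ'θ : θ * κ' = κ / 4 := by rw [hκ']; field_simp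
  have hκ'κ : κ' ≤ κ / 4 := by nlinarith
  obtain ⟨c, hc, hratio⟩ := exists_measure_ratio β hβ hκ'0
  refine ⟨c, hc, fun {Ω u} S y hy s hs hcpt v hv hv0 hvy => ?_⟩
  have hε1 := S.eps_lt
  have hκ1 : κ < 1 / 20 := by rw [hκ]; linarith
  have hbig : s ≤ 20 / ε * s := by
    have : 1 ≤ 20 / ε := by rw [one_le_div hε]; linarith
    nlinarith
  have hsc : CptIn (MASection Ω u y s) Ω := hcpt.mono (section_mono hbig)
  have hso := S.convex.isOpen_section hsc
  set V := MASection Ω u y (s / 2) with hV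
  have hVs : V ⊆ MASection Ω u y s := section_mono (by linarith)
  have hVc : CptIn V Ω := hsc.mono hVs
  have hVo := S.convex.isOpen_section hVc
  have hclV : closure V ⊆ MASection Ω u y s := fun w hw =>
    mem_section_iff.mpr ⟨subset_closure (hVc.2 hw),
      (S.convex.breg_le_of_mem_closure hVc hw).trans_lt (by linarith)⟩
  have hden : ∀ z ∈ V, ∃ᶠ w in 𝓝 z, 0 < (Hess u w).det := fun z hz => by
    have hκs : κ * (20 / ε * s) = s := by rw [hκ]; field_simp
    refine S.frequently_det_pos (hVc.subset hz) hs (hcpt.mono ?_)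
    have := S.engulfing (z := z) hy (by positivity) hcpt (by rw [← hκ, hκs]; exact hVs hz)
    rwa [← hκ, hκs] at this
  have hvV : IsSol u v V := hv.mono hVs
  set B := MASection Ω u y (κ' * s) with hB
  have hBV : B ⊆ V := section_mono (by nlinarith)
  have hBc := hVc.mono hBV
  have hBo := S.convex.isOpen_section hBc
  have hyB : y ∈ B := self_mem hy (by positivity)
  set a := 8 / (κ * s) with ha
  have ha0 : 0 < a := by positivity
  have haκ : a * (κ * s) = 8 := by rw [ha]; field_simp
  set f : E n → ℝ := fun z => 1 * u z + a⁻¹ * v z with hf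
  have hv2 : ∀ z ∈ V, ContDiffAt ℝ 2 v z := fun z hz =>
    hvV.smooth.contDiffAt (hVo.mem_nhds hz)
  have hf2 : ∀ z ∈ V, ContDiffAt ℝ 2 f z := fun z hz =>
    (contDiffAt_const.mul (S.convex.contDiffAt_two (hVc.subset hz))).add
      (contDiffAt_const.mul (hv2 z hz))
  have hHf : ∀ z ∈ V, Hess f z = Hess u z + a⁻¹ • Hess v z := fun z hz => by
    rw [hf, hess_add_smul (S.convex.contDiffAt_two (hVc.subset hz)) (hv2 z hz), one_smul]
  have hdetf : ContinuousOn (fun z => (Hess f z).det) V :=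
    (Continuous.matrix_det continuous_id).comp_continuousOn (continuousOn_pi.mpr fun i =>
      continuousOn_pi.mpr fun j => _root_.continuousOn_hess hVo
        (fun z hz => (hf2 z hz).contDiffWithinAt) i j)
  set A := V ∩ {z | v z ≤ 3} with hA
  have hAm : MeasurableSet A :=
    measurableSet_inter_le hVo (hvV.smooth.continuousOn) continuousOn_const
  set A' := A ∩ (V ∩ {z | |(Hess f z).det| ≤ (Hess u z).det}) with hA'
  have hA'm : MeasurableSet A' := hAm.inter
    (measurableSet_inter_le hVo hdetf.abs (S.convex.continuousOn_det.mono hVc.subset))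
  have hAc : CptIn A Ω := hVc.mono Set.inter_subset_left
  have hA'c : CptIn A' Ω := hAc.mono Set.inter_subset_left
  have hcontact : gradient u '' B ⊆ gradient f '' A' := by
    rintro _ ⟨b, hb, rfl⟩
    have hbΩ := hBc.subset hb
    have hby : breg u b y < θ * (κ' * s) := S.breg_lt_of_mem hy
      (hVc.mono (section_mono (by nlinarith))) hb hyB
    have hbw : ∀ w ∈ closure V, w ∉ V → κ * s / 2 ≤ breg u b w := fun w hw hwV => by
      by_contra! hcon
      refine hwV (S.engulfing hy (by positivity) hVc (z := b)
        (section_mono (by rw [← hκ]; nlinarith) hb) (mem_section_iff.mpr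
          ⟨subset_closure (hVc.2 hw), by rw [← hκ]; linarith⟩))
    have hcont : ContinuousOn (fun z => v z + a * breg u b z) (closure V) :=
      (hv.smooth.continuousOn.mono hclV).add
        (continuousOn_const.mul ((S.convex.continuousOn_breg b).mono hVc.2))
    have hvy3 : v y + a * breg u b y ≤ 3 := by
      have : a * breg u b y ≤ a * (κ * s) / 4 := by
        calc a * breg u b y ≤ a * (θ * (κ' * s)) := by gcongr
          _ = a * ((θ * κ') * s) := by ring
          _ = _ := by rw [hκ'θ]; ring
      linarith
    obtain ⟨z, hz, hmin⟩ := exists_interior_min hVc.1 (h := fun z => v z + a * breg u b z) hcont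
      (hBV hyB) (fun w hw hwV => by
        have h1 := mul_le_mul_of_nonneg_left (hbw w hw hwV) ha0.le
        have h2 := hv0 w (hclV hw)
        linarith)
    have hzΩ := hVc.subset hz
    have hloc := isLocalMin_of_open (h := fun z => v z + a * breg u b z) hVo hz hmin
    have hz3 : v z ≤ 3 := by
      have h1 := hmin y (subset_closure (hBV hyB))
      have h2 := S.convex.breg_nonneg hbΩ (subset_closure hzΩ)
      nlinarith
    have hd : HasFDerivAt (fun z => v z + a * breg u b z)
        (fderiv ℝ v z + a • (fderiv ℝ u z - fderiv ℝ u b)) z :=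
      ((hv2 z hz).differentiableAt (by norm_num)).hasFDerivAt.add
        ((S.convex.fderiv_breg b hzΩ).const_mul a)
    have hd0 := hloc.hasFDerivAt_eq_zero hd
    have hfd : HasFDerivAt f (fderiv ℝ u z + a⁻¹ • fderiv ℝ v z) z := by
      have := ((S.convex.differentiableAt hzΩ).hasFDerivAt.const_mul 1).add
        (((hv2 z hz).differentiableAt (by norm_num)).hasFDerivAt.const_mul a⁻¹)
      rwa [one_smul] at this
    have hgf : gradient f z = gradient u b := by
      unfold gradient
      rw [hfd.fderiv]
      congr 1
      have h3 : fderiv ℝ v z = - (a • (fderiv ℝ u z - fderiv ℝ u b)) :=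
        eq_neg_of_add_eq_zero_left hd0
      rw [h3, smul_neg, smul_smul, inv_mul_cancel₀ ha0.ne', one_smul]
      abel
    have hpsd : (Hess u z + a⁻¹ • Hess v z).PosSemidef := by
      have h4 := hess_posSemidef_of_isLocalMin (f := fun z => a⁻¹ * (v z + a * breg u b z)) ?_
        (hloc.mono fun w hw => mul_le_mul_of_nonneg_left hw (by positivity))
      · have e : (fun z => a⁻¹ * (v z + a * breg u b z)) =
            fun z => 1 * breg u b z + a⁻¹ * v z := by
          funext z; field_simp; ring
        rw [e, hess_add_smul ((S.convex.contDiffAt_breg b hzΩ).of_le (by norm_num)) (hv2 z hz),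
          one_smul, S.convex.hess_breg b hzΩ] at h4
        exact h4
      · exact contDiffAt_const.mul ((hv2 z hz).add (contDiffAt_const.mul
          ((S.convex.contDiffAt_breg b hzΩ).of_le (by norm_num))))
    refine ⟨z, ⟨⟨hz, hz3⟩, hz, ?_⟩, hgf⟩
    simp only [Set.mem_ofPred_eq]
    rw [hHf z hz, abs_of_nonneg hpsd.det_nonneg]
    exact S.convex.det_contact_le hn hVo hVc.subset hvV hz (hden z hz) _ hpsd
  have hchain : ENNReal.ofReal (maMeasure u B) ≤ ENNReal.ofReal (maMeasure u A') := by
    rw [S.convex.maMeasure_eq_volume hBc hBo.measurableSet]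
    calc _ ≤ volume (gradient u '' B) := measure_mono (Set.image_mono Set.inter_subset_left)
      _ ≤ volume (gradient f '' A') := measure_mono hcontact
      _ ≤ ∫⁻ z in A', ENNReal.ofReal |(hessCLM f z).det| :=
          addHaar_image_le_lintegral_abs_det_fderiv volume hA'm fun z hz =>
            (hasFDerivAt_gradient (hf2 z hz.1.1)).hasFDerivWithinAt
      _ ≤ ∫⁻ z in A', ENNReal.ofReal (Hess u z).det := by
          refine setLIntegral_mono' hA'm fun z hz => ENNReal.ofReal_le_ofReal ?_
          rw [det_hessCLM]; exact hz.2.2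
      _ = _ := (S.convex.ofReal_maMeasure hA'c hA'm).symm
  have h1 : maMeasure u B ≤ maMeasure u A' :=
    (ENNReal.ofReal_le_ofReal_iff (S.convex.maMeasure_nonneg hA'c.subset hA'm)).mp hchain
  calc c * maMeasure u (MASection Ω u y s) ≤ maMeasure u B :=
        hratio S y hy s hs hsc B subset_rfl hBc hBo.measurableSet
    _ ≤ maMeasure u A' := h1
    _ ≤ maMeasure u A := S.convex.maMeasure_mono hAc hAm Set.inter_subset_left

end DoublingSetup

/-- The determinant as a continuous multilinear function of the rows. -/
def detCMM (n : ℕ) : ContinuousMultilinearMap ℝ (fun _ : Fin n => Fin n → ℝ) ℝ where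
  toMultilinearMap := (Matrix.detRowAlternating (n := Fin n) (R := ℝ)).toMultilinearMap
  cont := Continuous.matrix_det continuous_id

lemma detCMM_apply {n : ℕ} (A : Fin n → Fin n → ℝ) :
    detCMM n A = Matrix.detRowAlternating A := rfl

lemma sum_detCMM_update_eq_zero {n : ℕ} (A : Fin n → Fin n → ℝ) {j k : Fin n} (hjk : j ≠ k)
    {T : Fin n → Fin n → ℝ} (hT : ∀ i l, T i l = T l i) :
    ∑ i, detCMM n (Function.update (Function.update A j (Pi.single i 1)) k (T i)) = 0 := by
  set f : Fin n → Fin n → ℝ := fun i l =>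
    detCMM n (Function.update (Function.update A j (Pi.single i 1)) k (Pi.single l 1)) with hf
  have hexp : ∀ i, detCMM n (Function.update (Function.update A j (Pi.single i 1)) k (T i)) =
      ∑ l, T i l * f i l := fun i => by
    have h1 : T i = ∑ l, T i l • (Pi.single l (1 : ℝ) : Fin n → ℝ) := by
      ext m; simp [Finset.sum_apply, Pi.single_apply]
    conv_lhs => rw [h1]
    have h2 := (detCMM n).toMultilinearMap.map_update_sum Finset.univ k
      (fun l => T i l • (Pi.single l (1 : ℝ) : Fin n → ℝ))
      (Function.update A j (Pi.single i 1))
    refine Eq.trans h2 (Finset.sum_congr rfl fun l _ => ?_)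
    exact (detCMM n).map_update_smul _ k (T i l) _
  have hanti : ∀ i l, f i l = - f l i := fun i l => by
    have h := (Matrix.detRowAlternating (n := Fin n) (R := ℝ)).map_swap
      (Function.update (Function.update A j (Pi.single l 1)) k (Pi.single i 1)) hjk
    rw [hf]
    simp only [detCMM_apply]
    rw [← h]
    congr 1
    ext a b
    simp only [Function.comp]
    by_cases haj : a = j
    · subst haj
      simp [Equiv.swap_apply_left, hjk]
    · by_cases hak : a = k
      · subst hak
        simp [Equiv.swap_apply_right, hjk]
      · simp [Equiv.swap_apply_of_ne_of_ne haj hak, haj, hak]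
  simp only [hexp]
  have h2 : ∑ i, ∑ l, T i l * f i l = - ∑ i, ∑ l, T i l * f i l := by
    conv_lhs => rw [Finset.sum_comm]
    rw [← Finset.sum_neg_distrib]
    refine Finset.sum_congr rfl fun i _ => ?_
    rw [← Finset.sum_neg_distrib]
    refine Finset.sum_congr rfl fun l _ => ?_
    rw [hT l i, hanti l i]; ring
  linarith

lemma contDiffOn_hess {n : ℕ} {f : E n → ℝ} {V : Set (E n)} (hV : IsOpen V)
    (hf : ContDiffOn ℝ 3 f V) (k l : Fin n) : ContDiffOn ℝ 1 (fun x => Hess f x k l) V := by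
  have h1 : ContDiffOn ℝ 2 (fun y => fderiv ℝ f y (EuclideanSpace.single l 1)) V :=
    (hf.fderiv_of_isOpen hV (by norm_num)).clm_apply contDiffOn_const
  exact (h1.fderiv_of_isOpen hV (by norm_num)).clm_apply contDiffOn_const

lemma fderiv_hess_symm {n : ℕ} {f : E n → ℝ} {V : Set (E n)} (hV : IsOpen V)
    (hf : ContDiffOn ℝ 3 f V) {x : E n} (hx : x ∈ V) (i k l : Fin n) :
    fderiv ℝ (fun x => Hess f x k l) x (EuclideanSpace.single i 1) =
      fderiv ℝ (fun x => Hess f x k i) x (EuclideanSpace.single l 1) := by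
  have h1 : ContDiffOn ℝ 2 (fun y => fderiv ℝ f y (EuclideanSpace.single k 1)) V :=
    (hf.fderiv_of_isOpen hV (by norm_num)).clm_apply contDiffOn_const
  have h2 := hess_isSymm (h1.contDiffAt (hV.mem_nhds hx))
  have h3 : ∀ m, (fun x => Hess f x k m) =ᶠ[𝓝 x]
      fun x => fderiv ℝ (fun y => fderiv ℝ f y (EuclideanSpace.single k 1)) x
        (EuclideanSpace.single m 1) := fun m => by
    filter_upwards [hV.mem_nhds hx] with y hy
    exact ((hess_isSymm ((hf.contDiffAt (hV.mem_nhds hy)).of_le (by norm_num))).apply k m).symm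
  rw [(h3 l).fderiv_eq, (h3 i).fderiv_eq]
  exact h2.apply l i

/-- The rows of the Hessian. -/
def hessRows {n : ℕ} (u : E n → ℝ) (x : E n) : Fin n → Fin n → ℝ := fun k l => Hess u x k l

lemma contDiffOn_cofU {n : ℕ} {u : E n → ℝ} {V : Set (E n)} (hV : IsOpen V)
    (hu : ContDiffOn ℝ 3 u V) (i j : Fin n) : ContDiffOn ℝ 1 (fun x => cofU u x i j) V := by
  have h1 : (fun x => cofU u x i j) = fun x => detCMM n
      (Function.update (hessRows u x) j (Pi.single i 1)) := by
    funext x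
    rw [cofU, Matrix.adjugate_apply]; rfl
  rw [h1]
  refine (detCMM n).contDiff.comp_contDiffOn (contDiffOn_pi.mpr fun k => ?_)
  by_cases hkj : k = j
  · subst hkj; simp only [Function.update_self]; exact contDiffOn_const
  · simp only [Function.update_of_ne hkj]
    exact contDiffOn_pi.mpr fun l => contDiffOn_hess hV hu k l

/-- The cofactor matrix of a Hessian is divergence free. -/
theorem div_cofU_eq_zero {n : ℕ} {u : E n → ℝ} {V : Set (E n)} (hV : IsOpen V)
    (hu : ContDiffOn ℝ 3 u V) {x : E n} (hx : x ∈ V) (j : Fin n) :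
    ∑ i, fderiv ℝ (fun x => cofU u x i j) x (EuclideanSpace.single i 1) = 0 := by
  have hd : ∀ k l, DifferentiableAt ℝ (fun x => Hess u x k l) x := fun k l =>
    ((contDiffOn_hess hV hu k l).contDiffAt (hV.mem_nhds hx)).differentiableAt (by norm_num)
  set T : Fin n → Fin n → Fin n → ℝ := fun k i l =>
    fderiv ℝ (fun x => Hess u x k l) x (EuclideanSpace.single i 1) with hT
  have hrow : ∀ k, HasFDerivAt (fun x => hessRows u x k)
      (ContinuousLinearMap.pi fun l => fderiv ℝ (fun x => Hess u x k l) x) x := fun k =>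
    hasFDerivAt_pi.mpr fun l => (hd k l).hasFDerivAt
  have hder : ∀ i, fderiv ℝ (fun x => cofU u x i j) x (EuclideanSpace.single i 1) =
      ∑ k, if k = j then 0 else detCMM n
        (Function.update (Function.update (hessRows u x) j (Pi.single i 1)) k
          (T k i)) := fun i => by
    have h1 : (fun x => cofU u x i j) = fun x => detCMM n
        (Function.update (hessRows u x) j (Pi.single i 1)) := by
      funext x
      rw [cofU, Matrix.adjugate_apply]; rfl
    have h2 : HasFDerivAt (fun x => Function.update (hessRows u x) j
        (Pi.single i 1)) (ContinuousLinearMap.pi fun k => if k = j then 0 else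
          (ContinuousLinearMap.pi fun l => fderiv ℝ (fun x => Hess u x k l) x)) x := by
      refine hasFDerivAt_pi.mpr fun k => ?_
      by_cases hkj : k = j
      · subst hkj; simp only [Function.update_self, if_true]; exact hasFDerivAt_const _ _
      · simp only [Function.update_of_ne hkj, if_neg hkj]; exact hrow k
    have h3 := ((detCMM n).hasFDerivAt (x := Function.update (hessRows u x) j
        (Pi.single i 1))).comp x h2
    rw [h1]
    erw [h3.fderiv]
    rw [ContinuousLinearMap.comp_apply, ContinuousMultilinearMap.linearDeriv_apply]
    refine Finset.sum_congr rfl fun k _ => ?_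
    by_cases hkj : k = j
    · subst hkj
      simp only [ContinuousLinearMap.pi_apply, if_true, _root_.zero_apply]
      exact (detCMM n).map_coord_zero k (by simp)
    · simp only [ContinuousLinearMap.pi_apply, if_neg hkj]
      rfl
  simp only [hder]
  rw [Finset.sum_comm]
  refine Finset.sum_eq_zero fun k _ => ?_
  by_cases hkj : k = j
  · simp [hkj]
  · simp only [if_neg hkj]
    exact sum_detCMM_update_eq_zero _ (Ne.symm hkj) fun i l => fderiv_hess_symm hV hu hx i k l

lemma integral_lineDeriv_eq_zero {n : ℕ} {X : E n → ℝ} (hX : ContDiff ℝ 1 X)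
    (hc : HasCompactSupport X) (e : E n) : ∫ x, fderiv ℝ X x e = 0 := by
  have hi : Integrable X := hX.continuous.integrable_of_hasCompactSupport hc
  have hi' : Integrable (fun x => fderiv ℝ X x e) := by
    refine Continuous.integrable_of_hasCompactSupport
      ((hX.continuous_fderiv (by norm_num)).clm_apply continuous_const) ?_
    exact (hc.fderiv (𝕜 := ℝ)).mono fun x hx => by
      simp only [Function.mem_support] at hx ⊢
      intro h; exact hx (by rw [h]; rfl)
  have := integral_bilinear_hasLineDerivAt_right_eq_neg_left_of_integrable (μ := volume)
    (f := fun _ : E n => (1 : ℝ)) (f' := fun _ => 0) (g := X) (g' := fun x => fderiv ℝ X x e)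
    (v := e) (B := ContinuousLinearMap.mul ℝ ℝ) (by simp) (by simpa using hi') (by simpa using hi)
    (fun x _ => by simpa using (hasFDerivAt_const (1 : ℝ) x).hasLineDerivAt e)
    (fun x _ => (hX.differentiable (by norm_num) x).hasFDerivAt.hasLineDerivAt e)
  simpa using this

lemma contDiff_of_compact {n : ℕ} {X : E n → ℝ} {V K : Set (E n)} (hV : IsOpen V)
    (hK : IsClosed K) (hKV : K ⊆ V) (hX : ContDiffOn ℝ 1 X V) (h0 : ∀ x ∉ K, X x = 0) :
    ContDiff ℝ 1 X := by
  rw [contDiff_iff_contDiffAt]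
  intro x
  by_cases hx : x ∈ K
  · exact hX.contDiffAt (hV.mem_nhds (hKV hx))
  · refine (contDiffAt_const (c := (0 : ℝ))).congr_of_eventuallyEq ?_
    filter_upwards [hK.isOpen_compl.mem_nhds hx] with y hy using h0 y hy

lemma gradient_eq_zero_of_compact {n : ℕ} {X : E n → ℝ} {K : Set (E n)}
    (hK : IsClosed K) (h0 : ∀ x ∉ K, X x = 0) {x : E n} (hx : x ∉ K) : gradient X x = 0 := by
  have : X =ᶠ[𝓝 x] fun _ => (0 : ℝ) := by
    filter_upwards [hK.isOpen_compl.mem_nhds hx] with y hy using h0 y hy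
  unfold gradient
  rw [this.fderiv_eq]; simp

lemma qf_gradient {n : ℕ} (A : Matrix (Fin n) (Fin n) ℝ) (f g : E n → ℝ) (x : E n) :
    qf A (gradient f x) (gradient g x) = ∑ i, ∑ j, A i j * pd f x i * pd g x j := by
  simp only [qf, gradient_apply]

lemma contDiffOn_pd {n : ℕ} {w : E n → ℝ} {V : Set (E n)} (hV : IsOpen V)
    (hw : ContDiffOn ℝ 2 w V) (j : Fin n) : ContDiffOn ℝ 1 (fun x => pd w x j) V :=
  (hw.fderiv_of_isOpen hV (by norm_num)).clm_apply contDiffOn_const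

/-- Integration by parts for the linearized Monge-Ampère operator. -/
theorem integral_mul_linearized {n : ℕ} {u w ψ : E n → ℝ} {V K : Set (E n)} (hV : IsOpen V)
    (hu : ContDiffOn ℝ 3 u V) (hw : ContDiffOn ℝ 2 w V) (hψ : ContDiffOn ℝ 1 ψ V)
    (hK : IsCompact K) (hKV : K ⊆ V) (h0 : ∀ x ∉ K, ψ x = 0) :
    Integrable (fun x => ψ x * ∑ i, ∑ j, cofU u x i j * pd2 w x i j) ∧
    Integrable (fun x => qf (cofU u x) (gradient ψ x) (gradient w x)) ∧
    ∫ x, ψ x * ∑ i, ∑ j, cofU u x i j * pd2 w x i j =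
      - ∫ x, qf (cofU u x) (gradient ψ x) (gradient w x) := by
  set X : Fin n → E n → ℝ := fun i x => ψ x * ∑ j, cofU u x i j * pd w x j with hX
  have hXs : ∀ i, ContDiffOn ℝ 1 (X i) V := fun i =>
    hψ.mul (ContDiffOn.sum fun j _ => (contDiffOn_cofU hV hu i j).mul (contDiffOn_pd hV hw j))
  have hX0 : ∀ i, ∀ x ∉ K, X i x = 0 := fun i x hx => by simp [hX, h0 x hx]
  have hXc : ∀ i, ContDiff ℝ 1 (X i) := fun i =>
    contDiff_of_compact hV hK.isClosed hKV (hXs i) (hX0 i)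
  have hXcs : ∀ i, HasCompactSupport (X i) := fun i =>
    HasCompactSupport.intro hK (hX0 i)
  have hderi : ∀ i, ∀ x ∈ V, fderiv ℝ (X i) x (EuclideanSpace.single i 1) =
      pd ψ x i * (∑ j, cofU u x i j * pd w x j) +
        ψ x * ∑ j, (cofU u x i j * pd2 w x i j +
          fderiv ℝ (fun x => cofU u x i j) x (EuclideanSpace.single i 1) * pd w x j) := by
    intro i x hx
    have hcd : ∀ j, HasFDerivAt (fun x => cofU u x i j) (fderiv ℝ (fun x => cofU u x i j) x) x :=
      fun j => (((contDiffOn_cofU hV hu i j).contDiffAt (hV.mem_nhds hx)).differentiableAt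
        (by norm_num)).hasFDerivAt
    have hpd : ∀ j, HasFDerivAt (fun x => pd w x j) (fderiv ℝ (fun x => pd w x j) x) x :=
      fun j => (((contDiffOn_pd hV hw j).contDiffAt (hV.mem_nhds hx)).differentiableAt
        (by norm_num)).hasFDerivAt
    have hψd : HasFDerivAt ψ (fderiv ℝ ψ x) x :=
      ((hψ.contDiffAt (hV.mem_nhds hx)).differentiableAt (by norm_num)).hasFDerivAt
    have h1 := hψd.mul (HasFDerivAt.fun_sum (u := Finset.univ)
      fun j _ => (hcd j).mul (hpd j))
    have h2 : fderiv ℝ (X i) x = _ := h1.fderiv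
    rw [h2]
    simp only [_root_.add_apply, _root_.smul_apply, _root_.sum_apply, smul_eq_mul, pd2]
    rw [add_comm, mul_comm (∑ j, _) (fderiv ℝ ψ x _)]
    refine congrArg₂ _ rfl (congrArg _ (Finset.sum_congr rfl fun j _ => ?_))
    rw [mul_comm (pd w x j)]
    rfl
  have hsum : ∀ x, ∑ i, fderiv ℝ (X i) x (EuclideanSpace.single i 1) =
      qf (cofU u x) (gradient ψ x) (gradient w x) +
        ψ x * ∑ i, ∑ j, cofU u x i j * pd2 w x i j := by
    intro x
    by_cases hx : x ∈ K
    · have hxV := hKV hx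
      rw [qf_gradient]
      have hdiv := fun j => div_cofU_eq_zero hV hu hxV j
      calc _ = ∑ i, (pd ψ x i * (∑ j, cofU u x i j * pd w x j) +
            ψ x * ∑ j, (cofU u x i j * pd2 w x i j +
              fderiv ℝ (fun x => cofU u x i j) x (EuclideanSpace.single i 1) * pd w x j)) :=
            Finset.sum_congr rfl fun i _ => hderi i x hxV
        _ = ∑ i, ∑ j, cofU u x i j * pd ψ x i * pd w x j +
            (ψ x * ∑ i, ∑ j, cofU u x i j * pd2 w x i j +
            ψ x * ∑ i, ∑ j, fderiv ℝ (fun x => cofU u x i j) x (EuclideanSpace.single i 1)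
              * pd w x j) := by
            rw [Finset.sum_add_distrib, ← Finset.mul_sum, ← mul_add, ← Finset.sum_add_distrib]
            refine congrArg₂ _ (Finset.sum_congr rfl fun i _ => ?_)
              (congrArg _ (Finset.sum_congr rfl fun i _ => Finset.sum_add_distrib))
            rw [Finset.mul_sum]
            exact Finset.sum_congr rfl fun j _ => by ring
        _ = _ := by
            have : ∑ i, ∑ j, fderiv ℝ (fun x => cofU u x i j) x (EuclideanSpace.single i 1)
              * pd w x j = 0 := by
              rw [Finset.sum_comm]
              refine Finset.sum_eq_zero fun j _ => ?_
              rw [← Finset.sum_mul, hdiv j, zero_mul]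
            rw [this, mul_zero, add_zero]
    · have h3 : ∀ i, fderiv ℝ (X i) x (EuclideanSpace.single i 1) = 0 := fun i => by
        have := gradient_eq_zero_of_compact hK.isClosed (hX0 i) hx
        rw [← inner_gradient, this, inner_zero_left]
      rw [h0 x hx, gradient_eq_zero_of_compact hK.isClosed h0 hx]
      simp [h3, qf]
  have h_int : ∀ i, Integrable (fun x => fderiv ℝ (X i) x (EuclideanSpace.single i 1)) := fun i => by
    refine Continuous.integrable_of_hasCompactSupport
      (((hXc i).continuous_fderiv (by norm_num)).clm_apply continuous_const) ?_
    refine HasCompactSupport.intro hK fun x hx => ?_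
    rw [← inner_gradient, gradient_eq_zero_of_compact hK.isClosed (hX0 i) hx, inner_zero_left]
  have htot : ∫ x, (qf (cofU u x) (gradient ψ x) (gradient w x) +
      ψ x * ∑ i, ∑ j, cofU u x i j * pd2 w x i j) = 0 := by
    simp only [← hsum]
    rw [integral_finsetSum _ fun i _ => h_int i]
    exact Finset.sum_eq_zero fun i _ => integral_lineDeriv_eq_zero (hXc i) (hXcs i) _
  have hψc : ContDiff ℝ 1 ψ := contDiff_of_compact hV hK.isClosed hKV hψ h0
  have hq : Integrable (fun x => qf (cofU u x) (gradient ψ x) (gradient w x)) := by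
    have hcont : ContinuousOn (fun x => qf (cofU u x) (gradient ψ x) (gradient w x)) V := by
      simp only [qf_gradient]
      refine continuousOn_finsetSum _ fun i _ => continuousOn_finsetSum _ fun j _ => ?_
      refine ((contDiffOn_cofU hV hu i j).continuousOn.mul ?_).mul (contDiffOn_pd hV hw j).continuousOn
      exact ((hψc.continuous_fderiv (by norm_num)).clm_apply continuous_const).continuousOn
    refine (integrableOn_iff_integrable_of_support_subset fun x hx => ?_).mp
      ((hcont.mono hKV).integrableOn_compact hK)
    by_contra hxK
    simp only [Function.mem_support] at hx
    rw [gradient_eq_zero_of_compact hK.isClosed h0 hxK] at hx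
    exact hx (by simp [qf])
  have hr : Integrable (fun x => ψ x * ∑ i, ∑ j, cofU u x i j * pd2 w x i j) := by
    have hcont : ContinuousOn (fun x => ψ x * ∑ i, ∑ j, cofU u x i j * pd2 w x i j) V := by
      refine hψ.continuousOn.mul (continuousOn_finsetSum _ fun i _ =>
        continuousOn_finsetSum _ fun j _ => ?_)
      exact (contDiffOn_cofU hV hu i j).continuousOn.mul (continuousOn_hess hV hw i j)
    refine (integrableOn_iff_integrable_of_support_subset fun x hx => ?_).mp
      ((hcont.mono hKV).integrableOn_compact hK)
    by_contra hxK
    exact hx (by simp [h0 x hxK])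
  rw [integral_add hq hr] at htot
  exact ⟨hr, hq, by linarith⟩

lemma hasDerivAt_max_zero_sq (t : ℝ) :
    HasDerivAt (fun t : ℝ => (max t 0) ^ 2) (2 * max t 0) t := by
  rcases lt_trichotomy t 0 with h | h | h
  · rw [max_eq_right h.le, mul_zero]
    refine (hasDerivAt_const t (0 : ℝ)).congr_of_eventuallyEq ?_
    filter_upwards [Iio_mem_nhds h] with y hy
    rw [max_eq_right (le_of_lt hy)]; norm_num
  · subst h
    rw [max_self, mul_zero, hasDerivAt_iff_isLittleO_nhds_zero]
    simp only [zero_add, max_self, smul_zero, sub_zero]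
    have h1 : (fun t : ℝ => (max t 0) ^ 2 - 0 ^ 2) =O[𝓝 0] fun t : ℝ => t ^ 2 := by
      refine Asymptotics.IsBigO.of_bound 1 (Filter.Eventually.of_forall fun x => ?_)
      rw [zero_pow two_ne_zero, sub_zero, Real.norm_of_nonneg (by positivity), Real.norm_of_nonneg (by positivity)]
      rcases le_total x 0 with h | h
      · rw [max_eq_right h]; nlinarith [sq_nonneg x]
      · rw [max_eq_left h]; linarith
    exact h1.trans_isLittleO (Asymptotics.isLittleO_pow_id one_lt_two)
  · rw [max_eq_left h.le]
    have h1 : HasDerivAt (fun t : ℝ => t ^ 2) (2 * t) t := by simpa using hasDerivAt_pow 2 t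
    refine h1.congr_of_eventuallyEq ?_
    filter_upwards [Ioi_mem_nhds h] with y hy
    rw [max_eq_left (le_of_lt hy)]

lemma contDiff_max_zero_sq : ContDiff ℝ 1 fun t : ℝ => (max t 0) ^ 2 := by
  rw [contDiff_one_iff_deriv]
  refine ⟨fun t => (hasDerivAt_max_zero_sq t).differentiableAt, ?_⟩
  have : deriv (fun t : ℝ => (max t 0) ^ 2) = fun t => 2 * max t 0 :=
    funext fun t => (hasDerivAt_max_zero_sq t).deriv
  rw [this]; fun_prop

/-- The cutoff function of a section. -/
def cutoff {n : ℕ} (Ω : Set (E n)) (u : E n → ℝ) (y : E n) (R : ℝ) (x : E n) : ℝ :=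
  open scoped Classical in if x ∈ Ω then (max (R - breg u y x) 0) ^ 2 else 0

namespace ConvexSetup

variable {n : ℕ} {Ω : Set (E n)} {u : E n → ℝ}

lemma cutoff_contDiffOn (S : ConvexSetup Ω u) (y : E n) (R : ℝ) :
    ContDiffOn ℝ 1 (cutoff Ω u y R) Ω := by
  have h1 : ContDiffOn ℝ 1 (fun x => (max (R - breg u y x) 0) ^ 2) Ω :=
    contDiff_max_zero_sq.comp_contDiffOn (contDiffOn_const.sub fun x hx =>
      ((S.contDiffAt_breg y hx).of_le (by norm_num)).contDiffWithinAt)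
  exact h1.congr fun x hx => by simp [cutoff, hx]

lemma cutoff_of_notMem {y : E n} {R : ℝ} {x : E n}
    (hx : x ∉ MASection Ω u y R) : cutoff Ω u y R x = 0 := by
  unfold cutoff
  split_ifs with h
  · have : R ≤ breg u y x := by
      by_contra! hcon
      exact hx (mem_section_iff.mpr ⟨subset_closure h, hcon⟩)
    rw [max_eq_right (by linarith)]; norm_num
  · rfl

lemma gradient_cutoff (S : ConvexSetup Ω u) (y : E n) (R : ℝ) {x : E n} (hx : x ∈ Ω) :
    gradient (cutoff Ω u y R) x = -(2 * max (R - breg u y x) 0) • gradient (breg u y) x := by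
  have h1 : HasFDerivAt (fun x => (max (R - breg u y x) 0) ^ 2)
      ((2 * max (R - breg u y x) 0) • -(fderiv ℝ (breg u y) x)) x := by
    have h2 := (S.fderiv_breg y hx).differentiableAt.hasFDerivAt.const_sub R
    exact (hasDerivAt_max_zero_sq (R - breg u y x)).comp_hasFDerivAt x h2
  have h3 : cutoff Ω u y R =ᶠ[𝓝 x] fun x => (max (R - breg u y x) 0) ^ 2 := by
    filter_upwards [S.isOpen.mem_nhds hx] with z hz
    simp [cutoff, hz]
  unfold gradient
  rw [h3.fderiv_eq, h1.fderiv, map_smul, map_neg, smul_neg, neg_smul]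

end ConvexSetup

/-- Density of the Dirichlet form of the linearized Monge-Ampère operator. -/
def energy {n : ℕ} (u w : E n → ℝ) (x : E n) : ℝ :=
  qf (cofU u x) (gradient w x) (gradient w x)

namespace ConvexSetup

variable {n : ℕ} {Ω : Set (E n)} {u : E n → ℝ}

lemma cofU_posSemidef (S : ConvexSetup Ω u) {x : E n} (hx : x ∈ Ω) : (cofU u x).PosSemidef :=
  adjugate_posSemidef (S.hess_posSemidef hx)

lemma energy_nonneg (S : ConvexSetup Ω u) (w : E n → ℝ) {x : E n} (hx : x ∈ Ω) :
    0 ≤ energy u w x := qf_nonneg (S.cofU_posSemidef hx) _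

lemma continuousOn_energy (S : ConvexSetup Ω u) {V : Set (E n)} (hV : IsOpen V) (hVΩ : V ⊆ Ω)
    {w : E n → ℝ} (hw : ContDiffOn ℝ 1 w V) : ContinuousOn (energy u w) V := by
  have h : energy u w = fun x => ∑ i, ∑ j, cofU u x i j * pd w x i * pd w x j :=
    funext fun x => qf_gradient _ _ _ _
  have hpd : ∀ i, ContinuousOn (fun x => pd w x i) V := fun i =>
    (hw.continuousOn_fderiv_of_isOpen hV (by norm_num)).clm_apply continuousOn_const
  rw [h]
  refine continuousOn_finsetSum _ fun i _ => continuousOn_finsetSum _ fun j _ => ?_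
  exact (((contDiffOn_cofU S.isOpen S.smooth i j).continuousOn.mono hVΩ).mul (hpd i)).mul (hpd j)

lemma closure_section_subset (S : ConvexSetup Ω u) {y : E n} {s r : ℝ}
    (h : CptIn (MASection Ω u y s) Ω) (hr : s < r) :
    closure (MASection Ω u y s) ⊆ MASection Ω u y r := fun _ hw =>
  mem_section_iff.mpr ⟨closure_mono h.subset hw, (S.breg_le_of_mem_closure h hw).trans_lt hr⟩

lemma contDiffOn_breg (S : ConvexSetup Ω u) (y : E n) : ContDiffOn ℝ 3 (breg u y) Ω :=
  fun _ hz => (S.contDiffAt_breg y hz).contDiffWithinAt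

lemma linearized_breg (S : ConvexSetup Ω u) (y : E n) {x : E n} (hx : x ∈ Ω) :
    ∑ i, ∑ j, cofU u x i j * pd2 (breg u y) x i j = n * (Hess u x).det := by
  have h1 : ∀ i j, pd2 (breg u y) x i j = Hess u x j i := fun i j => by
    rw [← S.hess_breg y hx]
    have := (S.hess_posSemidef hx)
    rw [← S.hess_breg y hx] at this
    exact (isSymm_of_posSemidef this).apply j i
  have h2 : ∑ i, ∑ j, cofU u x i j * pd2 (breg u y) x i j = (cofU u x * Hess u x).trace := by
    simp only [Matrix.trace, Matrix.diag, Matrix.mul_apply, h1]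
  rw [h2, cofU, Matrix.adjugate_mul, Matrix.trace_smul, Matrix.trace_one, smul_eq_mul, mul_comm,
    Fintype.card_fin]

lemma integral_energy_breg_le (S : ConvexSetup Ω u) {y : E n} (hy : y ∈ Ω) {R : ℝ} (hR : 0 < R)
    (hcpt : CptIn (MASection Ω u y (2 * R)) Ω) :
    ∫ x in MASection Ω u y R, energy u (breg u y) x ≤
      2 * n * R * maMeasure u (MASection Ω u y (2 * R)) := by
  have hcR : CptIn (MASection Ω u y R) Ω := hcpt.mono (section_mono (by linarith))
  obtain ⟨h1, h2, h3⟩ := integral_mul_linearized S.isOpen S.smooth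
    ((S.contDiffOn_breg y).of_le (by norm_num)) (S.cutoff_contDiffOn y (2 * R)) hcpt.1 hcpt.2
    (fun x hx => cutoff_of_notMem fun h => hx (subset_closure h))
  have hm := (S.isOpen_section hcpt).measurableSet
  have hmR := (S.isOpen_section hcR).measurableSet
  have hEint : IntegrableOn (energy u (breg u y)) (MASection Ω u y R) :=
    (((S.continuousOn_energy S.isOpen subset_rfl ((S.contDiffOn_breg y).of_le (by norm_num))).mono
      hcR.2).integrableOn_compact hcR.1).mono_set subset_closure
  have hA : 2 * R * ∫ x in MASection Ω u y R, energy u (breg u y) x ≤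
      - ∫ x, qf (cofU u x) (gradient (cutoff Ω u y (2 * R)) x) (gradient (breg u y) x) := by
    rw [← integral_indicator hmR, ← integral_const_mul, ← integral_neg]
    refine integral_mono ((hEint.integrable_indicator hmR).const_mul _) h2.neg fun x => ?_
    simp only
    by_cases hx : x ∈ Ω
    · rw [S.gradient_cutoff y _ hx, qf_smul_left]
      have he := S.energy_nonneg (breg u y) hx
      unfold energy at he
      by_cases hxS : x ∈ MASection Ω u y R
      · rw [Set.indicator_of_mem hxS]
        unfold energy
        have := (mem_section_iff.mp hxS).2
        rw [max_eq_left (by linarith)]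
        nlinarith
      · rw [Set.indicator_of_notMem hxS]
        have : 0 ≤ max (2 * R - breg u y x) 0 := le_max_right _ _
        nlinarith [mul_nonneg this he]
    · have hxK : x ∉ closure (MASection Ω u y (2 * R)) := fun h => hx (hcpt.2 h)
      rw [gradient_eq_zero_of_compact isClosed_closure
        (fun x hx => cutoff_of_notMem fun h => hx (subset_closure h)) hxK,
        Set.indicator_of_notMem fun h => hx (hcR.subset h)]
      simp [qf]
  have hB : ∫ x, cutoff Ω u y (2 * R) x * ∑ i, ∑ j, cofU u x i j * pd2 (breg u y) x i j ≤
      4 * R ^ 2 * n * maMeasure u (MASection Ω u y (2 * R)) := by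
    unfold maMeasure
    rw [← integral_indicator hm, ← integral_const_mul]
    refine integral_mono h1 (((S.integrableOn_det hcpt).integrable_indicator hm).const_mul _)
      fun x => ?_
    simp only
    by_cases hxS : x ∈ MASection Ω u y (2 * R)
    · have hx := hcpt.subset hxS
      rw [Set.indicator_of_mem hxS, S.linearized_breg y hx, cutoff, if_pos hx, ← mul_assoc]
      refine mul_le_mul_of_nonneg_right ?_ (S.det_nonneg hx)
      refine mul_le_mul_of_nonneg_right ?_ (Nat.cast_nonneg n)
      have h0 := S.breg_nonneg hy (subset_closure hx)
      have := (mem_section_iff.mp hxS).2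
      rw [max_eq_left (by linarith)]
      nlinarith
    · rw [Set.indicator_of_notMem hxS, cutoff_of_notMem hxS]; simp
  have h4 : 2 * R * ∫ x in MASection Ω u y R, energy u (breg u y) x ≤
      2 * R * (2 * n * R * maMeasure u (MASection Ω u y (2 * R))) := by
    rw [h3] at hB
    calc _ ≤ _ := hA
      _ ≤ _ := hB
      _ = _ := by ring
  exact le_of_mul_le_mul_left h4 (by positivity)

lemma gradient_log {v : E n → ℝ} {x : E n} (hv : DifferentiableAt ℝ v x) (h0 : v x ≠ 0) :
    gradient (fun x => Real.log (v x)) x = (v x)⁻¹ • gradient v x := by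
  unfold gradient
  rw [(hv.hasFDerivAt.log h0).fderiv, map_smul]

/-- Caccioppoli inequality for the logarithm of a positive solution. -/
theorem integral_energy_log_le (S : ConvexSetup Ω u) {y : E n} (hy : y ∈ Ω) {R : ℝ} (hR : 0 < R)
    (hcpt : CptIn (MASection Ω u y (2 * R)) Ω) {v : E n → ℝ}
    (hv : IsSol u v (MASection Ω u y (2 * R))) (hpos : ∀ x ∈ MASection Ω u y (2 * R), 0 < v x) :
    ∫ x in MASection Ω u y (R / 2), energy u (fun x => Real.log (v x)) x ≤
      32 * n * maMeasure u (MASection Ω u y (2 * R)) / R := by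
  have hcR : CptIn (MASection Ω u y R) Ω := hcpt.mono (section_mono (by linarith))
  have hcH : CptIn (MASection Ω u y (R / 2)) Ω := hcpt.mono (section_mono (by linarith))
  have hVo := S.isOpen_section hcpt
  have hmR := (S.isOpen_section hcR).measurableSet
  have hmH := (S.isOpen_section hcH).measurableSet
  have hKV : closure (MASection Ω u y R) ⊆ MASection Ω u y (2 * R) :=
    S.closure_section_subset hcR (by linarith)
  have hψ0 : ∀ x ∉ closure (MASection Ω u y R), cutoff Ω u y R x * (v x)⁻¹ = 0 := fun x hx => by
    rw [cutoff_of_notMem fun h => hx (subset_closure h), zero_mul]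
  have hv1 : ContDiffOn ℝ 1 v (MASection Ω u y (2 * R)) := hv.smooth.of_le (by norm_num)
  have hlog : ContDiffOn ℝ 1 (fun x => Real.log (v x)) (MASection Ω u y (2 * R)) :=
    hv1.log fun x hx => (hpos x hx).ne'
  obtain ⟨h1, h2, h3⟩ := integral_mul_linearized hVo (S.smooth.mono hcpt.subset) hv.smooth
    (ψ := fun x => cutoff Ω u y R x * (v x)⁻¹)
    (((S.cutoff_contDiffOn y R).mono hcpt.subset).mul (hv1.inv fun x hx => (hpos x hx).ne'))
    hcR.1 hKV hψ0
  have hzero : ∫ x, cutoff Ω u y R x * (v x)⁻¹ * ∑ i, ∑ j, cofU u x i j * pd2 v x i j = 0 := by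
    refine integral_eq_zero_of_ae (Filter.Eventually.of_forall fun x => ?_)
    simp only [Pi.zero_apply]
    by_cases hx : x ∈ MASection Ω u y (2 * R)
    · rw [hv.eqn x hx, mul_zero]
    · rw [cutoff_of_notMem fun h => hx (section_mono (by linarith) h)]; simp
  rw [hzero] at h3
  have hEφ : IntegrableOn (energy u (breg u y)) (MASection Ω u y R) :=
    (((S.continuousOn_energy S.isOpen subset_rfl ((S.contDiffOn_breg y).of_le (by norm_num))).mono
      hcR.2).integrableOn_compact hcR.1).mono_set subset_closure
  have hEw : IntegrableOn (energy u fun x => Real.log (v x)) (MASection Ω u y (R / 2)) :=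
    ((((S.continuousOn_energy hVo hcpt.subset hlog)).mono
      hKV).integrableOn_compact hcR.1).mono_set
        ((section_mono (by linarith)).trans subset_closure)
  have key : (R ^ 2 / 8) * (∫ x in MASection Ω u y (R / 2), energy u (fun x => Real.log (v x)) x) -
      2 * (∫ x in MASection Ω u y R, energy u (breg u y) x) ≤
      ∫ x, qf (cofU u x) (gradient (fun x => cutoff Ω u y R x * (v x)⁻¹) x) (gradient v x) * (-1) := by
    rw [← integral_indicator hmR, ← integral_indicator hmH, ← integral_const_mul,
      ← integral_const_mul, ← integral_sub ((hEw.integrable_indicator hmH).const_mul _)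
        ((hEφ.integrable_indicator hmR).const_mul _)]
    refine integral_mono (((hEw.integrable_indicator hmH).const_mul _).sub
        ((hEφ.integrable_indicator hmR).const_mul _)) (h2.mul_const _) fun x => ?_
    simp only
    by_cases hxK : x ∈ closure (MASection Ω u y R)
    · have hxV := hKV hxK
      have hx := hcpt.subset hxV
      have hvx := hpos x hxV
      have hvd : DifferentiableAt ℝ v x := (hv1.contDiffAt (hVo.mem_nhds hxV)).differentiableAt
        (by norm_num)
      have hcd : DifferentiableAt ℝ (cutoff Ω u y R) x :=
        ((S.cutoff_contDiffOn y R).contDiffAt (S.isOpen.mem_nhds hx)).differentiableAt (by norm_num)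
      have hg : gradient (fun x => cutoff Ω u y R x * (v x)⁻¹) x =
          (v x)⁻¹ • gradient (cutoff Ω u y R) x +
            (-(cutoff Ω u y R x * ((v x) ^ 2)⁻¹)) • gradient v x := by
        have hi : HasFDerivAt (fun x => (v x)⁻¹) ((-((v x) ^ 2)⁻¹) • fderiv ℝ v x) x :=
          (hasDerivAt_inv hvx.ne').comp_hasFDerivAt x hvd.hasFDerivAt
        have hmul := hcd.hasFDerivAt.mul hi
        unfold gradient
        rw [show fderiv ℝ (fun x => cutoff Ω u y R x * (v x)⁻¹) x = _ from hmul.fderiv, map_add,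
          map_smul, map_smul, map_smul, smul_smul, add_comm]
        congr 2
        ring
      have hlg := gradient_log hvd hvx.ne'
      have hsm : gradient v x = v x • gradient (fun x => Real.log (v x)) x := by
        rw [hlg, smul_smul, mul_inv_cancel₀ hvx.ne', one_smul]
      have hE := S.energy_nonneg (fun x => Real.log (v x)) hx
      have hF := S.energy_nonneg (breg u y) hx
      set m := max (R - breg u y x) 0 with hm
      have hm0 : 0 ≤ m := le_max_right _ _
      have hcut : cutoff Ω u y R x = m ^ 2 := by rw [cutoff, if_pos hx]
      set a := gradient (fun x => Real.log (v x)) x with ha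
      set b := gradient (breg u y) x with hb
      have hval : qf (cofU u x) (gradient (fun x => cutoff Ω u y R x * (v x)⁻¹) x) (gradient v x) =
          -(2 * m) * qf (cofU u x) b a - m ^ 2 * qf (cofU u x) a a := by
        rw [hg, S.gradient_cutoff y R hx, hsm, hcut]
        simp only [qf_add_left, qf_smul_left, qf_smul_right]
        field_simp
        ring
      rw [hval]
      have hamgm := two_mul_qf_le (S.cofU_posSemidef hx) ((2 : ℝ) • b) ((-m) • a)
      simp only [qf_smul_left, qf_smul_right] at hamgm
      unfold energy at hE hF ⊢
      by_cases hxR : x ∈ MASection Ω u y R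
      · rw [Set.indicator_of_mem hxR]
        by_cases hxH : x ∈ MASection Ω u y (R / 2)
        · rw [Set.indicator_of_mem hxH]
          have h5 := (mem_section_iff.mp hxH).2
          have h6 : R / 2 ≤ m := (by linarith : R / 2 ≤ R - breg u y x).trans (le_max_left _ _)
          have h7 : R ^ 2 / 4 ≤ m ^ 2 := by nlinarith
          nlinarith [mul_le_mul_of_nonneg_right h7 hE]
        · rw [Set.indicator_of_notMem hxH]
          nlinarith [mul_nonneg (sq_nonneg m) hE]
      · have h5 : R ≤ breg u y x := by
          by_contra! hcon
          exact hxR (mem_section_iff.mpr ⟨subset_closure hx, hcon⟩)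
        have hmz : m = 0 := max_eq_right (by linarith)
        rw [Set.indicator_of_notMem hxR,
          Set.indicator_of_notMem fun h => hxR (section_mono (by linarith) h), hmz]
        simp
    · rw [gradient_eq_zero_of_compact isClosed_closure hψ0 hxK,
        Set.indicator_of_notMem fun h => hxK (subset_closure h),
        Set.indicator_of_notMem fun h => hxK (subset_closure (section_mono (by linarith) h))]
      simp [qf]
  rw [integral_mul_const] at key
  have hb := S.integral_energy_breg_le hy hR hcpt
  rw [le_div_iff₀ hR]
  refine le_of_mul_le_mul_left ?_ hR
  nlinarith

end ConvexSetup

lemma lintegral_comp_add_smul {n : ℕ} {a : E n → ENNReal} (ha : Measurable a) (p : E n) {r : ℝ}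
    (hr : r ≠ 0) : ∫⁻ q, a (p + r • q) = ENNReal.ofReal |(r ^ n)⁻¹| * ∫⁻ q, a q := by
  have h1 : ∫⁻ q, a (p + r • q) = ∫⁻ q, a (p + q) ∂(Measure.map (r • ·) volume) := by
    rw [lintegral_map (by fun_prop) (by fun_prop)]
  rw [h1, Measure.map_addHaar_smul volume hr, lintegral_smul_measure,
    lintegral_add_left_eq_self a p]
  simp

lemma lintegral_segment_le {n : ℕ} {a : E n → ENNReal} (ha : Measurable a) (p : E n) {r : ℝ}
    (hr : 1 / 2 ≤ r) (Q : Set (E n)) :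
    ∫⁻ q in Q, a (p + r • (q - p)) ≤ 2 ^ n * ∫⁻ q, a q := by
  have h0 : 0 < r := by linarith
  calc ∫⁻ q in Q, a (p + r • (q - p)) ≤ ∫⁻ q, a (p + r • (q - p)) := setLIntegral_le_lintegral _ _
    _ = ∫⁻ q, a ((p - r • p) + r • q) := by
        refine lintegral_congr fun q => congrArg a ?_
        rw [smul_sub]; abel
    _ = ENNReal.ofReal |(r ^ n)⁻¹| * ∫⁻ q, a q := lintegral_comp_add_smul ha _ h0.ne'
    _ ≤ 2 ^ n * ∫⁻ q, a q := by
        refine mul_le_mul_left ?_ _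
        rw [abs_of_nonneg (by positivity), ← inv_pow, ENNReal.ofReal_pow (by positivity)]
        refine pow_le_pow_left' ?_ n
        rw [← ENNReal.ofReal_ofNat]
        refine ENNReal.ofReal_le_ofReal ?_
        rw [inv_le_comm₀ h0 (by norm_num)]
        linarith

/-- Averaging a function along segments joining two sets. -/
lemma mul_measure_le_of_segments {n : ℕ} {P Q R : Set (E n)} (hP : MeasurableSet P)
    (hQ : MeasurableSet Q) (hPR : P ⊆ R) (hQR : Q ⊆ R) {a : E n → ENNReal}
    (ha : Measurable a) {c : ENNReal}
    (h : ∀ p ∈ P, ∀ q ∈ Q, c ≤ ∫⁻ r in Set.Icc (0 : ℝ) 1, a (p + r • (q - p))) :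
    c * volume P * volume Q ≤ 2 ^ n * volume R * ∫⁻ q, a q := by
  set ν := ((volume : Measure (E n)).restrict P).prod ((volume : Measure (E n)).restrict Q) with hν
  have hmeas : Measurable fun z : (E n × E n) × ℝ => a (z.1.1 + z.2 • (z.1.2 - z.1.1)) :=
    ha.comp (by fun_prop)
  have h1 : c * volume P * volume Q ≤
      ∫⁻ z, (∫⁻ r in Set.Icc (0 : ℝ) 1, a (z.1 + r • (z.2 - z.1))) ∂ν := by
    have : ∫⁻ _, c ∂ν = c * volume P * volume Q := by
      rw [lintegral_const, hν, ← Set.univ_prod_univ, Measure.prod_prod, Measure.restrict_apply_univ,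
        Measure.restrict_apply_univ, mul_assoc]
    rw [← this]
    refine lintegral_mono_ae ?_
    rw [hν, Measure.prod_restrict]
    filter_upwards [ae_restrict_mem (hP.prod hQ)] with z hz using h z.1 hz.1 z.2 hz.2
  have h2 : ∫⁻ z, (∫⁻ r in Set.Icc (0 : ℝ) 1, a (z.1 + r • (z.2 - z.1))) ∂ν =
      ∫⁻ r in Set.Icc (0 : ℝ) 1, ∫⁻ z, a (z.1 + r • (z.2 - z.1)) ∂ν :=
    lintegral_lintegral_swap hmeas.aemeasurable
  have h3 : ∀ r : ℝ, ∫⁻ z, a (z.1 + r • (z.2 - z.1)) ∂ν ≤ 2 ^ n * volume R * ∫⁻ q, a q := by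
    intro r
    have hm : Measurable fun z : E n × E n => a (z.1 + r • (z.2 - z.1)) := ha.comp (by fun_prop)
    rcases le_total (1 / 2) r with hr | hr
    · rw [lintegral_prod _ hm.aemeasurable]
      calc ∫⁻ p in P, ∫⁻ q in Q, a (p + r • (q - p)) ≤ ∫⁻ _ in P, 2 ^ n * ∫⁻ q, a q :=
            lintegral_mono fun p => lintegral_segment_le ha p hr Q
        _ = (2 ^ n * ∫⁻ q, a q) * volume P := by
            rw [lintegral_const, Measure.restrict_apply_univ]
        _ ≤ (2 ^ n * ∫⁻ q, a q) * volume R := by gcongr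
        _ = _ := by ring
    · rw [lintegral_prod_symm _ hm.aemeasurable]
      calc ∫⁻ q in Q, ∫⁻ p in P, a (p + r • (q - p)) ≤ ∫⁻ _ in Q, 2 ^ n * ∫⁻ q, a q := by
            refine lintegral_mono fun q => ?_
            have h4 := lintegral_segment_le ha q (r := 1 - r) (by linarith) P
            refine le_trans (le_of_eq (lintegral_congr fun p => congrArg a ?_)) h4
            module
        _ = (2 ^ n * ∫⁻ q, a q) * volume Q := by
            rw [lintegral_const, Measure.restrict_apply_univ]
        _ ≤ (2 ^ n * ∫⁻ q, a q) * volume R := by gcongr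
        _ = _ := by ring
  calc _ ≤ _ := h1
    _ = _ := h2
    _ ≤ ∫⁻ _ in Set.Icc (0 : ℝ) 1, 2 ^ n * volume R * ∫⁻ q, a q := lintegral_mono fun r => h3 r
    _ = _ := by rw [lintegral_const, Measure.restrict_apply_univ, Real.volume_Icc]; simp

lemma hasStrictFDerivAt_gradient {n : ℕ} {f : E n → ℝ} {x : E n} (hf : ContDiffAt ℝ 2 f x) :
    HasStrictFDerivAt (gradient f) (hessCLM f x) x := by
  have h1 : ContDiffAt ℝ 1 (gradient f) x :=
    (((InnerProductSpace.toDual ℝ (E n)).symm.toContinuousLinearEquiv.toContinuousLinearMap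
    |>.restrictScalars ℝ).contDiff).contDiffAt.comp x (hf.fderiv_right (m := 1) (by norm_num))
  exact h1.hasStrictFDerivAt' (hasFDerivAt_gradient hf) (by norm_num)

namespace ConvexSetup

variable {n : ℕ} {Ω : Set (E n)} {u : E n → ℝ}

lemma hasStrictFDerivAt_gradient_inv (S : ConvexSetup Ω u) {V : Set (E n)} (hV : IsOpen V)
    (hVΩ : V ⊆ Ω) (hdet : ∀ x ∈ V, 0 < (Hess u x).det) {G : E n → E n}
    (hG : ∀ x ∈ V, G (gradient u x) = x) {x : E n} (hx : x ∈ V) :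
    ∃ A : E n →L[ℝ] E n, HasStrictFDerivAt G A (gradient u x) ∧ ∀ e, hessCLM u x (A e) = e := by
  have hd : (hessCLM u x).det ≠ 0 := by rw [det_hessCLM]; exact (hdet x hx).ne'
  have h1 := hasStrictFDerivAt_gradient (S.contDiffAt_two (hVΩ hx))
  rw [← ContinuousLinearMap.coe_toContinuousLinearEquivOfDetNeZero _ hd] at h1
  refine ⟨_, h1.to_local_left_inverse (g := G) ?_, fun e => ?_⟩
  · filter_upwards [hV.mem_nhds hx] with y hy using hG y hy
  · exact ((hessCLM u x).toContinuousLinearEquivOfDetNeZero hd).apply_symm_apply e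

lemma two_mul_inner_le (S : ConvexSetup Ω u) {x : E n} (hx : x ∈ Ω)
    (hdet : 0 < (Hess u x).det) (a b : E n) :
    2 * inner ℝ a b ≤ qf (cofU u x) a a / (Hess u x).det + inner ℝ (hessCLM u x b) b := by
  have h1 := two_mul_qf_le (S.cofU_posSemidef hx) a (hessCLM u x b)
  have h2 : ∀ c, qf (cofU u x) c (hessCLM u x b) = (Hess u x).det * inner ℝ c b :=
    fun c => qf_adjugate_mulVec _ _ _
  rw [h2, h2] at h1
  rw [← sub_nonneg]
  have h3 : qf (cofU u x) a a / (Hess u x).det + inner ℝ (hessCLM u x b) b - 2 * inner ℝ a b =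
      (qf (cofU u x) a a + (Hess u x).det * inner ℝ (hessCLM u x b) b -
        2 * ((Hess u x).det * inner ℝ a b)) / (Hess u x).det := by
    field_simp
  rw [h3]
  exact div_nonneg (by linarith) hdet.le

/-- Poincaré-type inequality in gradient coordinates for a nondegenerate potential. -/
theorem poincare_nondegenerate (S : ConvexSetup Ω u) {V : Set (E n)} (hV : IsOpen V)
    (hVΩ : V ⊆ Ω) (hdet : ∀ x ∈ V, 0 < (Hess u x).det) {w : E n → ℝ} (hw : ContDiffOn ℝ 1 w V)
    {P Q K : Set (E n)} (hPm : MeasurableSet P) (hQm : MeasurableSet Q) (hPK : P ⊆ K)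
    (hQK : Q ⊆ K) (hKV : K ⊆ V) {L B : ℝ} (hL : 0 < L) (hB : 0 < B)
    (hseg : ∀ ξ ∈ P, ∀ ζ ∈ Q, ∀ r ∈ Set.Icc (0 : ℝ) 1, ∃ x ∈ V,
      gradient u x = gradient u ξ + r • (gradient u ζ - gradient u ξ))
    (hinner : ∀ ξ ∈ P, ∀ ζ ∈ Q, inner ℝ (gradient u ζ - gradient u ξ) (ζ - ξ) ≤ B)
    (hosc : ∀ ξ ∈ P, ∀ ζ ∈ Q, L ≤ w ζ - w ξ) :
    ENNReal.ofReal (L ^ 2) * volume (gradient u '' P) * volume (gradient u '' Q) ≤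
      ENNReal.ofReal B * (2 ^ n * volume (gradient u '' K) *
        ∫⁻ x in V, ENNReal.ofReal (energy u w x)) := by
  have hinj : Set.InjOn (gradient u) V := fun x hx y hy h =>
    S.eq_of_gradient_eq (hVΩ hx) (hVΩ hy) (hdet x hx) h
  have hgd : ∀ x ∈ V, HasFDerivAt (gradient u) (hessCLM u x) x := fun x hx =>
    hasFDerivAt_gradient (S.contDiffAt_two (hVΩ hx))
  set G := Function.invFunOn (gradient u) V with hGdef
  have hG : ∀ x ∈ V, G (gradient u x) = x := hinj.leftInvOn_invFunOn
  set O := gradient u '' V with hO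
  have hgm : ∀ {T : Set (E n)}, MeasurableSet T → T ⊆ V → MeasurableSet (gradient u '' T) :=
    fun hT hTV => measurable_image_of_fderivWithin hT
      (fun x hx => (hgd x (hTV hx)).hasFDerivWithinAt) (hinj.mono hTV)
  have hGc : ContinuousOn G O := by
    rintro _ ⟨x, hx, rfl⟩
    obtain ⟨A, hA, -⟩ := S.hasStrictFDerivAt_gradient_inv hV hVΩ hdet hG hx
    exact hA.hasFDerivAt.continuousAt.continuousWithinAt
  have hGV : Set.MapsTo G O V := by rintro _ ⟨x, hx, rfl⟩; rwa [hG x hx]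
  set A : E n → ℝ := fun x => energy u w x / (Hess u x).det with hA
  have hAc : ContinuousOn A V := (S.continuousOn_energy hV hVΩ hw).div
    (S.continuousOn_det.mono hVΩ) fun x hx => (hdet x hx).ne'
  have hA0 : ∀ x ∈ V, 0 ≤ A x := fun x hx =>
    div_nonneg (S.energy_nonneg w (hVΩ hx)) (hdet x hx).le
  set a : E n → ENNReal := O.indicator fun q => ENNReal.ofReal (A (G q)) with ha
  have ham : Measurable a := by
    have hOm : MeasurableSet O := hgm hV.measurableSet subset_rfl
    have h1 : ContinuousOn (fun q => ENNReal.ofReal (A (G q))) O :=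
      ENNReal.continuous_ofReal.comp_continuousOn (hAc.comp hGc hGV)
    classical
    have := h1.measurable_piecewise (g := fun _ => (0 : ENNReal)) continuousOn_const hOm
    convert this using 1
    rw [ha, ← Set.piecewise_eq_indicator]
    rfl
  have hatot : ∫⁻ q, a q = ∫⁻ x in V, ENNReal.ofReal (energy u w x) := by
    rw [ha, lintegral_indicator (hgm hV.measurableSet subset_rfl),
      lintegral_image_eq_lintegral_abs_det_fderiv_mul volume hV.measurableSet
        (fun x hx => (hgd x hx).hasFDerivWithinAt) hinj]
    refine setLIntegral_congr_fun hV.measurableSet fun x hx => ?_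
    rw [hG x hx, det_hessCLM, abs_of_pos (hdet x hx), ← ENNReal.ofReal_mul (hdet x hx).le, hA,
      mul_div_cancel₀ _ (hdet x hx).ne']
  have hline : ∀ p ∈ gradient u '' P, ∀ q ∈ gradient u '' Q, ENNReal.ofReal (L ^ 2 / B) ≤
      ∫⁻ r in Set.Icc (0 : ℝ) 1, a (p + r • (q - p)) := by
    rintro _ ⟨ξ, hξ, rfl⟩ _ ⟨ζ, hζ, rfl⟩
    set p := gradient u ξ
    set e := gradient u ζ - p with he
    have hξV := hKV (hPK hξ)
    have hζV := hKV (hQK hζ)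
    set γ : ℝ → E n := fun r => G (p + r • e) with hγ
    have hmem : ∀ r ∈ Set.Icc (0 : ℝ) 1, p + r • e ∈ O := fun r hr => by
      obtain ⟨x, hx, hxe⟩ := hseg ξ hξ ζ hζ r hr
      exact ⟨x, hx, hxe⟩
    have hγd : ∀ r ∈ Set.Icc (0 : ℝ) 1, ∃ b, HasDerivAt γ b r ∧ hessCLM u (γ r) b = e := by
      intro r hr
      obtain ⟨x, hx, hxe⟩ := hseg ξ hξ ζ hζ r hr
      obtain ⟨A', hA', hAe⟩ := S.hasStrictFDerivAt_gradient_inv hV hVΩ hdet hG hx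
      have h1 : HasDerivAt (fun r : ℝ => p + r • e) e r := by
        simpa using ((hasDerivAt_id r).smul_const e).const_add p
      rw [hxe] at hA'
      have hγx : γ r = x := by rw [hγ]; simp only; rw [← hxe, hG x hx]
      have h2 : HasDerivAt (G ∘ fun r : ℝ => p + r • e) (A' e) r :=
        hA'.hasFDerivAt.comp_hasDerivAt r h1
      refine ⟨A' e, h2, ?_⟩
      rw [hγx, hAe]
    have hγV : ∀ r ∈ Set.Icc (0 : ℝ) 1, γ r ∈ V := fun r hr => hGV (hmem r hr)
    have hγc : ContinuousOn γ (Set.Icc 0 1) := fun r hr => by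
      obtain ⟨b, hb, -⟩ := hγd r hr
      exact hb.continuousAt.continuousWithinAt
    choose! b hb hbe using hγd
    set c := B / L with hc
    have hc0 : 0 < c := div_pos hB hL
    have hφc : ContinuousOn (fun r => c / 2 * A (γ r)) (Set.Icc 0 1) :=
      continuousOn_const.mul (hAc.comp hγc hγV)
    have hftc := intervalIntegral.sub_le_integral_of_hasDeriv_right_of_le
      (g := fun r => w (γ r) - 1 / (2 * c) * inner ℝ e (γ r))
      (g' := fun r => inner ℝ (gradient w (γ r)) (b r) - 1 / (2 * c) * inner ℝ e (b r))
      (φ := fun r => c / 2 * A (γ r)) zero_le_one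
      ((hw.continuousOn.comp hγc hγV).sub (continuousOn_const.mul
        (continuousOn_const.inner hγc)))
      (fun r hr => by
        have hr' := Set.Ioo_subset_Icc_self hr
        have hwd : HasFDerivAt w (fderiv ℝ w (γ r)) (γ r) :=
          ((hw.contDiffAt (hV.mem_nhds (hγV r hr'))).differentiableAt (by norm_num)).hasFDerivAt
        have h1 := hwd.comp_hasDerivAt r (hb r hr')
        have h2 : HasDerivAt (fun r => inner ℝ e (γ r)) (inner ℝ e (b r)) r :=
          ((innerSL ℝ e).hasFDerivAt).comp_hasDerivAt r (hb r hr')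
        have h3 := h1.sub (h2.const_mul (1 / (2 * c)))
        rw [← inner_gradient] at h3
        exact h3.hasDerivWithinAt)
      hφc.integrableOn_Icc
      (fun r hr => by
        have hr' := Set.Ioo_subset_Icc_self hr
        have h1 := S.two_mul_inner_le (hVΩ (hγV r hr')) (hdet _ (hγV r hr'))
          (c • gradient w (γ r)) (b r)
        rw [hbe r hr', qf_smul_left, qf_smul_right, real_inner_smul_left] at h1
        have h2 : A (γ r) = qf (cofU u (γ r)) (gradient w (γ r)) (gradient w (γ r)) /
          (Hess u (γ r)).det := rfl
        rw [mul_div_assoc, mul_div_assoc, ← h2] at h1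
        have h3 : inner ℝ (gradient w (γ r)) (b r) - 1 / (2 * c) * inner ℝ e (b r) =
            (2 * (c * inner ℝ (gradient w (γ r)) (b r)) - inner ℝ e (b r)) / (2 * c) := by
          field_simp
        rw [h3, div_le_iff₀ (by positivity)]
        nlinarith)
    have hγ0 : γ 0 = ξ := by simp only [hγ, zero_smul, add_zero]; exact hG ξ hξV
    have hγ1 : γ 1 = ζ := by
      simp only [hγ, one_smul, he, add_sub_cancel]; exact hG ζ hζV
    simp only [hγ0, hγ1] at hftc
    have h4 := hosc ξ hξ ζ hζ
    have h5 := hinner ξ hξ ζ hζ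
    rw [inner_sub_right] at h5
    rw [intervalIntegral.integral_const_mul, intervalIntegral.integral_of_le zero_le_one,
      ← integral_Icc_eq_integral_Ioc] at hftc
    set I := ∫ r in Set.Icc (0 : ℝ) 1, A (γ r) with hI
    have hIle : L ^ 2 / B ≤ I := by
      have h6 : L - 1 / (2 * c) * B ≤ c / 2 * I := by
        have : 1 / (2 * c) * (inner ℝ e ζ - inner ℝ e ξ) ≤ 1 / (2 * c) * B :=
          mul_le_mul_of_nonneg_left h5 (by positivity)
        linarith
      rw [hc] at h6
      have h7 : L - 1 / (2 * (B / L)) * B = L / 2 := by field_simp; ring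
      rw [h7] at h6
      rw [div_le_iff₀ hB]
      have h8 : B / L / 2 * I * L = B * I / 2 := by field_simp
      nlinarith [mul_le_mul_of_nonneg_right h6 hL.le]
    calc ENNReal.ofReal (L ^ 2 / B) ≤ ENNReal.ofReal I := ENNReal.ofReal_le_ofReal hIle
      _ = ∫⁻ r in Set.Icc (0 : ℝ) 1, ENNReal.ofReal (A (γ r)) := by
          rw [hI, ofReal_integral_eq_lintegral_ofReal]
          · exact (hAc.comp hγc hγV).integrableOn_Icc
          · filter_upwards [ae_restrict_mem measurableSet_Icc] with r hr using hA0 _ (hγV r hr)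
      _ = _ := by
          refine setLIntegral_congr_fun measurableSet_Icc fun r hr => ?_
          simp only [ha]
          rw [Set.indicator_of_mem (hmem r hr)]
  have hfin := mul_measure_le_of_segments (hgm hPm (hPK.trans hKV)) (hgm hQm (hQK.trans hKV))
    (Set.image_mono hPK) (Set.image_mono hQK) ham hline
  rw [hatot] at hfin
  have hsplit : ENNReal.ofReal (L ^ 2) = ENNReal.ofReal B * ENNReal.ofReal (L ^ 2 / B) := by
    rw [← ENNReal.ofReal_mul hB.le, mul_div_cancel₀ _ hB.ne']
  rw [hsplit, mul_assoc, mul_assoc, ← mul_assoc (ENNReal.ofReal (L ^ 2 / B))]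
  gcongr

end ConvexSetup

lemma tendsto_setIntegral_param {n : ℕ} {f : ℝ → E n → ℝ} {K A : Set (E n)} (hK : IsCompact K)
    (hA : MeasurableSet A) (hAK : A ⊆ K)
    (hf : ContinuousOn (fun z : ℝ × E n => f z.1 z.2) (Set.Icc 0 1 ×ˢ K)) :
    Filter.Tendsto (fun l => ∫ x in A, f l x) (𝓝[>] 0) (𝓝 (∫ x in A, f 0 x)) := by
  obtain ⟨M, hM⟩ := (isCompact_Icc.prod hK).exists_bound_of_continuousOn hf
  have hsec : ∀ l ∈ Set.Icc (0 : ℝ) 1, ContinuousOn (f l) K := fun l hl =>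
    hf.comp (f := fun x => (l, x)) (by fun_prop) fun x hx => ⟨hl, hx⟩
  have hIoo : Set.Icc (0 : ℝ) 1 ∈ 𝓝[>] (0 : ℝ) :=
    Filter.mem_of_superset (Ioo_mem_nhdsGT one_pos) Set.Ioo_subset_Icc_self
  refine tendsto_integral_filter_of_dominated_convergence (fun _ => M) ?_ ?_ ?_ ?_
  · filter_upwards [hIoo] with l hl
    exact ((hsec l hl).mono hAK).aestronglyMeasurable hA
  · filter_upwards [hIoo] with l hl
    filter_upwards [ae_restrict_mem hA] with x hx using hM (l, x) ⟨hl, hAK hx⟩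
  · exact integrableOn_const (((measure_mono hAK).trans_lt hK.measure_lt_top).ne)
  · filter_upwards [ae_restrict_mem hA] with x hx
    have h1 : ContinuousWithinAt (fun l => f l x) (Set.Icc 0 1) 0 :=
      (hf.comp (f := fun l => (l, x)) (by fun_prop) fun l hl => ⟨hl, hAK hx⟩) 0 (by simp)
    exact h1.tendsto.mono_left (nhdsWithin_le_of_mem hIoo)

lemma fderiv_half_norm_sq {n : ℕ} (x : E n) :
    HasFDerivAt (fun x : E n => ‖x‖ ^ 2 / 2) (innerSL ℝ x) x := by
  have h := ((hasStrictFDerivAt_norm_sq x).hasFDerivAt).const_mul (1 / 2 : ℝ)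
  have he : (fun x : E n => ‖x‖ ^ 2 / 2) = fun x => 1 / 2 * ‖x‖ ^ 2 := by
    funext x; ring
  rw [he]
  refine h.congr_fderiv ?_
  ext y
  simp

lemma hess_half_norm_sq {n : ℕ} (x : E n) : Hess (fun x : E n => ‖x‖ ^ 2 / 2) x = 1 := by
  ext i j
  have h1 : (fun y : E n => fderiv ℝ (fun x : E n => ‖x‖ ^ 2 / 2) y (EuclideanSpace.single j 1)) =
      fun y => innerSL ℝ (EuclideanSpace.single j (1 : ℝ)) y := by
    funext y
    rw [(fderiv_half_norm_sq y).fderiv]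
    simp [innerSL_apply_apply, real_inner_comm]
  simp only [Hess, pd2, Matrix.of_apply]
  rw [h1, ContinuousLinearMap.fderiv, innerSL_apply_apply]
  simp [Matrix.one_apply, EuclideanSpace.inner_single_left, eq_comm]

/-- Uniformly convex perturbation of a potential. -/
def pert {n : ℕ} (u : E n → ℝ) (l : ℝ) (x : E n) : ℝ := u x + l * (‖x‖ ^ 2 / 2)

lemma breg_add_breg {n : ℕ} (u : E n → ℝ) (y z : E n) :
    breg u y z + breg u z y = inner ℝ (gradient u z - gradient u y) (z - y) := by
  rw [inner_sub_left, inner_gradient, inner_gradient]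
  have : fderiv ℝ u z (y - z) = - fderiv ℝ u z (z - y) := by rw [← map_neg, neg_sub]
  unfold breg
  rw [this]; ring

namespace ConvexSetup

variable {n : ℕ} {Ω : Set (E n)} {u : E n → ℝ}

lemma pert (S : ConvexSetup Ω u) {l : ℝ} (hl : 0 ≤ l) : ConvexSetup Ω (pert u l) := by
  refine ⟨S.isOpen, S.smooth.add (contDiffOn_const.mul ?_), S.conv.add ?_⟩
  · exact ((contDiff_norm_sq ℝ).div_const 2).contDiffOn
  · have h1 : ConvexOn ℝ (closure Ω) fun x : E n => ‖x‖ ^ 2 :=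
      (convexOn_norm S.conv.1).pow (fun x _ => norm_nonneg x) 2
    have h2 := h1.smul (c := l / 2) (by positivity)
    refine h2.congr fun x _ => ?_
    simp only [smul_eq_mul]; ring

lemma hess_pert (S : ConvexSetup Ω u) (l : ℝ) {x : E n} (hx : x ∈ Ω) :
    Hess (_root_.pert u l) x = Hess u x + l • (1 : Matrix (Fin n) (Fin n) ℝ) := by
  have h := hess_add_smul (S.contDiffAt_two hx) (g := fun x : E n => ‖x‖ ^ 2 / 2)
    ((contDiff_norm_sq ℝ).div_const 2).contDiffAt 1 l
  rw [one_smul, hess_half_norm_sq] at h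
  rw [← h]
  congr 1
  funext y
  simp [_root_.pert]

lemma breg_pert (S : ConvexSetup Ω u) (l : ℝ) {y : E n} (hy : y ∈ Ω) (z : E n) :
    breg (_root_.pert u l) y z = breg u y z + l / 2 * ‖z - y‖ ^ 2 := by
  have h1 : HasFDerivAt (_root_.pert u l) (fderiv ℝ u y + l • innerSL ℝ y) y :=
    (S.differentiableAt hy).hasFDerivAt.add ((fderiv_half_norm_sq y).const_mul l)
  unfold breg
  rw [h1.fderiv, _root_.add_apply, _root_.smul_apply, innerSL_apply_apply, smul_eq_mul,
    norm_sub_sq_real, inner_sub_right, real_inner_self_eq_norm_sq, real_inner_comm]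
  unfold _root_.pert
  ring

/-- Segments between gradients stay in the image of the gradient. -/
lemma exists_gradient_eq_segment (S : ConvexSetup Ω u) {V : Set (E n)} (hV : IsOpen V)
    (hVc : CptIn V Ω) {ξ ζ : E n} (hξ : ξ ∈ V) {b : ℝ} (hb : breg u ζ ξ ≤ b)
    (hξb : ∀ x ∈ closure V, x ∉ V → b ≤ breg u ξ x) (hζb : ∀ x ∈ closure V, x ∉ V → b ≤ breg u ζ x)
    (hb0 : 0 ≤ b) {r : ℝ} (hr : r ∈ Set.Icc (0 : ℝ) 1) :
    ∃ x ∈ V, gradient u x = gradient u ξ + r • (gradient u ζ - gradient u ξ) := by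
  have hcont : ContinuousOn (fun x => (1 - r) * breg u ξ x + r * breg u ζ x) (closure V) :=
    (continuousOn_const.mul ((S.continuousOn_breg ξ).mono hVc.2)).add
      (continuousOn_const.mul ((S.continuousOn_breg ζ).mono hVc.2))
  obtain ⟨x, hx, hmin⟩ := exists_interior_min hVc.1
    (h := fun x => (1 - r) * breg u ξ x + r * breg u ζ x) hcont hξ (fun w hw hwV => by
      have h1 := hξb w hw hwV
      have h2 := hζb w hw hwV
      rw [breg_self]
      nlinarith [mul_le_mul_of_nonneg_left h1 (sub_nonneg.mpr hr.2),
        mul_le_mul_of_nonneg_left h2 hr.1, mul_le_mul_of_nonneg_left hb hr.1,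
        mul_nonneg (sub_nonneg.mpr hr.2) hb0])
  refine ⟨x, hx, ?_⟩
  have hxΩ := hVc.subset hx
  have hloc := isLocalMin_of_open (h := fun x => (1 - r) * breg u ξ x + r * breg u ζ x) hV hx hmin
  have hd : HasFDerivAt (fun x => (1 - r) * breg u ξ x + r * breg u ζ x)
      ((1 - r) • (fderiv ℝ u x - fderiv ℝ u ξ) + r • (fderiv ℝ u x - fderiv ℝ u ζ)) x :=
    ((S.fderiv_breg ξ hxΩ).const_mul (1 - r)).add ((S.fderiv_breg ζ hxΩ).const_mul r)
  have hz := hloc.hasFDerivAt_eq_zero hd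
  have h3 : fderiv ℝ u x = fderiv ℝ u ξ + r • (fderiv ℝ u ζ - fderiv ℝ u ξ) := by
    rw [← sub_eq_zero, ← hz]; module
  unfold gradient
  rw [h3]
  simp

lemma ofReal_maMeasure_eq_volume_image (S : ConvexSetup Ω u) {A : Set (E n)} (hA : CptIn A Ω)
    (hm : MeasurableSet A) (hdet : ∀ x ∈ A, 0 < (Hess u x).det) :
    ENNReal.ofReal (maMeasure u A) = volume (gradient u '' A) := by
  have h : A ∩ {x | 0 < (Hess u x).det} = A := Set.inter_eq_left.mpr fun x hx => hdet x hx
  rw [S.maMeasure_eq_volume hA hm, h]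

lemma poincare_nondegenerate_real (S : ConvexSetup Ω u) {V W : Set (E n)} (hV : IsOpen V)
    (hVc : CptIn V Ω) (hW : IsOpen W) (hVW : closure V ⊆ W) (hWΩ : W ⊆ Ω)
    (hdet : ∀ x ∈ V, 0 < (Hess u x).det) {w : E n → ℝ} (hw : ContDiffOn ℝ 1 w W)
    {P Q K : Set (E n)} (hPm : MeasurableSet P) (hQm : MeasurableSet Q) (hKm : MeasurableSet K)
    (hPK : P ⊆ K) (hQK : Q ⊆ K) (hKV : K ⊆ V) {L B : ℝ} (hL : 0 < L) (hB : 0 < B)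
    (hseg : ∀ ξ ∈ P, ∀ ζ ∈ Q, ∀ r ∈ Set.Icc (0 : ℝ) 1, ∃ x ∈ V,
      gradient u x = gradient u ξ + r • (gradient u ζ - gradient u ξ))
    (hinner : ∀ ξ ∈ P, ∀ ζ ∈ Q, inner ℝ (gradient u ζ - gradient u ξ) (ζ - ξ) ≤ B)
    (hosc : ∀ ξ ∈ P, ∀ ζ ∈ Q, L ≤ w ζ - w ξ) :
    L ^ 2 * maMeasure u P * maMeasure u Q ≤
      B * (2 ^ n * maMeasure u K * ∫ x in V, energy u w x) := by
  have h := S.poincare_nondegenerate hV hVc.subset hdet (hw.mono (subset_closure.trans hVW)) hPm hQm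
    hPK hQK hKV hL hB hseg hinner hosc
  have hdK : ∀ x ∈ K, 0 < (Hess u x).det := fun x hx => hdet x (hKV hx)
  have hKc := hVc.mono hKV
  have hPc := hKc.mono hPK
  have hQc := hKc.mono hQK
  have hei : IntegrableOn (energy u w) V :=
    (((S.continuousOn_energy hW hWΩ hw).mono hVW).integrableOn_compact hVc.1).mono_set subset_closure
  have he0 : 0 ≤ᵐ[volume.restrict V] energy u w := by
    filter_upwards [ae_restrict_mem hV.measurableSet] with x hx using
      S.energy_nonneg w (hVc.subset hx)
  have hI0 : 0 ≤ ∫ x in V, energy u w x := integral_nonneg_of_ae he0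
  have hK0 := S.maMeasure_nonneg hKc.subset hKm
  rw [← S.ofReal_maMeasure_eq_volume_image hPc hPm fun x hx => hdK x (hPK hx),
    ← S.ofReal_maMeasure_eq_volume_image hQc hQm fun x hx => hdK x (hQK hx),
    ← S.ofReal_maMeasure_eq_volume_image hKc hKm hdK,
    ← ofReal_integral_eq_lintegral_ofReal hei he0,
    show (2 : ENNReal) ^ n = ENNReal.ofReal (2 ^ n) by
      rw [ENNReal.ofReal_pow (by norm_num), ENNReal.ofReal_ofNat],
    ← ENNReal.ofReal_mul (by positivity),
    ← ENNReal.ofReal_mul (mul_nonneg (by positivity) (S.maMeasure_nonneg hPc.subset hPm)),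
    ← ENNReal.ofReal_mul (by positivity), ← ENNReal.ofReal_mul (by positivity),
    ← ENNReal.ofReal_mul hB.le] at h
  exact (ENNReal.ofReal_le_ofReal_iff (by positivity)).mp h

end ConvexSetup

/-- Poincaré inequality for the Monge-Ampère measure. -/
theorem DoublingSetup.poincare {n : ℕ} {Ω : Set (E n)} {u : E n → ℝ} {β ε : ℝ}
    (D : DoublingSetup Ω u β ε) {y : E n} (hy : y ∈ Ω) {s t : ℝ} (hs : 0 < s)
    (hst : (2 + 2 / ε) * s ≤ ε / 20 * t) (hcpt : CptIn (MASection Ω u y t) Ω)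
    {W : Set (E n)} (hW : IsOpen W) (hVW : closure (MASection Ω u y t) ⊆ W) (hWΩ : W ⊆ Ω)
    {w : E n → ℝ} (hw : ContDiffOn ℝ 1 w W)
    {P Q : Set (E n)} (hPm : MeasurableSet P) (hQm : MeasurableSet Q)
    (hPK : P ⊆ MASection Ω u y s) (hQK : Q ⊆ MASection Ω u y s) {L : ℝ} (hL : 0 < L)
    (hosc : ∀ ξ ∈ P, ∀ ζ ∈ Q, L ≤ w ζ - w ξ) :
    L ^ 2 * maMeasure u P * maMeasure u Q ≤ (3 + 4 / ε) * s *
      (2 ^ n * maMeasure u (MASection Ω u y s) * ∫ x in MASection Ω u y t, energy u w x) := by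
  have S := D.convex
  have he0 := D.eps_pos
  have he1 := D.eps_lt
  have hde : 0 < 2 / ε := by positivity
  have ht2 : 2 * s ≤ t := by nlinarith
  have ht : 0 < t := by linarith
  have hsκ : s ≤ ε / 20 * t := by nlinarith
  set V := MASection Ω u y t with hV
  set K := MASection Ω u y s with hK
  have hVo : IsOpen V := S.isOpen_section hcpt
  have hKV : K ⊆ V := section_mono (by linarith)
  have hKc : CptIn K Ω := hcpt.mono hKV
  have hKm : MeasurableSet K := (S.isOpen_section hKc).measurableSet
  have hθ : ∀ ξ ∈ K, ∀ ζ ∈ K, breg u ξ ζ ≤ (1 + 2 / ε) * s := fun ξ hξ ζ hζ =>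
    (D.breg_lt_of_mem hy (hcpt.mono (section_mono ht2)) hξ hζ).le
  obtain ⟨d, hd⟩ := D.bounded.subset_closedBall (0 : E n)
  have hdist : ∀ ξ ∈ K, ∀ ζ ∈ K, ‖ζ - ξ‖ ^ 2 ≤ (2 * d) ^ 2 := fun ξ hξ ζ hζ => by
    have h1 := mem_closedBall_zero_iff.mp (hd (hKc.subset hξ))
    have h2 := mem_closedBall_zero_iff.mp (hd (hKc.subset hζ))
    have := norm_sub_le ζ ξ
    have := norm_nonneg (ζ - ξ)
    exact pow_le_pow_left₀ this (by linarith) 2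
  have hbdry : ∀ ξ ∈ K, ∀ x ∈ closure V, x ∉ V → ε / 20 * t ≤ breg u ξ x := fun ξ hξ x hx hxV => by
    by_contra! hcon
    refine hxV (D.engulfing hy ht hcpt (section_mono hsκ hξ) (mem_section_iff.mpr ⟨?_, hcon⟩))
    exact subset_closure (hcpt.2 hx)
  have hHc : ContinuousOn (fun z : ℝ × E n => Hess u z.2 + z.1 • (1 : Matrix (Fin n) (Fin n) ℝ))
      (Set.Icc 0 1 ×ˢ closure V) := by
    refine ContinuousOn.add ?_ (by fun_prop)
    exact S.continuousOn_hess'.comp continuousOn_snd fun z hz => hcpt.2 hz.2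
  have hlimμ : ∀ A : Set (E n), MeasurableSet A → A ⊆ closure V →
      Filter.Tendsto (fun l => maMeasure (pert u l) A) (𝓝[>] 0) (𝓝 (maMeasure u A)) := by
    intro A hA hAV
    have h1 := tendsto_setIntegral_param
      (f := fun l x => (Hess u x + l • (1 : Matrix (Fin n) (Fin n) ℝ)).det) hcpt.1 hA hAV
      ((Continuous.matrix_det continuous_id).comp_continuousOn hHc)
    simp only [zero_smul, add_zero] at h1
    refine h1.congr fun l => setIntegral_congr_fun hA fun x hx => ?_
    rw [S.hess_pert l (hcpt.2 (hAV hx))]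
  have hlimE : Filter.Tendsto (fun l => ∫ x in V, energy (pert u l) w x) (𝓝[>] 0)
      (𝓝 (∫ x in V, energy u w x)) := by
    have hpd : ∀ i, ContinuousOn (fun x => gradient w x i) (closure V) := fun i => by
      simp only [gradient_apply]
      exact ((hw.continuousOn_fderiv_of_isOpen hW (by norm_num)).clm_apply
        continuousOn_const).mono hVW
    have hadj : ∀ i j, ContinuousOn (fun z : ℝ × E n =>
        (Hess u z.2 + z.1 • (1 : Matrix (Fin n) (Fin n) ℝ)).adjugate i j)
        (Set.Icc 0 1 ×ˢ closure V) := fun i j =>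
      ((Continuous.matrix_adjugate continuous_id).matrix_elem i j).comp_continuousOn hHc
    have h1 := tendsto_setIntegral_param
      (f := fun l x => qf (Hess u x + l • (1 : Matrix (Fin n) (Fin n) ℝ)).adjugate
        (gradient w x) (gradient w x)) hcpt.1 hVo.measurableSet subset_closure
      (by
        unfold qf
        refine continuousOn_finsetSum _ fun i _ => continuousOn_finsetSum _ fun j _ => ?_
        exact ((hadj i j).mul ((hpd i).comp continuousOn_snd fun z hz => hz.2)).mul
          ((hpd j).comp continuousOn_snd fun z hz => hz.2))
    simp only [zero_smul, add_zero] at h1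
    refine h1.congr fun l => setIntegral_congr_fun hVo.measurableSet fun x hx => ?_
    simp only [energy, cofU]
    rw [S.hess_pert l (hcpt.subset hx)]
  have hev : ∀ᶠ l : ℝ in 𝓝[>] 0, 0 < l ∧ l * (2 * d) ^ 2 ≤ s := by
    have h1 : ∀ᶠ l : ℝ in 𝓝 0, l * (2 * d) ^ 2 < s := by
      have : ContinuousAt (fun l : ℝ => l * (2 * d) ^ 2) 0 := by fun_prop
      exact this.eventually_lt continuousAt_const (by simpa using hs)
    filter_upwards [self_mem_nhdsWithin, nhdsWithin_le_nhds h1] with l hl hl' using ⟨hl, hl'.le⟩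
  refine le_of_tendsto_of_tendsto
    (((tendsto_const_nhds.mul (hlimμ P hPm (hPK.trans (hKV.trans subset_closure))))).mul
      (hlimμ Q hQm (hQK.trans (hKV.trans subset_closure))))
    (tendsto_const_nhds.mul ((tendsto_const_nhds.mul
      (hlimμ K hKm (hKV.trans subset_closure))).mul hlimE)) ?_
  filter_upwards [hev] with l hl
  obtain ⟨hl0, hls⟩ := hl
  have Sl := S.pert hl0.le
  have hbl : ∀ ξ ∈ K, ∀ ζ ∈ K, breg (pert u l) ξ ζ ≤ (1 + 2 / ε) * s + s / 2 :=
    fun ξ hξ ζ hζ => by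
      rw [S.breg_pert l (hKc.subset hξ)]
      have h1 := hθ ξ hξ ζ hζ
      have h2 := mul_le_mul_of_nonneg_left (hdist ξ hξ ζ hζ) (by positivity : 0 ≤ l / 2)
      linarith
  have hbo : ∀ ξ ∈ K, ∀ x ∈ closure V, x ∉ V →
      (1 + 2 / ε) * s + s / 2 ≤ breg (pert u l) ξ x := fun ξ hξ x hx hxV => by
    rw [S.breg_pert l (hKc.subset hξ)]
    have h1 := hbdry ξ hξ x hx hxV
    have h2 : 0 ≤ l / 2 * ‖x - ξ‖ ^ 2 := by positivity
    linarith
  refine Sl.poincare_nondegenerate_real hVo hcpt hW hVW hWΩ (fun x hx => ?_) hw hPm hQm hKm hPK hQK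
    hKV hL (by positivity) (fun ξ hξ ζ hζ r hr => ?_) (fun ξ hξ ζ hζ => ?_) hosc
  · rw [S.hess_pert l (hcpt.subset hx)]
    exact (posDef_add_smul_one (S.hess_posSemidef (hcpt.subset hx)) hl0).det_pos
  · exact Sl.exists_gradient_eq_segment hVo hcpt (hKV (hPK hξ)) (hbl ζ (hQK hζ) ξ (hPK hξ))
      (hbo ξ (hPK hξ)) (hbo ζ (hQK hζ)) (by positivity) hr
  · rw [← breg_add_breg]
    have h1 := hbl ξ (hPK hξ) ζ (hQK hζ)
    have h2 := hbl ζ (hQK hζ) ξ (hPK hξ)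
    have h3 : (3 + 4 / ε) * s = 2 * ((1 + 2 / ε) * s + s / 2) := by ring
    linarith

namespace DoublingSetup

set_option maxHeartbeats 1000000 in
/-- Growth lemma: a nonnegative solution that is large on a fixed fraction of a section is bounded
below on a smaller concentric section. -/
theorem exists_growth {n : ℕ} (hn : 0 < n) {β ε δ : ℝ} (hβ : 1 < β) (hε : 0 < ε) (hδ : 0 < δ) :
    ∃ γ : ℝ, 0 < γ ∧ ∀ {Ω : Set (E n)} {u : E n → ℝ}, DoublingSetup Ω u β ε →
      ∀ y ∈ Ω, ∀ s : ℝ, 0 < s → CptIn (MASection Ω u y (4 * ((2 + 2 / ε) / (ε / 20)) * s)) Ω →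
      ∀ v : E n → ℝ, IsSol u v (MASection Ω u y (4 * ((2 + 2 / ε) / (ε / 20)) * s)) →
      (∀ z ∈ MASection Ω u y (4 * ((2 + 2 / ε) / (ε / 20)) * s), 0 ≤ v z) →
      δ * maMeasure u (MASection Ω u y s) ≤ maMeasure u (MASection Ω u y s ∩ {z | 1 ≤ v z}) →
      ∀ z ∈ MASection Ω u y (ε / 20 * s), γ ≤ v z := by
  set κ := ε / 20 with hκ
  have hκ0 : 0 < κ := by positivity
  set ϑ := 2 + 2 / ε with hϑ
  have hϑ2 : 2 ≤ ϑ := by rw [hϑ]; linarith [div_pos two_pos hε]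
  have hϑ0 : 0 < ϑ := by linarith
  obtain ⟨c₁, hc₁, hr₁⟩ := exists_measure_ratio β hβ (κ := κ ^ 2 / ϑ) (by positivity)
  obtain ⟨c₂, hc₂, hcd⟩ := exists_critical_density hn hβ hε
  obtain ⟨c₃, hc₃, hr₃⟩ := exists_measure_ratio β hβ (κ := (4 * (ϑ / κ))⁻¹) (by positivity)
  set M := (3 + 4 / ε) * 2 ^ n * (32 * n) * (κ / (2 * ϑ)) with hM
  have hM0 : 0 ≤ M := by positivity
  set B := M / (c₁ * c₂ * c₃ * δ) with hB
  have hB0 : 0 ≤ B := by positivity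
  refine ⟨Real.exp (-(B + 1)) / 4, by positivity, fun {Ω u} D y hy s hs hcpt v hv hv0 hdens z hz => ?_⟩
  set γ := Real.exp (-(B + 1)) / 4 with hγ
  have hγ0 : 0 < γ := by positivity
  by_contra! hvz
  have S := D.convex
  have he1 := D.eps_lt
  have hκ1 : κ < 1 / 20 := by rw [hκ]; linarith
  have hϑκ : 40 ≤ ϑ / κ := by rw [le_div_iff₀ hκ0]; linarith
  set t := ϑ / κ * s with ht
  have ht0 : 0 < t := by positivity
  have ht40 : 40 * s ≤ t := by rw [ht]; gcongr
  have e4 : 4 * (ϑ / κ) * s = 4 * t := by rw [ht]; ring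
  have hκt : κ * t = ϑ * s := by rw [ht]; field_simp
  rw [e4] at hcpt hv hv0
  have hsub : ∀ {r : ℝ}, r ≤ 4 * t → CptIn (MASection Ω u y r) Ω := fun hr =>
    hcpt.mono (section_mono hr)
  have hcs : CptIn (MASection Ω u y s) Ω := hsub (by linarith)
  have hct : CptIn (MASection Ω u y t) Ω := hsub (by linarith)
  have hzs : z ∈ MASection Ω u y s := section_mono (by nlinarith) hz
  have hzΩ : z ∈ Ω := hcs.subset hzs
  have hzκ : MASection Ω u z (κ * s) ⊆ MASection Ω u y s := D.engulfing hy hs hcs hz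
  have hzϑ : MASection Ω u z (ϑ * s) ⊆ MASection Ω u y t := by
    rw [← hκt]
    exact D.engulfing hy ht0 hct (section_mono (by rw [← hκ, hκt]; nlinarith) hzs)
  have hcϑ : CptIn (MASection Ω u z (ϑ * s)) Ω := hct.mono hzϑ
  have hyz : MASection Ω u y s ⊆ MASection Ω u z (ϑ * s) := fun w hw => by
    refine mem_section_iff.mpr ⟨(mem_section_iff.mp hw).1, ?_⟩
    have := D.breg_lt_of_mem hy (hsub (by linarith)) hzs hw
    rw [hϑ]; linarith
  have hκ2 : κ ^ 2 * s ≤ κ * s := by nlinarith [mul_pos hκ0 hs]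
  have hb0 : 0 < κ ^ 2 * s := by positivity
  have hzb : MASection Ω u z (κ ^ 2 * s) ⊆ MASection Ω u y s := (section_mono hκ2).trans hzκ
  have hso := S.isOpen_section hcs
  have hbo := S.isOpen_section (hcs.mono hzb)
  have hs4 : MASection Ω u y s ⊆ MASection Ω u y (4 * t) := section_mono (by linarith)
  have h4o := S.isOpen_section hcpt
  -- the set where `v` is small
  have hP := hcd D z hzΩ (κ ^ 2 * s) hb0 (hcs.mono (by
    refine Set.Subset.trans (section_mono (le_of_eq ?_)) hzκ
    rw [hκ]; field_simp)) (fun x => γ⁻¹ * v x + 0)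
    ((hv.mono (hzb.trans hs4)).affine hbo _ _)
    (fun x hx => by have := hv0 x (hs4 (hzb hx)); positivity)
    (by rw [add_zero, inv_mul_le_iff₀ hγ0]; linarith)
  have hμb := hr₁ D z hzΩ (ϑ * s) (by positivity) hcϑ (MASection Ω u z (κ ^ 2 * s))
    (section_mono (le_of_eq (by field_simp))) (hcs.mono hzb) hbo.measurableSet
  have hμs := S.maMeasure_mono hcϑ (S.isOpen_section hcϑ).measurableSet hyz
  have hμ4 := hr₃ D y hy (4 * t) (by positivity) hcpt (MASection Ω u y s)
    (section_mono (le_of_eq (by rw [← e4]; field_simp))) hcs hso.measurableSet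
  set P := MASection Ω u z (κ ^ 2 * s / 2) ∩ {x | γ⁻¹ * v x + 0 ≤ 3} with hPdef
  set Q := MASection Ω u y s ∩ {x | 1 ≤ v x} with hQdef
  have hb2 : MASection Ω u z (κ ^ 2 * s / 2) ⊆ MASection Ω u z (κ ^ 2 * s) :=
    section_mono (by linarith)
  have hPK : P ⊆ MASection Ω u y s := (Set.inter_subset_left.trans hb2).trans hzb
  have hPm : MeasurableSet P := measurableSet_inter_le
    (S.isOpen_section (hcs.mono (hb2.trans hzb)))
    (((hv.smooth.continuousOn.mono ((hb2.trans hzb).trans hs4)).const_mul _).add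
      continuousOn_const) continuousOn_const
  have hQm : MeasurableSet Q := measurableSet_inter_le hso continuousOn_const
    (hv.smooth.continuousOn.mono hs4)
  have hsol := hv.affine h4o 1 γ
  have hpos : ∀ x ∈ MASection Ω u y (4 * t), 0 < 1 * v x + γ := fun x hx => by
    have := hv0 x hx; positivity
  have e22 : 2 * (2 * t) = 4 * t := by ring
  have e2t : 2 * t / 2 = t := by ring
  have hcac := S.integral_energy_log_le hy (R := 2 * t) (by positivity)
    (by rwa [e22]) (by rwa [e22]) (by rwa [e22])
  rw [e22, e2t] at hcac
  have hpoin := D.poincare hy hs (t := t) (by rw [← hκ, hκt]) hct h4o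
    (S.closure_section_subset hct (by linarith)) hcpt.subset
    (w := fun x => Real.log (1 * v x + γ))
    ((hsol.smooth.of_le (by norm_num)).log fun x hx => (hpos x hx).ne')
    hPm hQm hPK Set.inter_subset_left (L := B + 1) (by positivity) (fun ξ hξ ζ hζ => by
      have h1 : 1 * v ξ + γ ≤ Real.exp (-(B + 1)) := by
        have h := hξ.2
        rw [Set.mem_ofPred_eq, add_zero, inv_mul_le_iff₀ hγ0] at h
        linarith
      have h2 := (Real.log_le_log (hpos ξ (hs4 (hPK hξ))) h1)
      rw [Real.log_exp] at h2
      have h3 : 0 ≤ Real.log (1 * v ζ + γ) := Real.log_nonneg (by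
        have : 1 ≤ v ζ := hζ.2
        linarith)
      linarith)
  have hμ := S.maMeasure_section_pos hy hs hcs
  set m := maMeasure u (MASection Ω u y s)
  set m₄ := maMeasure u (MASection Ω u y (4 * t))
  have hP' : c₂ * (c₁ * m) ≤ maMeasure u P := by
    refine le_trans ?_ hP
    refine mul_le_mul_of_nonneg_left (le_trans ?_ hμb) hc₂.le
    exact mul_le_mul_of_nonneg_left hμs hc₁.le
  have hm4 : m₄ ≤ m / c₃ := by rw [le_div_iff₀ hc₃]; linarith
  have hchain : (B + 1) ^ 2 * (c₂ * (c₁ * m)) * (δ * m) ≤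
      (3 + 4 / ε) * s * (2 ^ n * m * (32 * n * (m / c₃) / (2 * t))) := by
    calc _ ≤ (B + 1) ^ 2 * maMeasure u P * maMeasure u Q := by
          have : 0 ≤ maMeasure u P := le_trans (by positivity) hP'
          gcongr
      _ ≤ _ := hpoin
      _ ≤ _ := by
          refine mul_le_mul_of_nonneg_left (mul_le_mul_of_nonneg_left (hcac.trans ?_)
            (by positivity)) (by positivity)
          gcongr
  have hrhs : (3 + 4 / ε) * s * (2 ^ n * m * (32 * n * (m / c₃) / (2 * t))) = M * (m ^ 2 / c₃) := by
    rw [hM, ht]; field_simp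
  have hMB : M = B * (c₁ * c₂ * c₃ * δ) := by rw [hB]; field_simp
  rw [hrhs, hMB] at hchain
  have : (B + 1) ^ 2 * (c₁ * c₂ * δ * m ^ 2) ≤ B * (c₁ * c₂ * δ * m ^ 2) := by
    calc _ = (B + 1) ^ 2 * (c₂ * (c₁ * m)) * (δ * m) := by ring
      _ ≤ _ := hchain
      _ = _ := by field_simp
  have h5 := le_of_mul_le_mul_right this (by positivity)
  nlinarith

end DoublingSetup

namespace DoublingSetup

lemma exists_growth_scaled {n : ℕ} (hn : 0 < n) {β ε δ : ℝ} (hβ : 1 < β) (hε : 0 < ε)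
    (hδ : 0 < δ) :
    ∃ γ : ℝ, 0 < γ ∧ ∀ {Ω : Set (E n)} {u : E n → ℝ}, DoublingSetup Ω u β ε →
      ∀ y ∈ Ω, ∀ s : ℝ, 0 < s → CptIn (MASection Ω u y (4 * ((2 + 2 / ε) / (ε / 20)) * s)) Ω →
      ∀ v : E n → ℝ, IsSol u v (MASection Ω u y (4 * ((2 + 2 / ε) / (ε / 20)) * s)) →
      (∀ z ∈ MASection Ω u y (4 * ((2 + 2 / ε) / (ε / 20)) * s), 0 ≤ v z) →
      ∀ a : ℝ, 0 < a →
      δ * maMeasure u (MASection Ω u y s) ≤ maMeasure u (MASection Ω u y s ∩ {z | a ≤ v z}) →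
      ∀ z ∈ MASection Ω u y (ε / 20 * s), γ * a ≤ v z := by
  obtain ⟨γ, hγ, h⟩ := exists_growth hn hβ hε hδ
  refine ⟨γ, hγ, fun {Ω u} D y hy s hs hcpt v hv hv0 a ha hd z hz => ?_⟩
  have hset : {z : E n | 1 ≤ a⁻¹ * v z + 0} = {z | a ≤ v z} := by
    ext x
    simp only [Set.mem_ofPred_eq, add_zero, le_inv_mul_iff₀ ha, mul_one]
  have := h D y hy s hs hcpt (fun x => a⁻¹ * v x + 0)
    (hv.affine (D.convex.isOpen_section hcpt) _ _)
    (fun x hx => by have := hv0 x hx; positivity) (by rwa [hset]) z hz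
  rwa [add_zero, le_inv_mul_iff₀ ha, mul_comm] at this

/-- Expansion of positivity, from a point where a solution almost attains its maximum, and from
a section to its double. -/
lemma exists_expansion {n : ℕ} (hn : 0 < n) {β ε : ℝ} (hβ : 1 < β) (hε : 0 < ε) (hε1 : ε < 1) :
    ∃ γ : ℝ, 0 < γ ∧ ∃ Λ : ℝ, 20 / ε ≤ Λ ∧
      ∀ {Ω : Set (E n)} {u : E n → ℝ}, DoublingSetup Ω u β ε →
      ∀ y ∈ Ω, ∀ s : ℝ, 0 < s → CptIn (MASection Ω u y (Λ * s)) Ω →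
      ∀ v : E n → ℝ, IsSol u v (MASection Ω u y (Λ * s)) →
      (∀ z ∈ MASection Ω u y (Λ * s), 0 ≤ v z) → ∀ a : ℝ, 0 < a →
      ((∀ z ∈ MASection Ω u y s, a ≤ v z) → ∀ z ∈ MASection Ω u y (2 * s), γ * a ≤ v z) ∧
      ((∀ z ∈ MASection Ω u y s, v z ≤ 5 / 4 * a) → v y = a →
        ∀ z ∈ MASection Ω u y (ε / 20 * s), γ * a ≤ v z) := by
  set κ := ε / 20 with hκ
  have hκ0 : 0 < κ := by positivity
  have hκ1 : κ < 1 / 20 := by rw [hκ]; linarith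
  obtain ⟨c₁, hc₁, hr₁⟩ := exists_measure_ratio β hβ (κ := κ / 2) (by positivity)
  obtain ⟨c₂, hc₂, hcd⟩ := exists_critical_density hn hβ hε
  obtain ⟨γ₁, hγ₁, hg₁⟩ := exists_growth_scaled hn hβ hε hc₁
  obtain ⟨γ₂, hγ₂, hg₂⟩ := exists_growth_scaled hn hβ hε hc₂
  set Λ := 4 * ((2 + 2 / ε) / κ) with hΛ
  have hΛκ : 20 / ε ≤ Λ := by
    have h1 : 20 / ε = 1 / κ := by rw [hκ]; field_simp
    have h2 : 0 < 2 / ε := by positivity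
    rw [h1, hΛ, ← mul_div_assoc]
    gcongr
    linarith
  have h20 : 20 ≤ 20 / ε := by rw [le_div_iff₀ hε]; linarith
  have hΛ20 : 20 ≤ Λ := by linarith
  have hκ2 : 1 ≤ 2 / κ := by rw [le_div_iff₀ hκ0]; linarith
  have hΛΛ : Λ ≤ Λ * (2 / κ) := le_mul_of_one_le_right (by linarith) hκ2
  refine ⟨min γ₁ (γ₂ / 2), by positivity, Λ * (2 / κ), hΛκ.trans hΛΛ,
    fun {Ω u} D y hy s hs hcpt v hv hv0 a ha => ⟨fun hav z hz => ?_, fun hav hya z hz => ?_⟩⟩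
  · have e : Λ * (2 / κ) * s = Λ * (2 / κ * s) := by ring
    rw [e] at hcpt hv hv0
    have hs2 : s ≤ 2 / κ * s := le_mul_of_one_le_left hs.le hκ2
    have hc : CptIn (MASection Ω u y (2 / κ * s)) Ω :=
      hcpt.mono (section_mono (le_mul_of_one_le_left (by positivity) (by linarith)))
    have hss : MASection Ω u y s ⊆ MASection Ω u y (2 / κ * s) := section_mono hs2
    have ho := D.convex.isOpen_section hc
    have hm : MeasurableSet (MASection Ω u y (2 / κ * s) ∩ {z | a ≤ v z}) :=
      measurableSet_inter_le ho continuousOn_const (hv.smooth.continuousOn.mono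
        (section_mono (le_mul_of_one_le_left (by positivity) (by linarith))))
    have hd := hr₁ D y hy (2 / κ * s) (by positivity) hc
      (MASection Ω u y (2 / κ * s) ∩ {z | a ≤ v z}) (by
        have : κ / 2 * (2 / κ * s) = s := by field_simp
        rw [this]
        exact fun w hw => ⟨hss hw, hav w hw⟩) (hc.mono Set.inter_subset_left) hm
    refine le_trans (mul_le_mul_of_nonneg_right (min_le_left _ _) ha.le)
      (hg₁ D y hy (2 / κ * s) (by positivity) hcpt v hv hv0 a ha hd z ?_)
    have : κ * (2 / κ * s) = 2 * s := by field_simp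
    rwa [this]
  · have hsub : MASection Ω u y (Λ * s) ⊆ MASection Ω u y (Λ * (2 / κ) * s) :=
      section_mono (mul_le_mul_of_nonneg_right hΛΛ hs.le)
    have hc : CptIn (MASection Ω u y (Λ * s)) Ω := hcpt.mono hsub
    have hss : MASection Ω u y s ⊆ MASection Ω u y (Λ * s) :=
      section_mono (le_mul_of_one_le_left hs.le (by linarith))
    have ho := D.convex.isOpen_section (hc.mono hss)
    have hvs := (hv.mono hsub).mono hss
    have hd := hcd D y hy s hs (hc.mono (section_mono (mul_le_mul_of_nonneg_right hΛκ hs.le)))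
      (fun x => (-4 / a) * v x + 5) (hvs.affine ho _ _) (fun x hx => by
        have h1 := mul_le_mul_of_nonneg_left (hav x hx) (by positivity : 0 ≤ 4 / a)
        have h2 : 4 / a * (5 / 4 * a) = 5 := by field_simp
        have h3 : -4 / a * v x = - (4 / a * v x) := by ring
        linarith) (by rw [hya]; field_simp; norm_num)
    have hm : MeasurableSet (MASection Ω u y s ∩ {z | a / 2 ≤ v z}) :=
      measurableSet_inter_le ho continuousOn_const hvs.smooth.continuousOn
    have hd' := hd.trans (D.convex.maMeasure_mono ((hc.mono hss).mono Set.inter_subset_left) hm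
      (Set.inter_subset_inter (section_mono (by linarith)) fun x hx => by
        simp only [Set.mem_ofPred_eq] at hx ⊢
        have h3 : -4 / a * v x = - (4 * v x / a) := by ring
        have h4 : 2 ≤ 4 * v x / a := by linarith
        rw [le_div_iff₀ ha] at h4
        linarith))
    have := hg₂ D y hy s hs hc v (hv.mono hsub) (fun x hx => hv0 x (hsub hx)) (a / 2)
      (by positivity) hd' z hz
    refine le_trans ?_ this
    rw [← mul_div_assoc, mul_div_right_comm]
    exact mul_le_mul_of_nonneg_right (min_le_right _ _) ha.le

lemma dilate_mem {n : ℕ} {Ω : Set (E n)} {u : E n → ℝ} {β ε : ℝ} (D : DoublingSetup Ω u β ε)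
    {y : E n} (hy : y ∈ Ω) {R : ℝ} (hR : 0 < R) (hcpt : CptIn (MASection Ω u y R) Ω) (k : ℕ)
    {z : E n} (hz : z ∈ MASection Ω u y (R / 2 ^ k)) :
    y + (1 + ε) ^ k • (z - y) ∈ MASection Ω u y R := by
  induction k generalizing z with
  | zero => simpa using hz
  | succ k ih =>
    have h2 : R / 2 ^ (k + 1) = R / 2 ^ k / 2 := by rw [pow_succ, div_div]
    have hle : R / 2 ^ k ≤ R := div_le_self hR.le (one_le_pow₀ (by norm_num))
    have h0 : 0 < R / 2 ^ k := by positivity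
    rw [h2] at hz
    have := ih (D.add_smul_mem hy h0 (hcpt.mono (section_mono hle))
      (section_mono (by linarith) hz) (mem_section_iff.mp hz).2.le)
    convert this using 2
    rw [pow_succ]
    module

end DoublingSetup

namespace DoublingSetup

set_option maxHeartbeats 1000000 in
/-- Harnack inequality under the doubling condition. -/
theorem exists_harnack {n : ℕ} (hn : 0 < n) {β ε : ℝ} (hβ : 1 < β) (hε : 0 < ε) (hε1 : ε < 1) :
    ∃ τ : ℝ, 0 < τ ∧ τ < 1 ∧ ∃ C : ℝ, 0 < C ∧ ∀ {Ω : Set (E n)} {u : E n → ℝ},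
      DoublingSetup Ω u β ε → ∀ x ∈ Ω, ∀ t : ℝ, 0 < t → CptIn (MASection Ω u x t) Ω →
      ∀ v : E n → ℝ, IsSol u v (MASection Ω u x t) → (∀ y ∈ MASection Ω u x t, 0 ≤ v y) →
      ∀ y ∈ MASection Ω u x (τ * t), ∀ z ∈ MASection Ω u x (τ * t), v y ≤ C * v z := by
  obtain ⟨γ, hγ, Λ, hΛ, hexp⟩ := exists_expansion hn hβ hε hε1
  set κ := ε / 20 with hκ
  have hκ0 : 0 < κ := by positivity
  have hκ1 : κ < 1 / 20 := by rw [hκ]; linarith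
  have h20 : 20 / ε = 1 / κ := by rw [hκ]; field_simp
  have hΛκ : 1 ≤ Λ * κ := by rwa [h20, div_le_iff₀ hκ0] at hΛ
  have hΛ0 : 0 < Λ := by
    by_contra! h
    nlinarith
  have hΛ20 : 20 ≤ Λ := by nlinarith
  set θ := 1 + 2 / ε with hθ
  have hθ1 : 1 ≤ θ := by rw [hθ]; linarith [div_pos two_pos hε]
  obtain ⟨q, hq⟩ := pow_unbounded_of_one_lt γ⁻¹ (show 1 < 1 + ε by linarith)
  set p := q + 1 with hp
  have hγp : 1 ≤ γ * (1 + ε) ^ p := by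
    have h1 : (1 + ε) ^ q ≤ (1 + ε) ^ p := pow_le_pow_right₀ (by linarith) (by omega)
    rw [← inv_le_iff_one_le_mul₀' hγ]
    exact hq.le.trans h1
  obtain ⟨j, hj⟩ := pow_unbounded_of_one_lt (θ / κ) one_lt_two
  rw [div_lt_iff₀ hκ0] at hj
  have hj1 : (1 : ℝ) ≤ 2 ^ j := one_le_pow₀ (by norm_num)
  set σ : ℝ := 1 / (5 * p) with hσ
  have hp0 : (0 : ℝ) < p := by rw [hp]; positivity
  have hσ0 : 0 < σ := by positivity
  have hpσ : p * σ = 1 / 5 := by rw [hσ]; field_simp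
  have hσ1 : σ ≤ 1 / 5 := by
    have : (1 : ℝ) ≤ p := by rw [hp]; push_cast; linarith [Nat.cast_nonneg (α := ℝ) q]
    nlinarith
  have hbern : 4 / 5 ≤ (1 - σ) ^ p := by
    have := one_add_mul_le_pow (a := -σ) (by linarith) p
    rw [← sub_eq_add_neg 1 σ] at this
    linarith
  set τ := κ / (Λ * 2 ^ j) with hτ
  have hτ0 : 0 < τ := by positivity
  have hτΛ : Λ * 2 ^ j * τ = κ := by rw [hτ]; field_simp
  have hτκ : τ ≤ κ := by
    rw [hτ]
    exact div_le_self hκ0.le (one_le_mul_of_one_le_of_one_le (by linarith) hj1)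
  set c := γ ^ (j + 1) * (σ * τ / (1 + ε)) ^ p with hc
  have hc0 : 0 < c := by positivity
  refine ⟨τ / 2, by positivity, by linarith, 2 ^ p / c, by positivity,
    fun {Ω u} D x hx t ht hcpt v hv hv0 y hy z hz => ?_⟩
  have S := D.convex
  have hτt : 0 < τ * t := by positivity
  have hτt1 : τ * t < t := mul_lt_of_lt_one_left ht (by linarith)
  have hcτ : CptIn (MASection Ω u x (τ * t)) Ω := hcpt.mono (section_mono hτt1.le)
  have hcl := S.closure_section_subset hcτ hτt1
  have hvc := hv.smooth.continuousOn
  set d : E n → ℝ := fun w => 1 - breg u x w / (τ * t) with hd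
  have hdc : ContinuousOn d (closure (MASection Ω u x (τ * t))) :=
    continuousOn_const.sub (((S.continuousOn_breg x).mono hcτ.2).div_const _)
  obtain ⟨x₀, hx₀, hmax⟩ := hcτ.1.exists_isMaxOn
    ⟨x, subset_closure (self_mem hx hτt)⟩ ((hvc.mono hcl).mul (hdc.pow p))
  have hdmem : ∀ w ∈ MASection Ω u x (τ * t), 0 < d w := fun w hw => by
    have := (mem_section_iff.mp hw).2
    simp only [hd, sub_pos]
    rwa [div_lt_one hτt]
  have hhalf : τ / 2 * t ≤ τ * t := mul_le_mul_of_nonneg_right (by linarith) ht.le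
  have hdy : 1 / 2 ≤ d y := by
    have := (mem_section_iff.mp hy).2
    have h2 : breg u x y / (τ * t) ≤ 1 / 2 := by
      rw [div_le_iff₀ hτt]; linarith
    simp only [hd]; linarith
  have hvy : v y * (1 / 2) ^ p ≤ v x₀ * d x₀ ^ p := by
    refine le_trans ?_ (hmax (subset_closure (section_mono hhalf hy)))
    exact mul_le_mul_of_nonneg_left (pow_le_pow_left₀ (by norm_num) hdy p)
      (hv0 y (section_mono (hhalf.trans hτt1.le) hy))
  have hz' : z ∈ MASection Ω u x (τ * t) := section_mono hhalf hz
  suffices hmain : c * (v x₀ * d x₀ ^ p) ≤ v z by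
    rw [div_mul_eq_mul_div, le_div_iff₀ hc0]
    rw [one_div, inv_pow, ← div_eq_mul_inv, div_le_iff₀ (by positivity)] at hvy
    calc v y * c ≤ v x₀ * d x₀ ^ p * 2 ^ p * c := mul_le_mul_of_nonneg_right hvy hc0.le
      _ = 2 ^ p * (c * (v x₀ * d x₀ ^ p)) := by ring
      _ ≤ 2 ^ p * v z := mul_le_mul_of_nonneg_left hmain (by positivity)
  have hvx₀ := hv0 x₀ (hcl hx₀)
  have hvz := hv0 z (section_mono hτt1.le hz')
  rcases hvx₀.eq_or_lt with h0 | hK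
  · rw [← h0]; simpa using hvz
  have hx₀Ω : x₀ ∈ Ω := hcτ.2 hx₀
  have hbx₀ := S.breg_le_of_mem_closure hcτ hx₀
  have hd0' : 0 ≤ d x₀ := by
    simp only [hd, sub_nonneg]
    exact div_le_one_of_le₀ hbx₀ hτt.le
  rcases hd0'.eq_or_lt with h0 | hd0
  · rw [← h0, zero_pow (by omega)]; simpa using hvz
  have hbn := S.breg_nonneg hx (subset_closure hx₀Ω)
  have hbd : breg u x x₀ = τ * t * (1 - d x₀) := by
    simp only [hd, sub_sub_cancel]; field_simp
  have hd1 : d x₀ ≤ 1 := by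
    simp only [hd]
    linarith [div_nonneg hbn hτt.le]
  have hx₀τ : x₀ ∈ MASection Ω u x (τ * t) :=
    mem_section_iff.mpr ⟨subset_closure hx₀Ω, by
      rw [hbd]; exact mul_lt_of_lt_one_right hτt (by linarith)⟩
  -- the scale on which `v` is comparable to its value at `x₀`
  obtain ⟨ρ, k, hρk, hρ0, hρle, hρge⟩ : ∃ ρ : ℝ, ∃ k : ℕ, ρ * (1 + ε) ^ k = 1 ∧ 0 < ρ ∧
      ρ ≤ σ * τ * d x₀ ∧ σ * τ * d x₀ / (1 + ε) ≤ ρ := by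
    have hb0 : 0 < σ * τ * d x₀ := by positivity
    have hb1 : σ * τ * d x₀ ≤ 1 :=
      mul_le_one₀ (mul_le_one₀ (by linarith) hτ0.le (by linarith)) hd0' hd1
    obtain ⟨m, hm1, hm2⟩ := exists_nat_pow_near ((one_le_inv₀ hb0).mpr hb1)
      (show 1 < 1 + ε by linarith)
    have hpow : 0 < (1 + ε) ^ m := by positivity
    refine ⟨((1 + ε) ^ (m + 1))⁻¹, m + 1, inv_mul_cancel₀ (by positivity), by positivity, ?_, ?_⟩
    · exact inv_le_of_inv_le₀ hb0 hm2.le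
    · rw [pow_succ, mul_inv, ← div_eq_mul_inv]
      exact div_le_div_of_nonneg_right ((le_inv_comm₀ hpow hb0).mp hm1) (by linarith)
  have hxκ : x₀ ∈ MASection Ω u x (κ * t) :=
    section_mono (mul_le_mul_of_nonneg_right hτκ ht.le) hx₀τ
  have heng : MASection Ω u x₀ (κ * t) ⊆ MASection Ω u x t := D.engulfing hx ht hcpt hxκ
  have hsub : ∀ {s : ℝ}, s ≤ 2 ^ j * (τ * t) →
      MASection Ω u x₀ (Λ * s) ⊆ MASection Ω u x t := fun {s} hs => by
    refine Set.Subset.trans (section_mono ?_) heng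
    calc Λ * s ≤ Λ * (2 ^ j * (τ * t)) := mul_le_mul_of_nonneg_left hs hΛ0.le
      _ = Λ * 2 ^ j * τ * t := by ring
      _ = κ * t := by rw [hτΛ]
  have hsub1 : MASection Ω u x₀ (τ * t) ⊆ MASection Ω u x t := by
    refine Set.Subset.trans (section_mono ?_) 
      (hsub (s := τ * t) (le_mul_of_one_le_left hτt.le hj1))
    exact le_mul_of_one_le_left hτt.le (by linarith)
  set r := τ * t / 2 ^ k with hr
  have hr0 : 0 < r := by positivity
  have hrR : r ≤ τ * t := div_le_self hτt.le (one_le_pow₀ (by norm_num))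
  have hnear : ∀ w ∈ MASection Ω u x₀ r, v w ≤ 5 / 4 * v x₀ := fun w hw => by
    have hw' := D.dilate_mem hx₀Ω hτt (hcpt.mono hsub1) k hw
    set w' := x₀ + (1 + ε) ^ k • (w - x₀) with hw'def
    have hww' : w = x₀ + ρ • (w' - x₀) := by
      rw [hw'def, add_sub_cancel_left, smul_smul, hρk, one_smul, add_sub_cancel]
    have hw't := mem_section_iff.mp (hsub1 hw')
    have hρ1 : ρ ≤ 1 :=
      (le_mul_of_one_le_right hρ0.le (one_le_pow₀ (by linarith))).trans_eq hρk
    have hseg := S.breg_segment (y := x) (subset_closure hx₀Ω) hw't.1 hρ0.le hρ1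
    rw [← hww'] at hseg
    have hbw : breg u x w ≤ τ * t * (1 - (1 - σ) * d x₀) := by
      have h1 : ρ * breg u x w' ≤ σ * τ * d x₀ * t := by
        have hw0 := hw't.2.le
        calc ρ * breg u x w' ≤ ρ * t := mul_le_mul_of_nonneg_left hw0 hρ0.le
          _ ≤ _ := mul_le_mul_of_nonneg_right hρle ht.le
      have h2 : 0 ≤ ρ * breg u x x₀ := by positivity
      rw [hbd] at hseg h2
      linarith
    have hdw : (1 - σ) * d x₀ ≤ d w := by
      have : breg u x w / (τ * t) ≤ 1 - (1 - σ) * d x₀ := by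
        rw [div_le_iff₀ hτt]; linarith
      simp only [hd] at this ⊢; linarith
    have hdw0 : 0 < (1 - σ) * d x₀ := mul_pos (by linarith) hd0
    have hwτ : w ∈ MASection Ω u x (τ * t) :=
      mem_section_iff.mpr ⟨(mem_section_iff.mp hw).1,
        hbw.trans_lt (mul_lt_of_lt_one_right hτt (by linarith))⟩
    have hm : v w * d w ^ p ≤ v x₀ * d x₀ ^ p := hmax (subset_closure hwτ)
    have hvw := hv0 w (section_mono hτt1.le hwτ)
    have h3 : v w * (4 / 5) * d x₀ ^ p ≤ v x₀ * d x₀ ^ p := by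
      calc v w * (4 / 5) * d x₀ ^ p ≤ v w * (1 - σ) ^ p * d x₀ ^ p := by gcongr
        _ = v w * ((1 - σ) * d x₀) ^ p := by rw [mul_pow]; ring
        _ ≤ v w * d w ^ p := by gcongr
        _ ≤ _ := hm
    have h4 := le_of_mul_le_mul_right h3 (by positivity)
    linarith
  have hgrow : ∀ i ≤ k + j, ∀ w ∈ MASection Ω u x₀ (2 ^ i * (κ * r)),
      γ ^ (i + 1) * v x₀ ≤ v w := by
    intro i
    induction i with
    | zero =>
      intro _ w hw
      have hs := hsub (s := r) (hrR.trans (le_mul_of_one_le_left hτt.le hj1))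
      rw [pow_zero, one_mul] at hw
      simpa using (hexp D x₀ hx₀Ω r hr0 (hcpt.mono hs) v (hv.mono hs) (fun a ha => hv0 a (hs ha))
        (v x₀) hK).2 hnear rfl w hw
    | succ i ih =>
      intro hi w hw
      have hle : 2 ^ i * (κ * r) ≤ 2 ^ j * (τ * t) := by
        have h1 : (2 : ℝ) ^ i ≤ 2 ^ (k + j) := pow_le_pow_right₀ (by norm_num) (by omega)
        calc 2 ^ i * (κ * r) ≤ 2 ^ (k + j) * (1 * r) := by gcongr; linarith
          _ = 2 ^ j * (τ * t) := by rw [hr, pow_add]; field_simp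
      have hs := hsub hle
      have := (hexp D x₀ hx₀Ω (2 ^ i * (κ * r)) (by positivity) (hcpt.mono hs) v (hv.mono hs)
        (fun a ha => hv0 a (hs ha)) (γ ^ (i + 1) * v x₀) (by positivity)).1 (ih (by omega)) w
        (by rwa [← mul_assoc, ← pow_succ'])
      rwa [← mul_assoc, ← pow_succ'] at this
  have hzmem : z ∈ MASection Ω u x₀ (2 ^ (k + j) * (κ * r)) := by
    refine mem_section_iff.mpr ⟨(mem_section_iff.mp hz').1, ?_⟩
    have h1 := D.breg_lt_of_mem hx (hcpt.mono (section_mono (by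
      have := mul_le_mul_of_nonneg_right (hτκ.trans hκ1.le) ht.le
      linarith))) hx₀τ hz'
    have h2 : 2 ^ (k + j) * (κ * r) = 2 ^ j * κ * (τ * t) := by rw [hr, pow_add]; field_simp
    rw [h2]
    exact h1.trans_le (mul_le_mul_of_nonneg_right hj.le hτt.le)
  refine le_trans ?_ (hgrow (k + j) le_rfl z hzmem)
  have hγk : ρ ^ p ≤ γ ^ k := by
    have h1 : 1 ≤ (γ * (1 + ε) ^ p) ^ k := one_le_pow₀ hγp
    calc ρ ^ p = ρ ^ p * 1 := (mul_one _).symm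
      _ ≤ ρ ^ p * (γ * (1 + ε) ^ p) ^ k := by gcongr
      _ = γ ^ k * (ρ * (1 + ε) ^ k) ^ p := by
          rw [mul_pow, mul_pow, ← pow_mul, ← pow_mul, mul_comm p k]; ring
      _ = γ ^ k := by rw [hρk, one_pow, mul_one]
  calc c * (v x₀ * d x₀ ^ p) = γ ^ (j + 1) * (σ * τ * d x₀ / (1 + ε)) ^ p * v x₀ := by
        rw [hc, mul_div_right_comm (σ * τ) (d x₀), mul_pow (σ * τ / (1 + ε)) (d x₀)]; ring
    _ ≤ γ ^ (j + 1) * ρ ^ p * v x₀ := by gcongr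
    _ ≤ γ ^ (j + 1) * γ ^ k * v x₀ := by gcongr
    _ = γ ^ (k + j + 1) * v x₀ := by rw [← pow_add]; congr 2; omega

end DoublingSetup

end

/-- Theorem 2.5: Maldonado's Harnack inequality for the linearized Monge-Ampère
equation under the doubling condition. -/
theorem maldonado_harnack (n : ℕ) (hn : 2 ≤ n) (α β : ℝ) :
    ∃ τ : ℝ, 0 < τ ∧ τ < 1 ∧ ∃ C > 0, ∀ (Ω : Set (E n)) (u : E n → ℝ),
      MASetup Ω u → DoublingCM Ω u α β →
      ∀ x ∈ Ω, ∀ t : ℝ, 0 < t → CptIn (MASection Ω u x t) Ω →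
      ∀ v : E n → ℝ, ContDiffOn ℝ 2 v (MASection Ω u x t) →
        (∀ y ∈ MASection Ω u x t, 0 ≤ v y) →
        (∀ y ∈ MASection Ω u x t, ∑ i, ∑ j, cofU u y i j * pd2 v y i j = 0) →
        ∀ y ∈ MASection Ω u x (τ * t), ∀ z ∈ MASection Ω u x (τ * t), v y ≤ C * v z := by
  by_cases h : (0 < α ∧ α < 1) ∧ 1 < β
  · obtain ⟨⟨h0, h1⟩, hβ⟩ := h
    obtain ⟨ε, hε, hε1, hD⟩ := exists_doublingSetup n h0 h1 hβ
    obtain ⟨τ, hτ, hτ1, C, hC, hH⟩ := DoublingSetup.exists_harnack (by omega : 0 < n) hβ hε hε1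
    exact ⟨τ, hτ, hτ1, C, hC, fun Ω u hM hDC x hx t ht hcpt v hv hv0 heq =>
      hH (hD Ω u hM hDC) x hx t ht hcpt v ⟨hv, heq⟩ hv0⟩
  · exact ⟨1 / 2, by norm_num, by norm_num, 1, one_pos,
      fun Ω u _ hD => absurd ⟨⟨hD.1, hD.2.1⟩, hD.2.2.1⟩ h⟩
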